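/- arXiv:1208.4714 — 3 statements merged into one kernel-verified Lean document; each statement's English description precedes it below -/
import Mathlib

section
/- (Cheap structure theorem.) Let K ≥ 1 be a real number and let P be a set of n points in the real projective plane ℝP² spanning at most Kn ordinary lines. Then P is contained in the union of at most 500K cubic curves. -/
/-- The real projective plane: one-dimensional subspaces of `ℝ³`. -/
abbrev RP2 := Projectivization ℝ (Fin 3 → ℝ)

/-- A line in `ℝP²`: the set of points contained in a fixed
two-dimensional linear subspace of `ℝ³`. -/
def IsProjLine (L : Set RP2) : Prop :=
  ∃ W : Submodule ℝ (Fin 3 → ℝ), Module.finrank ℝ W = 2 ∧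
    L = {x : RP2 | x.submodule ≤ W}

/-- The number of ordinary lines of `P`: lines containing exactly two points of `P`. -/
noncomputable def numOrdinaryLines (P : Set RP2) : ℕ :=
  {L : Set RP2 | IsProjLine L ∧ (P ∩ L).ncard = 2}.ncard

/-- A cubic curve in `ℝP²`: the zero set of a nonzero homogeneous polynomial of
degree `3` in three real variables (not necessarily irreducible). -/
def IsCubicCurve (Z : Set RP2) : Prop :=
  ∃ p : MvPolynomial (Fin 3) ℝ, p ≠ 0 ∧ p.IsHomogeneous 3 ∧
    Z = {x : RP2 | MvPolynomial.eval x.rep p = 0}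

set_option linter.unusedSectionVars false

namespace Cheap

/-- Vectors of `ℝ³`. -/
abbrev E3 := Fin 3 → ℝ

/-- Dot product on `ℝ³`. -/
def dt (x y : E3) : ℝ := x 0 * y 0 + x 1 * y 1 + x 2 * y 2

/-- Cross product on `ℝ³`. -/
def cr (x y : E3) : E3 :=
  ![x 1 * y 2 - x 2 * y 1, x 2 * y 0 - x 0 * y 2, x 0 * y 1 - x 1 * y 0]

theorem dt_add (x y z : E3) : dt x (y + z) = dt x y + dt x z := by
  simp [dt]; ring

theorem dt_sub (x y z : E3) : dt x (y - z) = dt x y - dt x z := by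
  simp [dt]; ring

theorem dt_smul (x : E3) (c : ℝ) (y : E3) : dt x (c • y) = c * dt x y := by
  simp [dt]; ring

theorem dt_neg (x y : E3) : dt x (-y) = - dt x y := by
  simp [dt]; ring

theorem dt_zero (x : E3) : dt x 0 = 0 := by
  simp [dt]

theorem dt_comm (x y : E3) : dt x y = dt y x := by
  simp only [dt]; ring

theorem dt_cr_left (x y : E3) : dt x (cr x y) = 0 := by
  simp [dt, cr]; ring

theorem dt_cr_right (x y : E3) : dt y (cr x y) = 0 := by
  simp [dt, cr]; ring

theorem dt_self_pos {x : E3} (h : x ≠ 0) : 0 < dt x x := by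
  have h2 : ∃ i, x i ≠ 0 := by
    by_contra hc
    push Not at hc
    exact h (funext hc)
  obtain ⟨i, hi⟩ := h2
  have := mul_self_pos.mpr hi
  simp only [dt]
  fin_cases i <;> simp only [Fin.zero_eta, Fin.mk_one, Fin.reduceFinMk] at this <;>
    nlinarith [mul_self_nonneg (x 0), mul_self_nonneg (x 1), mul_self_nonneg (x 2)]

/-- A vector orthogonal to two independent vectors is a multiple of the cross product. -/
theorem eq_smul_cr {x y v : E3} (h : cr x y ≠ 0) (hx : dt x v = 0) (hy : dt y v = 0) :
    ∃ t : ℝ, v = t • cr x y := by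
  have hp := dt_self_pos h
  refine ⟨dt (cr x y) v / dt (cr x y) (cr x y), ?_⟩
  have key : dt (cr x y) (cr x y) • v = dt (cr x y) v • cr x y := by
    simp only [dt] at hx hy
    ext i
    fin_cases i <;> simp [dt, cr]
    · linear_combination (-(x 1 * y 2 - x 2 * y 1) * 0 + (y 0 * (x 0 * y 0 + x 1 * y 1 + x 2 * y 2) - x 0 * (y 0 * y 0 + y 1 * y 1 + y 2 * y 2)) * (-1)) * hx + (x 0 * (x 0 * y 0 + x 1 * y 1 + x 2 * y 2) - y 0 * (x 0 * x 0 + x 1 * x 1 + x 2 * x 2)) * (-1) * hy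
    · linear_combination ((y 1 * (x 0 * y 0 + x 1 * y 1 + x 2 * y 2) - x 1 * (y 0 * y 0 + y 1 * y 1 + y 2 * y 2)) * (-1)) * hx + (x 1 * (x 0 * y 0 + x 1 * y 1 + x 2 * y 2) - y 1 * (x 0 * x 0 + x 1 * x 1 + x 2 * x 2)) * (-1) * hy
    · linear_combination ((y 2 * (x 0 * y 0 + x 1 * y 1 + x 2 * y 2) - x 2 * (y 0 * y 0 + y 1 * y 1 + y 2 * y 2)) * (-1)) * hx + (x 2 * (x 0 * y 0 + x 1 * y 1 + x 2 * y 2) - y 2 * (x 0 * x 0 + x 1 * x 1 + x 2 * x 2)) * (-1) * hy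
  rw [div_eq_inv_mul, mul_smul, ← key, smul_smul, inv_mul_cancel₀ hp.ne', one_smul]

/-- The kernel of a vector seen as a linear form. -/
def kr (v : E3) : Submodule ℝ E3 where
  carrier := {x | dt v x = 0}
  add_mem' := by
    intro x y hx hy
    simp only [Set.mem_ofPred_eq] at *
    rw [dt_add, hx, hy, add_zero]
  zero_mem' := dt_zero v
  smul_mem' := by
    intro c x hx
    simp only [Set.mem_ofPred_eq] at *
    rw [dt_smul, hx, mul_zero]

theorem mem_kr {v x : E3} : x ∈ kr v ↔ dt v x = 0 := Iff.rfl

section pat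

variable {ι : Type*} [Fintype ι] [DecidableEq ι] (a : ι → E3)

/-- Small perturbations keep strict inequalities. -/
theorem perturb (e : ι → ℝ) (x d : E3) :
    ∀ᶠ ε in nhdsWithin (0 : ℝ) (Set.Ioi 0), ∀ i, 0 < e i * dt (a i) x →
      0 < e i * dt (a i) (x + ε • d) := by
  rw [Filter.eventually_all]
  intro i
  by_cases h : 0 < e i * dt (a i) x
  · have hc : Continuous fun ε : ℝ => e i * dt (a i) (x + ε • d) := by
      simp only [dt_add, dt_smul]; fun_prop
    have h0 : 0 < (fun ε : ℝ => e i * dt (a i) (x + ε • d)) 0 := by simpa using h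
    have := (hc.continuousAt (x := 0)).eventually (lt_mem_nhds h0)
    filter_upwards [nhdsWithin_le_nhds this] with ε hε _ using hε
  · exact Filter.Eventually.of_forall fun ε hh => absurd hh h

theorem exists_perturb (e : ι → ℝ) (x d : E3) :
    ∃ ε : ℝ, 0 < ε ∧ ∀ i, 0 < e i * dt (a i) x → 0 < e i * dt (a i) (x + ε • d) := by
  obtain ⟨ε, h1, h2⟩ := ((perturb a e x d).and self_mem_nhdsWithin).exists
  exact ⟨ε, h2, h1⟩

/-- Sign of the index `i` in the pattern `A`. -/
def eps (A : Finset ι) (i : ι) : ℝ := if i ∈ A then 1 else -1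

theorem eps_mul_self (A : Finset ι) (i : ι) : eps A i * eps A i = 1 := by
  unfold eps; split_ifs <;> norm_num

open Classical in
/-- The sign patterns on `S` which are realised on the subspace `U`. -/
noncomputable def pat (U : Submodule ℝ E3) (S : Finset ι) : Finset (Finset ι) :=
  S.powerset.filter fun A => ∃ x ∈ U, ∀ i ∈ S, 0 < eps A i * dt (a i) x

theorem mem_pat {U : Submodule ℝ E3} {S A : Finset ι} :
    A ∈ pat a U S ↔ A ⊆ S ∧ ∃ x ∈ U, ∀ i ∈ S, 0 < eps A i * dt (a i) x := by
  simp [pat]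

theorem eps_insert_of_ne {A : Finset ι} {i j : ι} (h : j ≠ i) : eps (insert i A) j = eps A j := by
  simp [eps, h]

/-- A pattern is realised on the hyperplane iff both of its extensions are realised. -/
theorem mem_pat_ker {U : Submodule ℝ E3} {S A : Finset ι} {i : ι} (hi : i ∉ S)
    (hA : A ⊆ S) (hU : ∃ u ∈ U, dt (a i) u ≠ 0) :
    A ∈ pat a (U ⊓ kr (a i)) S ↔
      A ∈ pat a U (insert i S) ∧ insert i A ∈ pat a U (insert i S) := by
  have hiA : i ∉ A := fun h => hi (hA h)
  constructor
  · intro h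
    obtain ⟨-, x, ⟨hxU, hx0⟩, hx⟩ := (mem_pat a).1 h
    have hx0' : dt (a i) x = 0 := hx0
    obtain ⟨u, huU, hu⟩ := hU
    have gen : ∀ c : ℝ, ∃ y ∈ U, (∀ j ∈ S, 0 < eps A j * dt (a j) y) ∧
        ∃ ε > 0, dt (a i) y = ε * (c * dt (a i) u) := by
      intro c
      obtain ⟨ε, hε, h⟩ := exists_perturb a (eps A) x (c • u)
      refine ⟨x + ε • (c • u), U.add_mem hxU (U.smul_mem _ (U.smul_mem _ huU)),
        fun j hj => h j (hx j hj), ε, hε, ?_⟩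
      rw [dt_add, dt_smul, dt_smul, hx0', zero_add]
    refine ⟨(mem_pat a).2 ⟨hA.trans (Finset.subset_insert _ _), ?_⟩,
      (mem_pat a).2 ⟨Finset.insert_subset_insert _ hA, ?_⟩⟩
    · obtain ⟨y, hyU, hy, ε, hε, h⟩ := gen (-(dt (a i) u))
      refine ⟨y, hyU, ?_⟩
      intro j hj
      rcases Finset.mem_insert.1 hj with rfl | hj
      · rw [h, eps, if_neg hiA]
        have := mul_pos hε (mul_self_pos.2 hu)
        nlinarith
      · exact hy j hj
    · obtain ⟨y, hyU, hy, ε, hε, h⟩ := gen (dt (a i) u)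
      refine ⟨y, hyU, ?_⟩
      intro j hj
      rcases Finset.mem_insert.1 hj with rfl | hj
      · rw [h, eps, if_pos (Finset.mem_insert_self _ _)]
        have := mul_pos hε (mul_self_pos.2 hu)
        nlinarith
      · have hne : j ≠ i := fun h => hi (h ▸ hj)
        rw [eps_insert_of_ne hne]
        exact hy j hj
  · rintro ⟨h1, h2⟩
    obtain ⟨-, x, hxU, hx⟩ := (mem_pat a).1 h1
    obtain ⟨-, y, hyU, hy⟩ := (mem_pat a).1 h2
    have hxi := hx i (Finset.mem_insert_self _ _)
    have hyi := hy i (Finset.mem_insert_self _ _)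
    rw [eps, if_neg hiA] at hxi
    rw [eps, if_pos (Finset.mem_insert_self _ _)] at hyi
    refine (mem_pat a).2 ⟨hA, dt (a i) y • x + (- dt (a i) x) • y, ⟨?_, ?_⟩, ?_⟩
    · exact U.add_mem (U.smul_mem _ hxU) (U.smul_mem _ hyU)
    · change dt _ _ = 0
      rw [dt_add, dt_smul, dt_smul]; ring
    · intro j hj
      have hxj := hx j (Finset.mem_insert_of_mem hj)
      have hyj := hy j (Finset.mem_insert_of_mem hj)
      rw [eps_insert_of_ne (by rintro rfl; exact hi hj)] at hyj
      rw [dt_add, dt_smul, dt_smul]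
      have e1 : 0 < dt (a i) y := by linarith
      have e2 : 0 < - dt (a i) x := by linarith
      have := mul_pos e1 hxj
      have := mul_pos e2 hyj
      nlinarith

/-- Deletion-restriction. -/
theorem card_pat_insert {U : Submodule ℝ E3} {S : Finset ι} {i : ι} (hi : i ∉ S)
    (hU : ∃ u ∈ U, dt (a i) u ≠ 0) :
    (pat a U (insert i S)).card = (pat a U S).card + (pat a (U ⊓ kr (a i)) S).card := by
  classical
  set P := pat a U (insert i S) with hP
  -- patterns not containing i
  set P0 := P.filter (fun A => i ∉ A) with hP0
  set P1 := (P.filter (fun A => i ∈ A)).image (fun A => A.erase i) with hP1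
  have hc1 : P1.card = (P.filter (fun A => i ∈ A)).card := by
    apply Finset.card_image_of_injOn
    intro A hA B hB h
    simp only [Finset.coe_filter, Set.mem_ofPred_eq] at hA hB
    have := congrArg (insert i) h
    simpa [Finset.insert_erase hA.2, Finset.insert_erase hB.2] using this
  have hsum : P.card = P0.card + P1.card := by
    rw [hc1, hP0, add_comm]
    exact (Finset.card_filter_add_card_filter_not (s := P) (fun A => i ∈ A)).symm
  have mem1 : ∀ A, A ∈ P1 ↔ A ⊆ S ∧ insert i A ∈ P := by
    intro A
    simp only [hP1, Finset.mem_image, Finset.mem_filter]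
    constructor
    · rintro ⟨B, ⟨hB, hiB⟩, rfl⟩
      have := ((mem_pat a).1 hB).1
      refine ⟨?_, by rwa [Finset.insert_erase hiB]⟩
      intro j hj
      rcases Finset.mem_insert.1 (this (Finset.mem_of_mem_erase hj)) with h | h
      · exact absurd h (Finset.ne_of_mem_erase hj)
      · exact h
    · rintro ⟨h1, h2⟩
      exact ⟨_, ⟨h2, Finset.mem_insert_self _ _⟩, Finset.erase_insert (fun h => hi (h1 h))⟩
  have mem0 : ∀ A, A ∈ P0 ↔ A ⊆ S ∧ A ∈ P := by
    intro A
    simp only [hP0, Finset.mem_filter]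
    constructor
    · rintro ⟨h1, h2⟩
      refine ⟨?_, h1⟩
      have := ((mem_pat a).1 h1).1
      intro j hj
      rcases Finset.mem_insert.1 (this hj) with h | h
      · subst h; exact absurd hj h2
      · exact h
    · rintro ⟨h1, h2⟩
      exact ⟨h2, fun h => hi (h1 h)⟩
  have hun : P0 ∪ P1 = pat a U S := by
    ext A
    rw [Finset.mem_union, mem0, mem1, mem_pat a (S := S)]
    constructor
    · rintro (⟨h1, h2⟩ | ⟨h1, h2⟩)
      · obtain ⟨-, x, hxU, hx⟩ := (mem_pat a).1 h2
        exact ⟨h1, x, hxU, fun j hj => hx j (Finset.mem_insert_of_mem hj)⟩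
      · obtain ⟨-, x, hxU, hx⟩ := (mem_pat a).1 h2
        refine ⟨h1, x, hxU, fun j hj => ?_⟩
        have := hx j (Finset.mem_insert_of_mem hj)
        rwa [eps_insert_of_ne (by rintro rfl; exact hi hj)] at this
    · rintro ⟨h1, x, hxU, hx⟩
      have hiA : i ∉ A := fun h => hi (h1 h)
      by_cases hz : dt (a i) x = 0
      · left
        refine ⟨h1, ((mem_pat_ker a hi h1 hU).1 ?_).1⟩
        exact (mem_pat a).2 ⟨h1, x, ⟨hxU, hz⟩, hx⟩
      · rcases lt_or_gt_of_ne hz with h | h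
        · left
          refine ⟨h1, (mem_pat a).2 ⟨h1.trans (Finset.subset_insert _ _), x, hxU, ?_⟩⟩
          intro j hj
          rcases Finset.mem_insert.1 hj with rfl | hj
          · rw [eps, if_neg hiA]; linarith
          · exact hx j hj
        · right
          refine ⟨h1, (mem_pat a).2 ⟨Finset.insert_subset_insert _ h1, x, hxU, ?_⟩⟩
          intro j hj
          rcases Finset.mem_insert.1 hj with rfl | hj
          · rw [eps, if_pos (Finset.mem_insert_self _ _)]; linarith
          · have hne : j ≠ i := fun h => hi (h ▸ hj)
            rw [eps_insert_of_ne hne]; exact hx j hj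
  have hin : P0 ∩ P1 = pat a (U ⊓ kr (a i)) S := by
    ext A
    rw [Finset.mem_inter, mem0, mem1]
    constructor
    · rintro ⟨⟨h1, h2⟩, h3, h4⟩
      exact (mem_pat_ker a hi h1 hU).2 ⟨h2, h4⟩
    · intro h
      have h1 := ((mem_pat a).1 h).1
      have := (mem_pat_ker a hi h1 hU).1 h
      exact ⟨⟨h1, this.1⟩, h1, this.2⟩
  rw [hsum, ← hun, ← hin, Finset.card_union_add_card_inter]

theorem card_pat_empty (U : Submodule ℝ E3) : (pat a U ∅).card = 1 := by
  have : pat a U ∅ = {∅} := by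
    ext A
    rw [mem_pat]
    simp only [Finset.subset_empty, Finset.mem_singleton, Finset.notMem_empty, false_implies,
      implies_true, and_true]
    exact ⟨fun h => h.1, fun h => ⟨h, 0, U.zero_mem⟩⟩
  rw [this, Finset.card_singleton]

end pat

end Cheap

set_option linter.unusedSectionVars false
namespace Cheap

section flats

variable {ι : Type*} [Fintype ι] [DecidableEq ι] (a : ι → E3)

open Classical in
/-- The flat spanned by `i` and `j`: all lines through the intersection of lines `i`, `j`. -/
noncomputable def fl (i j : ι) : Finset ι :=
  Finset.univ.filter fun l => dt (a l) (cr (a i) (a j)) = 0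

theorem mem_fl {i j l : ι} : l ∈ fl a i j ↔ dt (a l) (cr (a i) (a j)) = 0 := by
  simp [fl]

theorem fl_left (i j : ι) : i ∈ fl a i j := (mem_fl a).2 (dt_cr_left _ _)

theorem fl_right (i j : ι) : j ∈ fl a i j := (mem_fl a).2 (dt_cr_right _ _)

theorem mem_fl_of (hp : ∀ i j, i ≠ j → cr (a i) (a j) ≠ 0) {i j l : ι} (hij : i ≠ j) {v : E3} (hv : v ≠ 0) (hi : dt (a i) v = 0)
    (hj : dt (a j) v = 0) : l ∈ fl a i j ↔ dt (a l) v = 0 := by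
  obtain ⟨t, rfl⟩ := eq_smul_cr (hp i j hij) hi hj
  have ht : t ≠ 0 := by rintro rfl; simp at hv
  rw [mem_fl, dt_smul, mul_eq_zero, or_iff_right ht]

theorem fl_eq (hp : ∀ i j, i ≠ j → cr (a i) (a j) ≠ 0) {i j k l : ι} (hij : i ≠ j) (hkl : k ≠ l) (hk : k ∈ fl a i j) (hl : l ∈ fl a i j) :
    fl a k l = fl a i j := by
  ext m
  rw [mem_fl_of a hp hkl (hp i j hij) ((mem_fl a).1 hk) ((mem_fl a).1 hl), mem_fl]

theorem fl_comm (hp : ∀ i j, i ≠ j → cr (a i) (a j) ≠ 0) {i j : ι} (hij : i ≠ j) : fl a i j = fl a j i :=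
  fl_eq a hp hij.symm hij (fl_right a _ _) (fl_left a _ _)

/-- The set of all flats (the vertices of the dual arrangement). -/
noncomputable def flats : Finset (Finset ι) :=
  (Finset.univ : Finset ι).offDiag.image fun p => fl a p.1 p.2

theorem mem_flats {J : Finset ι} : J ∈ flats a ↔ ∃ i j, i ≠ j ∧ fl a i j = J := by
  simp [flats]

theorem fl_mem_flats {i j : ι} (h : i ≠ j) : fl a i j ∈ flats a :=
  (mem_flats a).2 ⟨i, j, h, rfl⟩

theorem flat_eq_fl (hp : ∀ i j, i ≠ j → cr (a i) (a j) ≠ 0) {J : Finset ι} (hJ : J ∈ flats a) {i j : ι} (hij : i ≠ j) (hi : i ∈ J)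
    (hj : j ∈ J) : J = fl a i j := by
  obtain ⟨k, l, hkl, rfl⟩ := (mem_flats a).1 hJ
  exact (fl_eq a hp hkl hij hi hj).symm

theorem card_pat_line_zero (hp : ∀ i j, i ≠ j → cr (a i) (a j) ≠ 0) {i j : ι} {S : Finset ι} (hij : i ≠ j) {s : ι} (hs : s ∈ S)
    (hsf : s ∈ fl a i j) : (pat a (kr (a i) ⊓ kr (a j)) S).card = 0 := by
  rw [Finset.card_eq_zero, Finset.eq_empty_iff_forall_notMem]
  intro A hA
  obtain ⟨-, x, ⟨hx1, hx2⟩, hx⟩ := (mem_pat a).1 hA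
  obtain ⟨t, rfl⟩ := eq_smul_cr (hp i j hij) hx1 hx2
  have := hx s hs
  rw [dt_smul, (mem_fl a).1 hsf] at this
  simp at this

theorem card_pat_line_two (hp : ∀ i j, i ≠ j → cr (a i) (a j) ≠ 0) {i j : ι} {S : Finset ι} (hij : i ≠ j) (hS : S.Nonempty)
    (hs : ∀ s ∈ S, s ∉ fl a i j) : (pat a (kr (a i) ⊓ kr (a j)) S).card = 2 := by
  classical
  set v := cr (a i) (a j) with hv
  have hs' : ∀ s ∈ S, dt (a s) v ≠ 0 := fun s h => by
    have := hs s h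
    rwa [mem_fl] at this
  set A1 := S.filter (fun s => 0 < dt (a s) v) with hA1
  set A2 := S.filter (fun s => dt (a s) v < 0) with hA2
  have : pat a (kr (a i) ⊓ kr (a j)) S = {A1, A2} := by
    ext A
    rw [mem_pat, Finset.mem_insert, Finset.mem_singleton]
    constructor
    · rintro ⟨hAS, x, ⟨hx1, hx2⟩, hx⟩
      obtain ⟨t, rfl⟩ := eq_smul_cr (hp i j hij) hx1 hx2
      rw [← hv] at hx
      have ht : t ≠ 0 := by
        rintro rfl
        obtain ⟨s, hs⟩ := hS
        have := hx s hs
        simp [dt_zero] at this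
      rcases lt_or_gt_of_ne ht with ht | ht
      · right
        ext s
        simp only [hA2, Finset.mem_filter]
        constructor
        · intro h
          refine ⟨hAS h, ?_⟩
          have := hx s (hAS h)
          rw [dt_smul, eps, if_pos h] at this
          nlinarith
        · rintro ⟨h1, h2⟩
          by_contra h
          have := hx s h1
          rw [dt_smul, eps, if_neg h] at this
          nlinarith
      · left
        ext s
        simp only [hA1, Finset.mem_filter]
        constructor
        · intro h
          refine ⟨hAS h, ?_⟩
          have := hx s (hAS h)
          rw [dt_smul, eps, if_pos h] at this
          by_contra hc
          nlinarith
        · rintro ⟨h1, h2⟩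
          by_contra h
          have := hx s h1
          rw [dt_smul, eps, if_neg h] at this
          nlinarith
    · have h1 : v ∈ kr (a i) ⊓ kr (a j) := ⟨dt_cr_left _ _, dt_cr_right _ _⟩
      rintro (rfl | rfl)
      · refine ⟨Finset.filter_subset _ _, v, h1, fun s h => ?_⟩
        have := hs' s h
        simp only [eps, hA1, Finset.mem_filter, h, true_and]
        split_ifs with h2
        · linarith
        · have := lt_of_le_of_ne (not_lt.1 h2) this
          linarith
      · refine ⟨Finset.filter_subset _ _, -v, Submodule.neg_mem _ h1, fun s h => ?_⟩
        have := hs' s h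
        simp only [eps, hA2, Finset.mem_filter, h, true_and, dt_neg]
        split_ifs with h2
        · linarith
        · have := lt_of_le_of_ne (not_lt.1 h2) this.symm
          linarith
  rw [this, Finset.card_pair]
  intro h
  obtain ⟨s, hs⟩ := hS
  have h1 := hs' s hs
  rcases lt_or_gt_of_ne h1 with h2 | h2
  · have : s ∈ A1 := h ▸ (Finset.mem_filter.2 ⟨hs, h2⟩)
    have := (Finset.mem_filter.1 this).2
    linarith
  · have : s ∈ A2 := h ▸ (Finset.mem_filter.2 ⟨hs, h2⟩)
    have := (Finset.mem_filter.1 this).2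
    linarith

theorem dt_cr_cr (x y : E3) : dt y (cr x (cr x y)) = - dt (cr x y) (cr x y) := by
  simp [dt, cr]; ring

theorem exists_kr (hp : ∀ i j, i ≠ j → cr (a i) (a j) ≠ 0) {i j : ι} (hij : i ≠ j) : ∃ u ∈ kr (a i), dt (a j) u ≠ 0 := by
  refine ⟨cr (a i) (cr (a i) (a j)), dt_cr_left _ _, ?_⟩
  rw [dt_cr_cr]
  have := dt_self_pos (hp i j hij)
  linarith

/-- Number of cells cut on line `i` by the lines in `S`. -/
theorem card_pat_kr (hp : ∀ i j, i ≠ j → cr (a i) (a j) ≠ 0) {i : ι} {S : Finset ι} (hi : i ∉ S) (hS : S.Nonempty) :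
    (pat a (kr (a i)) S).card = 2 * (S.image (fl a i)).card := by
  classical
  induction S using Finset.induction_on with
  | empty => exact absurd hS (by simp)
  | insert j S hj ih =>
    have hij : i ≠ j := by rintro rfl; exact hi (Finset.mem_insert_self _ _)
    have hi' : i ∉ S := fun h => hi (Finset.mem_insert_of_mem h)
    rw [card_pat_insert a hj (exists_kr a hp hij)]
    rcases S.eq_empty_or_nonempty with rfl | hS'
    · simp [card_pat_empty]
    · rw [ih hi' hS', Finset.image_insert]
      by_cases h : ∃ s ∈ S, s ∈ fl a i j
      · obtain ⟨s, hs, hsf⟩ := h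
        rw [card_pat_line_zero a hp hij hs hsf, add_zero, Finset.insert_eq_of_mem]
        have his : i ≠ s := by rintro rfl; exact hi' hs
        exact Finset.mem_image.2 ⟨s, hs, fl_eq a hp hij his (fl_left a _ _) hsf⟩
      · push Not at h
        rw [card_pat_line_two a hp hij hS' h, Finset.card_insert_of_notMem]
        · ring
        · intro hm
          obtain ⟨s, hs, he⟩ := Finset.mem_image.1 hm
          exact h s hs (he ▸ fl_right a i s)

/-- The sum of (multiplicity - 1) over all vertices, for the subarrangement `S`. -/
noncomputable def phi (S : Finset ι) : ℕ := ∑ J ∈ flats a, ((J ∩ S).card - 1)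

theorem phi_insert (hp : ∀ i j, i ≠ j → cr (a i) (a j) ≠ 0) {i : ι} {S : Finset ι} (hi : i ∉ S) :
    phi a (insert i S) = phi a S + (S.image (fl a i)).card := by
  classical
  have h1 : S.image (fl a i) = (flats a).filter (fun J => i ∈ J ∧ (J ∩ S).Nonempty) := by
    ext J
    simp only [Finset.mem_image, Finset.mem_filter]
    constructor
    · rintro ⟨s, hs, rfl⟩
      have his : i ≠ s := by rintro rfl; exact hi hs
      exact ⟨fl_mem_flats a his, fl_left a _ _, s, Finset.mem_inter.2 ⟨fl_right a _ _, hs⟩⟩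
    · rintro ⟨hJ, hiJ, s, hs⟩
      obtain ⟨h1, h2⟩ := Finset.mem_inter.1 hs
      have his : i ≠ s := by rintro rfl; exact hi h2
      exact ⟨s, h2, (flat_eq_fl a hp hJ his hiJ h1).symm⟩
  rw [h1, Finset.card_filter, phi, phi, ← Finset.sum_add_distrib]
  apply Finset.sum_congr rfl
  intro J _
  by_cases hiJ : i ∈ J
  · rw [Finset.inter_insert_of_mem hiJ, Finset.card_insert_of_notMem
      (fun h => hi (Finset.mem_inter.1 h).2)]
    by_cases hn : (J ∩ S).Nonempty
    · have := Finset.card_pos.2 hn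
      simp only [hiJ, hn, and_self, if_true]; omega
    · rw [Finset.not_nonempty_iff_eq_empty] at hn
      simp [hn]
  · rw [Finset.inter_insert_of_notMem hiJ]
    simp [hiJ]

/-- Number of cells of the arrangement `S` on the sphere (Euler's formula). -/
theorem card_pat_top (hp : ∀ i j, i ≠ j → cr (a i) (a j) ≠ 0) (h0 : ∀ i, a i ≠ 0) {S : Finset ι} (hS : S.Nonempty) :
    (pat a ⊤ S).card = 2 + 2 * phi a S := by
  classical
  induction S using Finset.induction_on with
  | empty => exact absurd hS (by simp)
  | insert i S hi ih =>
    have hu : ∃ u ∈ (⊤ : Submodule ℝ E3), dt (a i) u ≠ 0 :=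
      ⟨a i, Submodule.mem_top, (dt_self_pos (h0 i)).ne'⟩
    rw [card_pat_insert a hi hu, top_inf_eq, phi_insert a hp hi]
    rcases S.eq_empty_or_nonempty with rfl | hS'
    · simp [card_pat_empty, phi]
    · rw [ih hS', card_pat_kr a hp hi hS']
      ring

theorem phi_flat (hp : ∀ i j, i ≠ j → cr (a i) (a j) ≠ 0) {J : Finset ι} (hJ : J ∈ flats a) : phi a J = J.card - 1 := by
  classical
  rw [phi, Finset.sum_eq_single_of_mem J hJ]
  · rw [Finset.inter_self]
  · intro J' hJ' hne
    rw [Nat.sub_eq_zero_iff_le, Finset.card_le_one]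
    intro x hx y hy
    by_contra hxy
    obtain ⟨h1, h2⟩ := Finset.mem_inter.1 hx
    obtain ⟨h3, h4⟩ := Finset.mem_inter.1 hy
    exact hne ((flat_eq_fl a hp hJ' hxy h1 h3).trans (flat_eq_fl a hp hJ hxy h2 h4).symm)

theorem two_le_card_flat {J : Finset ι} (hJ : J ∈ flats a) : 2 ≤ J.card := by
  obtain ⟨i, j, hij, rfl⟩ := (mem_flats a).1 hJ
  exact Finset.one_lt_card.2 ⟨i, fl_left a _ _, j, fl_right a _ _, hij⟩

theorem phi_univ : phi a Finset.univ = ∑ J ∈ flats a, (J.card - 1) := by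
  simp [phi]

theorem sum_image_fl (hp : ∀ i j, i ≠ j → cr (a i) (a j) ≠ 0) : ∑ i, ((Finset.univ.erase i).image (fl a i)).card = ∑ J ∈ flats a, J.card := by
  classical
  have h1 : ∀ i, (Finset.univ.erase i).image (fl a i) = (flats a).filter (fun J => i ∈ J) := by
    intro i
    ext J
    simp only [Finset.mem_image, Finset.mem_filter, Finset.mem_erase, Finset.mem_univ, and_true]
    constructor
    · rintro ⟨s, hs, rfl⟩
      exact ⟨fl_mem_flats a hs.symm, fl_left a _ _⟩
    · rintro ⟨hJ, hiJ⟩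
      obtain ⟨s, hs, hne⟩ := Finset.exists_mem_ne (two_le_card_flat a hJ) i
      exact ⟨s, hne, (flat_eq_fl a hp hJ hne.symm hiJ hs).symm⟩
  simp only [h1, Finset.card_filter]
  rw [Finset.sum_comm]
  apply Finset.sum_congr rfl
  intro J _
  simp

/-- The topes (cells on the sphere). -/
noncomputable def topes : Finset (Finset ι) := pat a ⊤ Finset.univ

theorem mem_topes {A : Finset ι} : A ∈ topes a ↔ ∃ x, ∀ i, 0 < eps A i * dt (a i) x := by
  simp [topes, mem_pat]

/-- The walls of a cell. -/
noncomputable def walls (A : Finset ι) : Finset ι :=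
  Finset.univ.filter fun i => symmDiff A {i} ∈ topes a

theorem mem_walls {A : Finset ι} {i : ι} : i ∈ walls a A ↔ symmDiff A {i} ∈ topes a := by
  simp [walls]

theorem symmDiff_of_mem {A : Finset ι} {i : ι} (h : i ∈ A) : symmDiff A {i} = A.erase i := by
  ext j
  simp only [Finset.mem_symmDiff, Finset.mem_singleton, Finset.mem_erase]
  grind

theorem symmDiff_of_notMem {A : Finset ι} {i : ι} (h : i ∉ A) : symmDiff A {i} = insert i A := by
  ext j
  simp only [Finset.mem_symmDiff, Finset.mem_singleton, Finset.mem_insert]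
  grind

theorem card_wall (hp : ∀ i j, i ≠ j → cr (a i) (a j) ≠ 0) (h0 : ∀ i, a i ≠ 0) (hn : 2 ≤ Fintype.card ι) (i : ι) :
    ((topes a).filter (fun A => i ∈ walls a A)).card =
      4 * ((Finset.univ.erase i).image (fl a i)).card := by
  classical
  set S : Finset ι := Finset.univ.erase i with hSdef
  have hi : i ∉ S := Finset.notMem_erase _ _
  have hins : insert i S = Finset.univ := Finset.insert_erase (Finset.mem_univ _)
  have hS : S.Nonempty := by
    rw [← Finset.card_pos, hSdef, Finset.card_erase_of_mem (Finset.mem_univ _), Finset.card_univ]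
    omega
  have hu : ∃ u ∈ (⊤ : Submodule ℝ E3), dt (a i) u ≠ 0 :=
    ⟨a i, Submodule.mem_top, (dt_self_pos (h0 i)).ne'⟩
  have hk := card_pat_kr a hp hi hS
  have hmem : ∀ A ⊆ S, (A ∈ pat a (kr (a i)) S ↔ A ∈ topes a ∧ insert i A ∈ topes a) := by
    intro A hA
    have := mem_pat_ker a hi hA hu
    rwa [top_inf_eq, hins] at this
  have hset : (topes a).filter (fun A => i ∈ walls a A) =
      pat a (kr (a i)) S ∪ (pat a (kr (a i)) S).image (insert i) := by
    ext A
    rw [Finset.mem_filter, mem_walls, Finset.mem_union, Finset.mem_image]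
    constructor
    · rintro ⟨h1, h2⟩
      by_cases hA : i ∈ A
      · right
        rw [symmDiff_of_mem hA] at h2
        refine ⟨A.erase i, (hmem _ (Finset.erase_subset_erase _ (Finset.subset_univ _))).2 ⟨h2, ?_⟩,
          Finset.insert_erase hA⟩
        rwa [Finset.insert_erase hA]
      · left
        rw [symmDiff_of_notMem hA] at h2
        refine (hmem A ?_).2 ⟨h1, h2⟩
        intro j hj
        exact Finset.mem_erase.2 ⟨by rintro rfl; exact hA hj, Finset.mem_univ _⟩
    · rintro (h | ⟨B, hB, rfl⟩)
      · have hAS := ((mem_pat a).1 h).1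
        have := (hmem A hAS).1 h
        rw [symmDiff_of_notMem (fun h' => hi (hAS h'))]
        exact this
      · have hAS := ((mem_pat a).1 hB).1
        have := (hmem B hAS).1 hB
        rw [symmDiff_of_mem (Finset.mem_insert_self _ _),
          Finset.erase_insert (fun h' => hi (hAS h'))]
        exact this.symm
  rw [hset, Finset.card_union_of_disjoint, Finset.card_image_of_injOn, hk]
  · ring
  · intro A hA B hB h
    have hA' := ((mem_pat a).1 hA).1
    have hB' := ((mem_pat a).1 hB).1
    have := congrArg (fun C => Finset.erase C i) h
    simpa [Finset.erase_insert (fun h' => hi (hA' h')),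
      Finset.erase_insert (fun h' => hi (hB' h'))] using this
  · rw [Finset.disjoint_left]
    intro A hA hA2
    obtain ⟨B, hB, rfl⟩ := Finset.mem_image.1 hA2
    exact hi (((mem_pat a).1 hA).1 (Finset.mem_insert_self _ _))

/-- Double counting of walls. -/
theorem sum_walls (hp : ∀ i j, i ≠ j → cr (a i) (a j) ≠ 0) (h0 : ∀ i, a i ≠ 0) (hn : 2 ≤ Fintype.card ι) :
    ∑ A ∈ topes a, (walls a A).card = 4 * ∑ J ∈ flats a, J.card := by
  classical
  rw [← sum_image_fl a hp, Finset.mul_sum]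
  simp only [← card_wall a hp h0 hn]
  simp only [Finset.card_filter]
  rw [Finset.sum_comm]
  apply Finset.sum_congr rfl
  intro A _
  simp

theorem card_topes (hp : ∀ i j, i ≠ j → cr (a i) (a j) ≠ 0) (h0 : ∀ i, a i ≠ 0) [Nonempty ι] :
    (topes a).card = 2 + 2 * ∑ J ∈ flats a, (J.card - 1) := by
  rw [topes, card_pat_top a hp h0 Finset.univ_nonempty, phi_univ]

/-- Melchior's equality, in the form needed. -/
theorem melchior (hp : ∀ i j, i ≠ j → cr (a i) (a j) ≠ 0) (h0 : ∀ i, a i ≠ 0) (hn : 2 ≤ Fintype.card ι) :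
    ∑ A ∈ topes a, (((walls a A).card : ℤ) - 3) + 6 = ∑ J ∈ flats a, (6 - 2 * (J.card : ℤ)) := by
  have : Nonempty ι := Fintype.card_pos_iff.1 (by omega)
  have h1 := sum_walls a hp h0 hn
  have h2 := card_topes a hp h0
  have h3 : ((∑ J ∈ flats a, (J.card - 1) : ℕ) : ℤ) = ∑ J ∈ flats a, ((J.card : ℤ) - 1) := by
    rw [Nat.cast_sum]
    apply Finset.sum_congr rfl
    intro J hJ
    have := two_le_card_flat a hJ
    push_cast [show 1 ≤ J.card by omega]
    rfl
  rw [Finset.sum_sub_distrib, Finset.sum_const, ← Nat.cast_sum, h1, h2]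
  simp only [nsmul_eq_mul, Nat.cast_add, Nat.cast_mul, h3, Nat.cast_sum]
  rw [Finset.sum_sub_distrib, Finset.sum_sub_distrib, ← Finset.mul_sum]
  simp
  ring

end flats

end Cheap

set_option linter.unusedSectionVars false
namespace Cheap

section cells

variable {ι : Type*} [Fintype ι] [DecidableEq ι] (a : ι → E3)

theorem eps_symmDiff_self (A : Finset ι) (i : ι) : eps (symmDiff A {i}) i = - eps A i := by
  by_cases h : i ∈ A <;> simp [eps, Finset.mem_symmDiff, h]

theorem eps_symmDiff_of_ne (A : Finset ι) {i j : ι} (h : j ≠ i) :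
    eps (symmDiff A {i}) j = eps A j := by
  by_cases h' : j ∈ A <;> simp [eps, Finset.mem_symmDiff, h, h']

theorem eps_ne_zero (A : Finset ι) (i : ι) : eps A i ≠ 0 := by
  unfold eps; split_ifs <;> norm_num

theorem exists_generic {κ : Type*} [Fintype κ] [DecidableEq κ] (g : κ → E3) (hg : ∀ k, g k ≠ 0) :
    ∃ d : E3, ∀ k, dt (g k) d ≠ 0 := by
  suffices h : ∀ s : Finset κ, ∃ d : E3, ∀ k ∈ s, dt (g k) d ≠ 0 by
    obtain ⟨d, hd⟩ := h Finset.univ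
    exact ⟨d, fun k => hd k (Finset.mem_univ _)⟩
  intro s
  induction s using Finset.induction_on with
  | empty => exact ⟨0, by simp⟩
  | insert k s hk ih =>
    obtain ⟨d, hd⟩ := ih
    by_cases h : dt (g k) d = 0
    · obtain ⟨ε, hε, h2⟩ := exists_perturb g (fun k => dt (g k) d) d (g k)
      refine ⟨d + ε • g k, ?_⟩
      intro k' hk'
      rcases Finset.mem_insert.1 hk' with rfl | hk'
      · rw [dt_add, dt_smul, h, zero_add]
        exact mul_ne_zero hε.ne' (dt_self_pos (hg _)).ne'
      · have := h2 k' (mul_self_pos.2 (hd k' hk'))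
        exact right_ne_zero_of_mul this.ne'
    · refine ⟨d, ?_⟩
      intro k' hk'
      rcases Finset.mem_insert.1 hk' with rfl | hk'
      · exact h
      · exact hd k' hk'

theorem wall_of_zero (h0 : ∀ i, a i ≠ 0) {A : Finset ι} {l : ι} {z : E3} (hz : dt (a l) z = 0)
    (hm : ∀ m, m ≠ l → 0 < eps A m * dt (a m) z) : symmDiff A {l} ∈ topes a := by
  obtain ⟨ε, hε, h⟩ := exists_perturb a (eps A) z ((- eps A l) • a l)
  refine (mem_topes a).2 ⟨z + ε • ((- eps A l) • a l), fun m => ?_⟩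
  by_cases hml : m = l
  · subst hml
    rw [eps_symmDiff_self, dt_add, dt_smul, dt_smul, hz]
    have h1 := eps_mul_self A m
    have h2 := mul_pos hε (dt_self_pos (h0 m))
    calc (0 : ℝ) < (eps A m * eps A m) * (ε * dt (a m) (a m)) := by rw [h1, one_mul]; exact h2
      _ = _ := by ring
  · rw [eps_symmDiff_of_ne _ hml]
    exact h m (hm m hml)

/-- The cell graph is isometric: some wall of `A` separates `A` from `B`. -/
theorem exists_sep_wall (hp : ∀ i j, i ≠ j → cr (a i) (a j) ≠ 0) (h0 : ∀ i, a i ≠ 0)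
    {A B : Finset ι} (hA : A ∈ topes a) (hB : B ∈ topes a) (hAB : A ≠ B) :
    ∃ l ∈ walls a A, eps B l = - eps A l := by
  classical
  obtain ⟨x, hx⟩ := (mem_topes a).1 hB
  obtain ⟨y0, hy0⟩ := (mem_topes a).1 hA
  have hx0 : ∀ m, dt (a m) x ≠ 0 := fun m => right_ne_zero_of_mul (hx m).ne'
  let κ := {p : ι × ι // p.1 ≠ p.2}
  let g : κ → E3 := fun p => dt (a p.1.2) x • a p.1.1 - dt (a p.1.1) x • a p.1.2
  have hgdef : ∀ (p : κ) y, dt (g p) y =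
      dt (a p.1.2) x * dt (a p.1.1) y - dt (a p.1.1) x * dt (a p.1.2) y := by
    intro p y
    simp only [g, dt, Pi.sub_apply, Pi.smul_apply, smul_eq_mul]; ring
  have hg : ∀ p, g p ≠ 0 := by
    intro p hp0
    apply hp p.1.1 p.1.2 p.2
    have h1 : dt (a p.1.2) x • cr (a p.1.1) (a p.1.2) = cr (g p) (a p.1.2) := by
      ext i
      fin_cases i <;> simp [cr, g] <;> ring
    rw [hp0] at h1
    have h2 : cr 0 (a p.1.2) = 0 := by
      ext i
      fin_cases i <;> simp [cr]
    rw [h2] at h1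
    exact (smul_eq_zero.1 h1).resolve_left (hx0 _)
  obtain ⟨d, hd⟩ := exists_generic g hg
  obtain ⟨ε, ⟨h1, h2⟩, h3⟩ := (((perturb a (eps A) y0 d).and
    (perturb g (fun k => dt (g k) y0) y0 d)).and self_mem_nhdsWithin).exists
  set y := y0 + ε • d with hy
  have hyA : ∀ i, 0 < eps A i * dt (a i) y := fun i => h1 i (hy0 i)
  have hyg : ∀ k, dt (g k) y ≠ 0 := by
    intro k
    by_cases hk : dt (g k) y0 = 0
    · rw [hy, dt_add, dt_smul, hk, zero_add]
      exact mul_ne_zero (ne_of_gt h3) (hd k)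
    · exact right_ne_zero_of_mul (h2 k (mul_self_pos.2 hk)).ne'
  set S : Finset ι := Finset.univ.filter (fun l => eps B l = - eps A l) with hS
  have hnS : ∀ l, l ∉ S → eps B l = eps A l := by
    intro l hl
    simp only [hS, Finset.mem_filter, Finset.mem_univ, true_and] at hl
    unfold eps at hl ⊢
    split_ifs at hl ⊢ <;> first | rfl | (exfalso; apply hl; norm_num)
  have hSne : S.Nonempty := by
    by_contra hc
    rw [Finset.not_nonempty_iff_eq_empty] at hc
    apply hAB
    ext l
    have := hnS l (by simp [hc])
    unfold eps at this
    split_ifs at this with p q q <;> first | tauto | norm_num at this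
  have hw : ∀ l ∈ S, 0 < - eps A l * dt (a l) x := by
    intro l hl
    have := (Finset.mem_filter.1 hl).2
    rw [← this]; exact hx l
  obtain ⟨l, hl, hmin⟩ := Finset.exists_min_image S
    (fun l => (eps A l * dt (a l) y) / (- eps A l * dt (a l) x)) hSne
  refine ⟨l, (mem_walls a).2 ?_, (Finset.mem_filter.1 hl).2⟩
  set ρ := (eps A l * dt (a l) y) / (- eps A l * dt (a l) x) with hρ
  have hρpos : 0 < ρ := div_pos (hyA l) (hw l hl)
  have hρeq : ρ = - (dt (a l) y / dt (a l) x) := by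
    rw [hρ, neg_mul, div_neg, mul_div_mul_left _ _ (eps_ne_zero A l)]
  apply wall_of_zero a h0 (z := y + ρ • x)
  · rw [dt_add, dt_smul, hρeq]
    field_simp [hx0 l]
    ring
  · intro m hm
    rw [dt_add, dt_smul]
    by_cases hmS : m ∈ S
    · have h4 := hmin m hmS
      have h5 := (le_div_iff₀ (hw m hmS)).1 h4
      have h6 : ρ * (-eps A m * dt (a m) x) ≠ eps A m * dt (a m) y := by
        intro he
        have h7 : eps A m * (dt (a m) y + ρ * dt (a m) x) = 0 := by linarith
        have h8 := (mul_eq_zero.1 h7).resolve_left (eps_ne_zero A m)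
        have h9 := hyg ⟨(l, m), hm.symm⟩
        rw [hgdef] at h9
        apply h9
        simp only
        rw [hρeq] at h8
        have h10 : dt (a m) y = dt (a l) y / dt (a l) x * dt (a m) x := by linarith
        rw [h10]
        field_simp [hx0 l]
        ring
      have := lt_of_le_of_ne h5 h6
      nlinarith
    · have h4 := hx m
      rw [hnS m hmS] at h4
      have := mul_pos hρpos h4
      have := hyA m
      nlinarith

/-- A cell is cut out by its walls. -/
theorem wall_cone (hp : ∀ i j, i ≠ j → cr (a i) (a j) ≠ 0) (h0 : ∀ i, a i ≠ 0)
    {A : Finset ι} (hA : A ∈ topes a) {x : E3} (hx : ∀ i ∈ walls a A, 0 < eps A i * dt (a i) x)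
    (l : ι) : 0 < eps A l * dt (a l) x := by
  classical
  by_contra hl
  push Not at hl
  obtain ⟨d0, hd0⟩ := exists_generic a h0
  obtain ⟨d, hd, hdl⟩ : ∃ d : E3, (∀ k, dt (a k) d ≠ 0) ∧ eps A l * dt (a l) d < 0 := by
    rcases lt_or_gt_of_ne (mul_ne_zero (eps_ne_zero A l) (hd0 l)) with h | h
    · exact ⟨d0, hd0, h⟩
    · refine ⟨-d0, fun k => ?_, ?_⟩
      · rw [dt_neg]; exact neg_ne_zero.2 (hd0 k)
      · rw [dt_neg]; linarith
  obtain ⟨ε, ⟨h1, h2⟩, h3⟩ := (((perturb a (eps A) x d).and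
    (perturb a (fun k => dt (a k) x) x d)).and self_mem_nhdsWithin).exists
  have h3' : 0 < ε := h3
  set x' := x + ε • d with hx'
  have hne : ∀ k, dt (a k) x' ≠ 0 := by
    intro k
    by_cases hk : dt (a k) x = 0
    · rw [hx', dt_add, dt_smul, hk, zero_add]
      exact mul_ne_zero (ne_of_gt h3) (hd k)
    · exact right_ne_zero_of_mul (h2 k (mul_self_pos.2 hk)).ne'
  have hl' : eps A l * dt (a l) x' < 0 := by
    rw [hx', dt_add, dt_smul]
    have := mul_neg_of_pos_of_neg h3' hdl
    nlinarith
  set B : Finset ι := Finset.univ.filter (fun k => 0 < dt (a k) x') with hB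
  have hBpos : ∀ k, 0 < eps B k * dt (a k) x' := by
    intro k
    have := hne k
    simp only [eps, hB, Finset.mem_filter, Finset.mem_univ, true_and]
    split_ifs with h
    · linarith
    · have := lt_of_le_of_ne (not_lt.1 h) this
      linarith
  have hBt : B ∈ topes a := (mem_topes a).2 ⟨x', hBpos⟩
  have hAB : A ≠ B := by
    intro h
    have := hBpos l
    rw [← h] at this
    linarith
  obtain ⟨m, hm, hme⟩ := exists_sep_wall a hp h0 hA hBt hAB
  have h4 := h1 m (hx m hm)
  have h5 := hBpos m
  rw [hme] at h5
  linarith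

theorem walls_no_common (hp : ∀ i j, i ≠ j → cr (a i) (a j) ≠ 0) (h0 : ∀ i, a i ≠ 0)
    (hn : ∀ u : E3, u ≠ 0 → ∃ i, dt (a i) u ≠ 0)
    {A : Finset ι} (hA : A ∈ topes a) {u : E3} (hu : u ≠ 0) : ∃ i ∈ walls a A, dt (a i) u ≠ 0 := by
  by_contra hc
  push Not at hc
  obtain ⟨l, hl⟩ := hn u hu
  obtain ⟨y, hy⟩ := (mem_topes a).1 hA
  have := wall_cone a hp h0 hA (x := y + (-(dt (a l) y) / dt (a l) u) • u) (fun i hi => by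
    rw [dt_add, dt_smul, hc i hi, mul_zero, add_zero]; exact hy i) l
  rw [dt_add, dt_smul, div_mul_cancel₀ _ hl] at this
  simp at this

theorem three_le_walls (hp : ∀ i j, i ≠ j → cr (a i) (a j) ≠ 0) (h0 : ∀ i, a i ≠ 0)
    (hn : ∀ u : E3, u ≠ 0 → ∃ i, dt (a i) u ≠ 0) (hc : 2 ≤ Fintype.card ι)
    {A : Finset ι} (hA : A ∈ topes a) : 3 ≤ (walls a A).card := by
  by_contra h
  obtain ⟨T, hT, hTc⟩ := Finset.exists_superset_card_eq (s := walls a A) (n := 2) (by omega) hc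
  obtain ⟨i, j, hij, rfl⟩ := Finset.card_eq_two.1 hTc
  obtain ⟨k, hk, hk2⟩ := walls_no_common a hp h0 hn hA (hp i j hij)
  have := hT hk
  simp only [Finset.mem_insert, Finset.mem_singleton] at this
  rcases this with rfl | rfl
  · exact hk2 (dt_cr_left _ _)
  · exact hk2 (dt_cr_right _ _)

/-- `J` is a corner of the cell `A`. -/
def IsCorner (A J : Finset ι) : Prop :=
  ∃ v : E3, v ≠ 0 ∧ ∀ l, (l ∈ J → dt (a l) v = 0) ∧ (l ∉ J → 0 < eps A l * dt (a l) v)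

theorem triangle_notMem (hp : ∀ i j, i ≠ j → cr (a i) (a j) ≠ 0) (h0 : ∀ i, a i ≠ 0)
    (hn : ∀ u : E3, u ≠ 0 → ∃ i, dt (a i) u ≠ 0)
    {A : Finset ι} (hA : A ∈ topes a) {i j k : ι} (hij : i ≠ j) (hw : walls a A = {i, j, k}) :
    k ∉ fl a i j := by
  intro hk
  obtain ⟨m, hm, hm2⟩ := walls_no_common a hp h0 hn hA (hp i j hij)
  rw [hw] at hm
  simp only [Finset.mem_insert, Finset.mem_singleton] at hm
  rcases hm with rfl | rfl | rfl
  · exact hm2 (dt_cr_left _ _)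
  · exact hm2 (dt_cr_right _ _)
  · exact hm2 ((mem_fl a).1 hk)

theorem triangle_corner (hp : ∀ i j, i ≠ j → cr (a i) (a j) ≠ 0) (h0 : ∀ i, a i ≠ 0)
    (hn : ∀ u : E3, u ≠ 0 → ∃ i, dt (a i) u ≠ 0)
    {A : Finset ι} (hA : A ∈ topes a) {i j k : ι} (hij : i ≠ j) (hw : walls a A = {i, j, k}) :
    IsCorner a A (fl a i j) := by
  have hk := triangle_notMem a hp h0 hn hA hij hw
  obtain ⟨v, hv, hvi, hvj, hvk⟩ : ∃ v : E3, v ≠ 0 ∧ dt (a i) v = 0 ∧ dt (a j) v = 0 ∧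
      0 < eps A k * dt (a k) v := by
    have h1 : dt (a k) (cr (a i) (a j)) ≠ 0 := fun h => hk ((mem_fl a).2 h)
    rcases lt_or_gt_of_ne (mul_ne_zero (eps_ne_zero A k) h1) with h | h
    · refine ⟨-cr (a i) (a j), neg_ne_zero.2 (hp i j hij), ?_, ?_, ?_⟩
      · rw [dt_neg, dt_cr_left, neg_zero]
      · rw [dt_neg, dt_cr_right, neg_zero]
      · rw [dt_neg]; linarith
    · exact ⟨cr (a i) (a j), hp i j hij, dt_cr_left _ _, dt_cr_right _ _, h⟩
  obtain ⟨y, hy⟩ := (mem_topes a).1 hA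
  refine ⟨v, hv, fun l => ⟨fun hl => ?_, fun hl => ?_⟩⟩
  · exact (mem_fl_of a hp hij hv hvi hvj).1 hl
  · have hne : dt (a l) v ≠ 0 := fun h => hl ((mem_fl_of a hp hij hv hvi hvj).2 h)
    rcases lt_or_gt_of_ne (mul_ne_zero (eps_ne_zero A l) hne) with h | h
    · exfalso
      set s := (eps A l * dt (a l) y) / (- (eps A l * dt (a l) v)) with hs
      have hspos : 0 < s := div_pos (hy l) (by linarith)
      have := wall_cone a hp h0 hA (x := y + s • v) (fun m hm => by
        rw [hw] at hm
        simp only [Finset.mem_insert, Finset.mem_singleton] at hm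
        rw [dt_add, dt_smul]
        rcases hm with rfl | rfl | rfl
        · rw [hvi, mul_zero, add_zero]; exact hy _
        · rw [hvj, mul_zero, add_zero]; exact hy _
        · have := mul_pos hspos hvk
          have := hy m
          nlinarith) l
      have h2 : s * (- (eps A l * dt (a l) v)) = eps A l * dt (a l) y :=
        div_mul_cancel₀ _ (by linarith)
      rw [dt_add, dt_smul] at this
      nlinarith
    · exact h

theorem corner_mem (hp : ∀ i j, i ≠ j → cr (a i) (a j) ≠ 0) (h0 : ∀ i, a i ≠ 0)
    {A J : Finset ι} (hA : A ∈ topes a) {i j k : ι} (hw : walls a A = {i, j, k})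
    (hJ : J ∈ flats a) (hJA : IsCorner a A J) (hi : i ∈ J) : j ∈ J ∨ k ∈ J := by
  by_contra hc
  push Not at hc
  obtain ⟨hj, hk⟩ := hc
  obtain ⟨v, hv, hvl⟩ := hJA
  obtain ⟨i', hi', hne⟩ := Finset.exists_mem_ne (two_le_card_flat a hJ) i
  -- a direction which is positive on one and negative on the other
  obtain ⟨d, hd1, hd2⟩ : ∃ d : E3, 0 < eps A i * dt (a i) d ∧ eps A i' * dt (a i') d < 0 := by
    obtain ⟨u, hu1, hu2⟩ := exists_kr a hp hne.symm
    rw [mem_kr] at hu1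
    have hpos := dt_self_pos (h0 i)
    set e := eps A i
    set e' := eps A i'
    have he : e * e = 1 := eps_mul_self A i
    have he' : e' * e' = 1 := eps_mul_self A i'
    refine ⟨e • a i + (-(1 + e' * (e * dt (a i') (a i))) * e' / dt (a i') u) • u, ?_, ?_⟩
    · rw [dt_add, dt_smul, dt_smul, hu1, mul_zero, add_zero, ← mul_assoc, he, one_mul]
      exact hpos
    · rw [dt_add, dt_smul, dt_smul, div_mul_cancel₀ _ hu2]
      have h9 : e' * (e * dt (a i') (a i) + -(1 + e' * (e * dt (a i') (a i))) * e') = -1 := by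
        linear_combination (-(1 + e' * (e * dt (a i') (a i)))) * he'
      rw [h9]; norm_num
  obtain ⟨ε, hε, h⟩ := exists_perturb a (eps A) v d
  have := wall_cone a hp h0 hA (x := v + ε • d) (fun m hm => by
    rw [hw] at hm
    simp only [Finset.mem_insert, Finset.mem_singleton] at hm
    rcases hm with rfl | rfl | rfl
    · rw [dt_add, dt_smul, (hvl _).1 hi, zero_add]
      have := mul_pos hε hd1
      nlinarith
    · exact h _ ((hvl _).2 hj)
    · exact h _ ((hvl _).2 hk)) i'
  rw [dt_add, dt_smul, (hvl _).1 hi', zero_add] at this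
  nlinarith

/-- Passing through a simple triple point. -/
theorem flip_tope {A : Finset ι} {i j c : ι} (hij : i ≠ j) (hic : i ≠ c) (hjc : j ≠ c)
    (hco : IsCorner a A {i, j, c}) (hj : j ∈ walls a A) :
    symmDiff (symmDiff A {i}) {c} ∈ topes a := by
  obtain ⟨v, hv, hvl⟩ := hco
  obtain ⟨y, hy⟩ := (mem_topes a).1 ((mem_walls a).1 hj)
  obtain ⟨ε, hε, h⟩ := exists_perturb a (eps A) v (-y)
  refine (mem_topes a).2 ⟨v + ε • (-y), fun l => ?_⟩
  by_cases hl : l ∈ ({i, j, c} : Finset ι)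
  · rw [dt_add, dt_smul, (hvl l).1 hl, zero_add, dt_neg]
    have hyl := mul_pos hε (hy l)
    simp only [Finset.mem_insert, Finset.mem_singleton] at hl
    rcases hl with rfl | rfl | rfl
    · rw [eps_symmDiff_of_ne _ hic, eps_symmDiff_self]
      rw [eps_symmDiff_of_ne _ hij] at hyl
      nlinarith
    · rw [eps_symmDiff_of_ne _ hjc, eps_symmDiff_of_ne _ hij.symm]
      rw [eps_symmDiff_self] at hyl
      nlinarith
    · rw [eps_symmDiff_self, eps_symmDiff_of_ne _ hic.symm]
      rw [eps_symmDiff_of_ne _ hjc.symm] at hyl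
      nlinarith
  · have hl' := hl
    simp only [Finset.mem_insert, Finset.mem_singleton, not_or] at hl'
    rw [eps_symmDiff_of_ne _ hl'.2.2, eps_symmDiff_of_ne _ hl'.1]
    exact h l ((hvl l).2 hl)

end cells

end Cheap

set_option linter.unusedSectionVars false
set_option linter.unusedVariables false
namespace Cheap

section good

variable {ι : Type*} [Fintype ι] [DecidableEq ι] {a : ι → E3}

/-- A non-degenerate arrangement: pairwise non-proportional vectors spanning `ℝ³`. -/
structure Arr (a : ι → E3) : Prop where
  hp : ∀ i j, i ≠ j → cr (a i) (a j) ≠ 0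
  h0 : ∀ i, a i ≠ 0
  hn : ∀ u : E3, u ≠ 0 → ∃ i, dt (a i) u ≠ 0
  hc : 2 ≤ Fintype.card ι

/-- `{i, j, k}` is a simple triple point. -/
def T3 (a : ι → E3) (i j k : ι) : Prop := i ≠ j ∧ i ≠ k ∧ j ≠ k ∧ fl a i j = {i, j, k}

theorem T3.swap (H : Arr a) {i j k : ι} (h : T3 a i j k) : T3 a j i k := by
  obtain ⟨h1, h2, h3, h4⟩ := h
  refine ⟨h1.symm, h3, h2, ?_⟩
  rw [← fl_comm a H.hp h1, h4]
  ext x; simp only [Finset.mem_insert, Finset.mem_singleton]; tauto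

theorem T3.rot (H : Arr a) {i j k : ι} (h : T3 a i j k) : T3 a j k i := by
  obtain ⟨h1, h2, h3, h4⟩ := h
  refine ⟨h3, h1.symm, h2.symm, ?_⟩
  rw [fl_eq a H.hp h1 h3 (fl_right a i j) (by rw [h4]; simp), h4]
  ext x; simp only [Finset.mem_insert, Finset.mem_singleton]; tauto

theorem T3.swap' (H : Arr a) {i j k : ι} (h : T3 a i j k) : T3 a i k j :=
  ((h.rot H).rot H).swap H

theorem T3.unique {i j k k' : ι} (h : T3 a i j k) (h' : T3 a i j k') : k = k' := by
  have h1 : k ∈ fl a i j := by rw [h.2.2.2]; simp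
  rw [h'.2.2.2] at h1
  simp only [Finset.mem_insert, Finset.mem_singleton] at h1
  rcases h1 with h1 | h1 | h1
  · exact absurd h1.symm h.2.1
  · exact absurd h1.symm h.2.2.1
  · exact h1

open Classical in
/-- The third element of the simple triple point on `i` and `j` (when it exists). -/
noncomputable def third (a : ι → E3) (i j : ι) : ι :=
  if h : ∃ c, T3 a i j c then h.choose else i

theorem third_eq {i j c : ι} (h : T3 a i j c) : third a i j = c := by
  have h' : ∃ c, T3 a i j c := ⟨c, h⟩
  rw [third, dif_pos h']
  exact h'.choose_spec.unique h

theorem exists_T3 (H : Arr a) {i j : ι} (hij : i ≠ j) (h : (fl a i j).card = 3) :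
    T3 a i j (third a i j) := by
  have h1 : ((fl a i j).erase i).card = 2 := by rw [Finset.card_erase_of_mem (fl_left a i j), h]
  have h2 : (((fl a i j).erase i).erase j).card = 1 := by
    rw [Finset.card_erase_of_mem (Finset.mem_erase.2 ⟨hij.symm, fl_right a i j⟩), h1]
  obtain ⟨k, hk⟩ := Finset.card_eq_one.1 h2
  have h3 : k ∈ ((fl a i j).erase i).erase j := by rw [hk]; simp
  simp only [Finset.mem_erase] at h3
  have : T3 a i j k := by
    refine ⟨hij, h3.2.1.symm, h3.1.symm, ?_⟩
    rw [← hk, Finset.insert_erase, Finset.insert_erase (fl_left a i j)]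
    exact Finset.mem_erase.2 ⟨hij.symm, fl_right a i j⟩
  rw [third_eq this]; exact this

theorem T3.card {i j k : ι} (h : T3 a i j k) : (fl a i j).card = 3 := by
  rw [h.2.2.2, Finset.card_eq_three]
  exact ⟨i, j, k, h.1, h.2.1, h.2.2.1, rfl⟩

/-- A triangular cell all of whose corners are simple triple points. -/
def Good (a : ι → E3) (A : Finset ι) (i j k : ι) : Prop :=
  A ∈ topes a ∧ walls a A = {i, j, k} ∧ T3 a i j (third a i j) ∧ T3 a i k (third a i k) ∧
    T3 a j k (third a j k)

theorem third_comm (H : Arr a) {i j c : ι} (h : T3 a i j c) : third a j i = c :=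
  third_eq (h.swap H)

theorem Good.rot (H : Arr a) {A : Finset ι} {i j k : ι} (h : Good a A i j k) : Good a A k i j := by
  obtain ⟨h1, h2, h3, h4, h5⟩ := h
  refine ⟨h1, ?_, ?_, ?_, h3⟩
  · rw [h2]; ext x; simp only [Finset.mem_insert, Finset.mem_singleton]; tauto
  · rw [third_comm H h4]; exact h4.swap H
  · rw [third_comm H h5]; exact h5.swap H

theorem Good.swap (H : Arr a) {A : Finset ι} {i j k : ι} (h : Good a A i j k) : Good a A i k j := by
  obtain ⟨h1, h2, h3, h4, h5⟩ := h
  refine ⟨h1, ?_, h4, h3, ?_⟩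
  · rw [h2]; ext x; simp only [Finset.mem_insert, Finset.mem_singleton]; tauto
  · rw [third_comm H h5]; exact h5.swap H

theorem Good.third_ne (H : Arr a) {A : Finset ι} {i j k : ι} (h : Good a A i j k) :
    third a i j ≠ third a i k := by
  obtain ⟨h1, h2, h3, h4, h5⟩ := h
  intro he
  rw [he] at h3
  exact h5.1 ((h3.swap' H).unique (h4.swap' H))

theorem Good.flip_aux (H : Arr a) {A : Finset ι} {i j k : ι} (h : Good a A i j k) :
    symmDiff A {i} ∈ topes a ∧ ({i, third a i j, third a i k} : Finset ι) ⊆ walls a (symmDiff A {i}) := by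
  obtain ⟨h1, h2, h3, h4, h5⟩ := h
  have hi : i ∈ walls a A := by rw [h2]; simp
  have hj : j ∈ walls a A := by rw [h2]; simp
  have hk : k ∈ walls a A := by rw [h2]; simp
  have hw2 : walls a A = {i, k, j} := by
    rw [h2]; ext x; simp only [Finset.mem_insert, Finset.mem_singleton]; tauto
  have c1 := triangle_corner a H.hp H.h0 H.hn h1 h3.1 h2
  have c2 := triangle_corner a H.hp H.h0 H.hn h1 h4.1 hw2
  rw [h3.2.2.2] at c1
  rw [h4.2.2.2] at c2
  refine ⟨(mem_walls a).1 hi, ?_⟩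
  intro x hx
  simp only [Finset.mem_insert, Finset.mem_singleton] at hx
  rw [mem_walls]
  rcases hx with rfl | rfl | rfl
  · rwa [symmDiff_assoc, symmDiff_self, symmDiff_bot]
  · exact flip_tope a h3.1 h3.2.1 h3.2.2.1 c1 hj
  · exact flip_tope a h4.1 h4.2.1 h4.2.2.1 c2 hk

theorem Good.card_three (H : Arr a) {A : Finset ι} {i j k : ι} (h : Good a A i j k) :
    ({i, third a i j, third a i k} : Finset ι).card = 3 :=
  Finset.card_eq_three.2 ⟨_, _, _, h.2.2.1.2.1, h.2.2.2.1.2.1, h.third_ne H, rfl⟩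

theorem Good.flip_walls (H : Arr a) {A : Finset ι} {i j k : ι} (h : Good a A i j k)
    (hc : (walls a (symmDiff A {i})).card = 3) :
    walls a (symmDiff A {i}) = {i, third a i j, third a i k} :=
  (Finset.eq_of_subset_of_card_le (h.flip_aux H).2 (by rw [hc, h.card_three H])).symm

theorem Good.flip_good (H : Arr a) {A : Finset ι} {i j k : ι} (h : Good a A i j k)
    (hc : (walls a (symmDiff A {i})).card = 3)
    (hf : (fl a (third a i j) (third a i k)).card = 3) :
    Good a (symmDiff A {i}) i (third a i j) (third a i k) := by
  refine ⟨(h.flip_aux H).1, h.flip_walls H hc, ?_, ?_, exists_T3 H (h.third_ne H) hf⟩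
  · have := h.2.2.1.swap' H
    rw [third_eq this]; exact this
  · have := h.2.2.2.1.swap' H
    rw [third_eq this]; exact this

/-- Number of cells having a given corner. -/
theorem card_corner (H : Arr a) {J : Finset ι} (hJ : J ∈ flats a)
    [DecidablePred fun A => IsCorner a A J] :
    ((topes a).filter fun A => IsCorner a A J).card ≤ 4 * J.card := by
  obtain ⟨i, j, hij, rfl⟩ := (mem_flats a).1 hJ
  set J := fl a i j with hJd
  obtain ⟨l0, hl0⟩ := H.hn _ (H.hp i j hij)
  have hl0J : l0 ∉ J := fun h => hl0 ((mem_fl a).1 h)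
  have hcard : (pat a ⊤ J ×ˢ (Finset.univ : Finset Bool)).card = 4 * J.card := by
    rw [Finset.card_product, card_pat_top a H.hp H.h0 ⟨i, fl_left a i j⟩, phi_flat a H.hp hJ]
    have := two_le_card_flat a hJ
    simp only [Finset.card_univ, Fintype.card_bool]
    omega
  rw [← hcard]
  apply Finset.card_le_card_of_injOn (fun A => (A ∩ J, decide (l0 ∈ A)))
  · intro A hA
    simp only [Finset.coe_filter, Set.mem_ofPred_eq] at hA
    simp only [Finset.coe_product, Set.mem_prod, Finset.mem_coe, Finset.mem_univ, and_true]
    obtain ⟨x, hx⟩ := (mem_topes a).1 hA.1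
    refine (mem_pat a).2 ⟨Finset.inter_subset_right, x, trivial, fun l hl => ?_⟩
    have := hx l
    simp only [eps, Finset.mem_inter, hl, and_true] at this ⊢
    exact this
  · intro A hA B hB h
    simp only [Finset.coe_filter, Set.mem_ofPred_eq] at hA hB
    obtain ⟨-, v, hv, hvl⟩ := hA
    obtain ⟨-, w, hw, hwl⟩ := hB
    simp only [Prod.mk.injEq, decide_eq_decide] at h
    obtain ⟨hAB, hl⟩ := h
    have hvi := (hvl i).1 (fl_left a i j)
    have hvj := (hvl j).1 (fl_right a i j)
    have hwi := (hwl i).1 (fl_left a i j)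
    have hwj := (hwl j).1 (fl_right a i j)
    obtain ⟨s, hs⟩ := eq_smul_cr (H.hp i j hij) hvi hvj
    obtain ⟨t, ht⟩ := eq_smul_cr (H.hp i j hij) hwi hwj
    have e0 : eps A l0 = eps B l0 := by simp only [eps, hl]
    have p1 := (hvl l0).2 hl0J
    have p2 := (hwl l0).2 hl0J
    rw [hs, dt_smul] at p1
    rw [ht, dt_smul, ← e0] at p2
    have hst : 0 < s * t := by
      have := mul_pos p1 p2
      have h3 : 0 < (s * t) * (eps A l0 * dt (a l0) (cr (a i) (a j))) ^ 2 := by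
        nlinarith
      exact (pos_iff_pos_of_mul_pos h3).2 (by
        have : eps A l0 * dt (a l0) (cr (a i) (a j)) ≠ 0 := mul_ne_zero (eps_ne_zero _ _) hl0
        positivity)
    ext l
    by_cases hlJ : l ∈ J
    · have := congrArg (l ∈ ·) hAB
      simpa [hlJ] using this
    · have q1 := (hvl l).2 hlJ
      have q2 := (hwl l).2 hlJ
      rw [hs, dt_smul] at q1
      rw [ht, dt_smul] at q2
      have := mul_pos q1 q2
      have h3 : 0 < (s * t) * (dt (a l) (cr (a i) (a j))) ^ 2 * (eps A l * eps B l) := by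
        nlinarith
      have h4 : 0 < eps A l * eps B l := by
        refine (pos_iff_pos_of_mul_pos h3).1 ?_
        have : dt (a l) (cr (a i) (a j)) ≠ 0 := fun h => hlJ ((mem_fl a).2 h)
        positivity
      unfold eps at h4
      split_ifs at h4 with p q q <;> first | tauto | norm_num at h4

open Classical in
/-- Number of simple points. -/
noncomputable def N2 (a : ι → E3) : ℕ := ((flats a).filter fun J => J.card = 2).card

open Classical in
/-- Corners of cells at points which are not simple triple points. -/
noncomputable def Co (a : ι → E3) : Finset (Finset ι × Finset ι) :=
  (topes a ×ˢ flats a).filter fun p => p.2.card ≠ 3 ∧ IsCorner a p.1 p.2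

open Classical in
/-- Flags of non triangular cells. -/
noncomputable def Qs (a : ι → E3) : Finset (Finset ι × ι) :=
  (topes a ×ˢ Finset.univ).filter fun p => p.2 ∈ walls a p.1 ∧ 4 ≤ (walls a p.1).card

theorem card_Co (H : Arr a) :
    (Co a).card ≤ ∑ J ∈ flats a, if J.card ≠ 3 then 4 * J.card else 0 := by
  classical
  have h1 : Co a ⊆ ((flats a).filter fun J => J.card ≠ 3).biUnion fun J =>
      ((topes a).filter fun A => IsCorner a A J).image fun A => (A, J) := by
    intro p hp
    simp only [Co, Finset.mem_filter, Finset.mem_product] at hp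
    simp only [Finset.mem_biUnion, Finset.mem_filter, Finset.mem_image]
    exact ⟨p.2, ⟨hp.1.2, hp.2.1⟩, p.1, ⟨hp.1.1, hp.2.2⟩, rfl⟩
  refine (Finset.card_le_card h1).trans (Finset.card_biUnion_le.trans ?_)
  rw [← Finset.sum_filter]
  refine Finset.sum_le_sum fun J hJ => Finset.card_image_le.trans ?_
  exact card_corner H (Finset.mem_filter.1 hJ).1

theorem card_Qs (H : Arr a) :
    ((Qs a).card : ℤ) ≤ 4 * ∑ A ∈ topes a, ((walls a A).card - 3 : ℤ) := by
  classical
  have h1 : Qs a ⊆ ((topes a).filter fun A => 4 ≤ (walls a A).card).biUnion fun A =>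
      (walls a A).image fun i => (A, i) := by
    intro p hp
    simp only [Qs, Finset.mem_filter, Finset.mem_product] at hp
    simp only [Finset.mem_biUnion, Finset.mem_filter, Finset.mem_image]
    exact ⟨p.1, ⟨hp.1.1, hp.2.2⟩, p.2, hp.2.1, rfl⟩
  have h2 : (Qs a).card ≤ ∑ A ∈ topes a, if 4 ≤ (walls a A).card then (walls a A).card else 0 := by
    refine (Finset.card_le_card h1).trans (Finset.card_biUnion_le.trans ?_)
    rw [← Finset.sum_filter]
    exact Finset.sum_le_sum fun J hJ => Finset.card_image_le
  calc ((Qs a).card : ℤ) ≤ ((∑ A ∈ topes a, if 4 ≤ (walls a A).card then (walls a A).card else 0 : ℕ) : ℤ) := by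
        exact_mod_cast h2
    _ ≤ _ := by
      push_cast
      rw [Finset.mul_sum]
      refine Finset.sum_le_sum fun A hA => ?_
      have := three_le_walls a H.hp H.h0 H.hn H.hc hA
      split_ifs <;> omega

theorem count_main (H : Arr a) :
    (Qs a).card + (Co a).card ≤ 24 * N2 a ∧ (Qs a).card + 3 * (Co a).card ≤ 72 * N2 a := by
  classical
  have hm := melchior a H.hp H.h0 H.hc
  have hQ := card_Qs H
  have hC : ((Co a).card : ℤ) ≤ ∑ J ∈ flats a,
      (24 * (if J.card = 2 then 1 else 0) - 8 * (6 - 2 * (J.card : ℤ))) := by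
    refine (Int.ofNat_le.2 (card_Co H)).trans ?_
    push_cast
    refine Finset.sum_le_sum fun J hJ => ?_
    have := two_le_card_flat a hJ
    split_ifs <;> omega
  rw [Finset.sum_sub_distrib, ← Finset.mul_sum, ← Finset.mul_sum, ← hm] at hC
  have hN : (∑ J ∈ flats a, (if J.card = 2 then 1 else 0 : ℤ)) = N2 a := by
    simp [N2]
  rw [hN] at hC
  have hY : 0 ≤ ∑ A ∈ topes a, ((walls a A).card - 3 : ℤ) := by
    refine Finset.sum_nonneg fun A hA => ?_
    have := three_le_walls a H.hp H.h0 H.hn H.hc hA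
    omega
  constructor <;> omega

end good

end Cheap

set_option linter.unusedSectionVars false
set_option linter.unusedVariables false
namespace Cheap

section states

variable {ι : Type*} [Fintype ι] [DecidableEq ι] {a : ι → E3}

/-- A labelled triangle. -/
abbrev St (ι : Type*) := Finset ι × ι × ι × ι

/-- Goodness of a labelled triangle. -/
def GoodS (a : ι → E3) (s : St ι) : Prop := Good a s.1 s.2.1 s.2.2.1 s.2.2.2

/-- Reflection of a labelled triangle across its first wall. -/
noncomputable def Fm (a : ι → E3) (s : St ι) : St ι :=
  (symmDiff s.1 {s.2.1}, s.2.1, third a s.2.1 s.2.2.1, third a s.2.1 s.2.2.2)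

/-- Rotation of the labels. -/
def rt (s : St ι) : St ι := (s.1, s.2.2.2, s.2.1, s.2.2.1)

/-- Reflection across the last wall. -/
noncomputable def Gm (a : ι → E3) (s : St ι) : St ι := Fm a (rt s)

theorem GoodS.rt (H : Arr a) {s : St ι} (h : GoodS a s) : GoodS a (rt s) := Good.rot H h

theorem rt_inj {s s' : St ι} (h : rt s = rt s') : s = s' := by
  obtain ⟨A, i, j, k⟩ := s
  obtain ⟨A', i', j', k'⟩ := s'
  simp only [rt, Prod.mk.injEq] at h ⊢
  tauto

theorem Fm_inj (H : Arr a) {s s' : St ι} (h : GoodS a s) (h' : GoodS a s')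
    (he : Fm a s = Fm a s') : s = s' := by
  obtain ⟨A, i, j, k⟩ := s
  obtain ⟨A', i', j', k'⟩ := s'
  simp only [Fm, Prod.mk.injEq] at he
  obtain ⟨h1, rfl, h3, h4⟩ := he
  have hA : A = A' := symmDiff_left_injective _ h1
  subst hA
  obtain ⟨-, -, g1, g2, -⟩ := h
  obtain ⟨-, -, g1', g2', -⟩ := h'
  simp only at g1 g2 g1' g2'
  rw [← h3] at g1'
  rw [← h4] at g2'
  have := (g1.swap' H).unique (g1'.swap' H)
  have := (g2.swap' H).unique (g2'.swap' H)
  simp_all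

theorem Gm_inj (H : Arr a) {s s' : St ι} (h : GoodS a s) (h' : GoodS a s')
    (he : Gm a s = Gm a s') : s = s' :=
  rt_inj (Fm_inj H (h.rt H) (h'.rt H) he)

open Classical in
/-- Good labelled triangles whose reflection is not good. -/
noncomputable def Fail (a : ι → E3) : Finset (St ι) :=
  Finset.univ.filter fun s => GoodS a s ∧ ¬ GoodS a (Fm a s)

open Classical in
/-- Flags which are bad for the reflection. -/
noncomputable def BF (a : ι → E3) : Finset (Finset ι × ι) :=
  Finset.univ.filter fun p => ∃ J, (p.1, J) ∈ Co a ∧ walls a p.1 \ J = {p.2}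

theorem card_BF : (BF a).card ≤ (Co a).card := by
  classical
  apply Finset.card_le_card_of_forall_subsingleton
    (fun (p : Finset ι × ι) (q : Finset ι × Finset ι) => p.1 = q.1 ∧ walls a p.1 \ q.2 = {p.2})
  · intro p hp
    obtain ⟨J, hJ, h⟩ := (Finset.mem_filter.1 hp).2
    exact ⟨(p.1, J), hJ, rfl, h⟩
  · rintro ⟨B, J⟩ - ⟨A, i⟩ ⟨-, h1, h2⟩ ⟨A', i'⟩ ⟨-, h3, h4⟩
    simp only at h1 h2 h3 h4
    subst h1 h3
    rw [h2] at h4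
    simp only [Finset.singleton_inj] at h4
    rw [h4]

theorem card_Fail (H : Arr a) : (Fail a).card ≤ 48 * N2 a := by
  classical
  have hcount := (count_main H).1
  have hBF := card_BF (a := a)
  have h1 : (Qs a ∪ BF a).card ≤ 24 * N2 a := (Finset.card_union_le _ _).trans (by omega)
  have h2 : (Fail a).card ≤ 2 * (Qs a ∪ BF a).card := by
    apply Finset.card_le_mul_card_image_of_maps_to
      (f := fun s : St ι => (symmDiff s.1 {s.2.1}, s.2.1))
    · rintro ⟨A, i, j, k⟩ hs
      obtain ⟨hg, hf⟩ := (Finset.mem_filter.1 hs).2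
      have hg' : Good a A i j k := hg
      have hf' : ¬ Good a (symmDiff A {i}) i (third a i j) (third a i k) := hf
      obtain ⟨ht, hsub⟩ := hg'.flip_aux H
      have h3 := three_le_walls a H.hp H.h0 H.hn H.hc ht
      rw [Finset.mem_union]
      by_cases h4 : 4 ≤ (walls a (symmDiff A {i})).card
      · left
        simp only [Qs, Finset.mem_filter, Finset.mem_product, Finset.mem_univ, and_true]
        exact ⟨ht, hsub (by simp), h4⟩
      · right
        have h5 : (walls a (symmDiff A {i})).card = 3 := by omega
        have hw := hg'.flip_walls H h5
        have hne := hg'.third_ne H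
        have h6 : (fl a (third a i j) (third a i k)).card ≠ 3 := fun h =>
          hf' (hg'.flip_good H h5 h)
        have hw' : walls a (symmDiff A {i}) = {third a i j, third a i k, i} := by
          rw [hw]; ext x; simp only [Finset.mem_insert, Finset.mem_singleton]; tauto
        have hni := triangle_notMem a H.hp H.h0 H.hn ht hne hw'
        have hco := triangle_corner a H.hp H.h0 H.hn ht hne hw'
        simp only [BF, Finset.mem_filter, Finset.mem_univ, true_and]
        refine ⟨fl a (third a i j) (third a i k), ?_, ?_⟩
        · simp only [Co, Finset.mem_filter, Finset.mem_product]
          exact ⟨⟨ht, fl_mem_flats a hne⟩, h6, hco⟩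
        · rw [hw']
          ext x
          simp only [Finset.mem_sdiff, Finset.mem_insert, Finset.mem_singleton]
          constructor
          · rintro ⟨rfl | rfl | rfl, h⟩
            · exact absurd (fl_left a _ _) h
            · exact absurd (fl_right a _ _) h
            · rfl
          · rintro rfl
            exact ⟨by simp, hni⟩
    · rintro ⟨B, i⟩ -
      -- at most two labelled triangles with the same cell and first wall
      by_cases hne : ((Fail a).filter fun s => (symmDiff s.1 {s.2.1}, s.2.1) = (B, i)).Nonempty
      · obtain ⟨⟨A, i', j, k⟩, hs⟩ := hne
        have hsub : ((Fail a).filter fun s => (symmDiff s.1 {s.2.1}, s.2.1) = (B, i)) ⊆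
            {(A, i, j, k), (A, i, k, j)} := by
          rintro ⟨A', i'', j', k'⟩ hs'
          simp only [Finset.mem_filter, Prod.mk.injEq] at hs hs'
          obtain ⟨hs1, hs2, rfl⟩ := hs
          obtain ⟨hs1', hs2', rfl⟩ := hs'
          have hA : A' = A := by
            apply symmDiff_left_injective {i''}
            rw [← hs2] at hs2'
            exact hs2'
          subst hA
          have g : Good a A' i'' j k := (Finset.mem_filter.1 hs1).2.1
          have g' : Good a A' i'' j' k' := (Finset.mem_filter.1 hs1').2.1
          have hw := g.2.1
          rw [g'.2.1] at hw
          have e1 := g'.2.2.1.1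
          have e2 := g'.2.2.2.1.1
          have e3 := g'.2.2.2.2.1
          have m1 : j' ∈ ({i'', j, k} : Finset ι) := by rw [← hw]; simp
          have m2 : k' ∈ ({i'', j, k} : Finset ι) := by rw [← hw]; simp
          simp only [Finset.mem_insert, Finset.mem_singleton] at m1 m2
          simp only [Finset.mem_insert, Finset.mem_singleton, Prod.mk.injEq, true_and]
          grind
        exact (Finset.card_le_card hsub).trans Finset.card_le_two
      · rw [Finset.not_nonempty_iff_eq_empty] at hne
        rw [hne]; simp
  omega

/-- The regularity condition on a labelled triangle. -/
def RG (a : ι → E3) (s : St ι) : Prop :=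
  GoodS a s ∧ GoodS a (Fm a s) ∧ GoodS a (Gm a s) ∧ GoodS a (Gm a (Fm a s)) ∧
    GoodS a (Gm a (Gm a s)) ∧ GoodS a (Gm a (Gm a (Gm a s)))

open Classical in
/-- Good labelled triangles which are not regular. -/
noncomputable def BS (a : ι → E3) : Finset (St ι) :=
  Finset.univ.filter fun s => GoodS a s ∧ ¬ RG a s

theorem card_BS (H : Arr a) : (BS a).card ≤ 240 * N2 a := by
  classical
  have key : ∀ (P : St ι → Prop) (g : St ι → St ι), (∀ s s', P s → P s' → g s = g s' → s = s') →
      ∃ t : Finset (St ι), t.card ≤ 48 * N2 a ∧ ∀ s, P s → g s ∈ Fail a → s ∈ t := by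
    intro P g hg
    refine ⟨Finset.univ.filter fun s => P s ∧ g s ∈ Fail a,
      le_trans (Finset.card_le_card_of_injOn g ?_ ?_) (card_Fail H), ?_⟩
    · intro s hs
      exact (Finset.mem_filter.1 hs).2.2
    · intro s hs s' hs' h
      exact hg s s' (Finset.mem_filter.1 hs).2.1 (Finset.mem_filter.1 hs').2.1 h
    · intro s h1 h2
      exact Finset.mem_filter.2 ⟨Finset.mem_univ _, h1, h2⟩
  have mf : ∀ s, GoodS a s → ¬ GoodS a (Fm a s) → s ∈ Fail a := fun s h1 h2 =>
    Finset.mem_filter.2 ⟨Finset.mem_univ _, h1, h2⟩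
  obtain ⟨t1, k1, m1⟩ := key (GoodS a) id (fun s s' _ _ h => h)
  obtain ⟨t2, k2, m2⟩ := key (GoodS a) rt (fun s s' _ _ h => rt_inj h)
  obtain ⟨t3, k3, m3⟩ := key (GoodS a) (fun s => rt (Fm a s))
    (fun s s' h1 h2 h => Fm_inj H h1 h2 (rt_inj h))
  obtain ⟨t4, k4, m4⟩ := key (GoodS a) (fun s => rt (Gm a s))
    (fun s s' h1 h2 h => Gm_inj H h1 h2 (rt_inj h))
  obtain ⟨t5, k5, m5⟩ := key (fun s => GoodS a s ∧ GoodS a (Gm a s)) (fun s => rt (Gm a (Gm a s)))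
    (fun s s' h1 h2 h => Gm_inj H h1.1 h2.1 (Gm_inj H h1.2 h2.2 (rt_inj h)))
  have hsub : BS a ⊆ t1 ∪ (t2 ∪ (t3 ∪ (t4 ∪ t5))) := by
    intro s hs
    obtain ⟨h0, hr⟩ := (Finset.mem_filter.1 hs).2
    simp only [Finset.mem_union]
    by_cases h1 : GoodS a (Fm a s)
    swap
    · exact Or.inl (m1 s h0 (mf _ h0 h1))
    by_cases h2 : GoodS a (Gm a s)
    swap
    · exact Or.inr (Or.inl (m2 s h0 (mf _ (h0.rt H) h2)))
    by_cases h3 : GoodS a (Gm a (Fm a s))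
    swap
    · exact Or.inr (Or.inr (Or.inl (m3 s h0 (mf _ (h1.rt H) h3))))
    by_cases h4 : GoodS a (Gm a (Gm a s))
    swap
    · exact Or.inr (Or.inr (Or.inr (Or.inl (m4 s h0 (mf _ (h2.rt H) h4)))))
    by_cases h5 : GoodS a (Gm a (Gm a (Gm a s)))
    swap
    · exact Or.inr (Or.inr (Or.inr (Or.inr (m5 s ⟨h0, h2⟩ (mf _ (h4.rt H) h5)))))
    exact absurd ⟨h0, h1, h2, h3, h4, h5⟩ hr
  refine (Finset.card_le_card hsub).trans ?_
  have u0 := Finset.card_union_le t1 (t2 ∪ (t3 ∪ (t4 ∪ t5)))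
  have u1 := Finset.card_union_le t2 (t3 ∪ (t4 ∪ t5))
  have u2 := Finset.card_union_le t3 (t4 ∪ t5)
  have u3 := Finset.card_union_le t4 t5
  omega

open Classical in
/-- Flags of cells which are not good. -/
noncomputable def NG (a : ι → E3) : Finset (Finset ι × ι) :=
  (topes a ×ˢ Finset.univ).filter fun p => p.2 ∈ walls a p.1 ∧ ¬ ∃ j k, Good a p.1 p.2 j k

set_option maxHeartbeats 1000000 in
theorem card_NG (H : Arr a) : (NG a).card ≤ 72 * N2 a := by
  classical
  have hcount := (count_main H).2
  have hsub : NG a ⊆ Qs a ∪ ((Co a).filter fun q => (walls a q.1).card = 3).biUnion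
      fun q => (walls a q.1).image fun i => (q.1, i) := by
    intro p hp
    obtain ⟨A, i⟩ := p
    simp only [NG, Finset.mem_filter, Finset.mem_product, Finset.mem_univ, and_true] at hp
    obtain ⟨hA, hi, hng⟩ := hp
    have h3 := three_le_walls a H.hp H.h0 H.hn H.hc hA
    rw [Finset.mem_union]
    by_cases h4 : 4 ≤ (walls a A).card
    · left
      simp only [Qs, Finset.mem_filter, Finset.mem_product, Finset.mem_univ, and_true]
      exact ⟨hA, hi, h4⟩
    · right
      have h5 : (walls a A).card = 3 := by omega
      have h6 : ((walls a A).erase i).card = 2 := by rw [Finset.card_erase_of_mem hi, h5]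
      obtain ⟨j, k, hjk, he⟩ := Finset.card_eq_two.1 h6
      have hw : walls a A = {i, j, k} := by rw [← he, Finset.insert_erase hi]
      have hij : i ≠ j := by
        rintro rfl
        have : i ∈ (walls a A).erase i := by rw [he]; simp
        simp at this
      have hik : i ≠ k := by
        rintro rfl
        have : i ∈ (walls a A).erase i := by rw [he]; simp
        simp at this
      suffices hJ : ∃ J, (A, J) ∈ Co a by
        obtain ⟨J, hJ⟩ := hJ
        simp only [Finset.mem_biUnion, Finset.mem_filter, Finset.mem_image]
        exact ⟨(A, J), ⟨hJ, h5⟩, i, hi, rfl⟩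
      have mk : ∀ x y z, x ≠ y → walls a A = {x, y, z} → (fl a x y).card ≠ 3 →
          ∃ J, (A, J) ∈ Co a := by
        intro x y z hxy hw' hc
        refine ⟨fl a x y, ?_⟩
        simp only [Co, Finset.mem_filter, Finset.mem_product]
        exact ⟨⟨hA, fl_mem_flats a hxy⟩, hc, triangle_corner a H.hp H.h0 H.hn hA hxy hw'⟩
      by_contra hno
      apply hng
      refine ⟨j, k, hA, hw, ?_, ?_, ?_⟩
      · refine exists_T3 H hij ?_
        by_contra hc
        exact hno (mk i j k hij hw hc)
      · refine exists_T3 H hik ?_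
        by_contra hc
        refine hno (mk i k j hik ?_ hc)
        rw [hw]; ext x; simp only [Finset.mem_insert, Finset.mem_singleton]; tauto
      · refine exists_T3 H hjk ?_
        by_contra hc
        refine hno (mk j k i hjk ?_ hc)
        rw [hw]; ext x; simp only [Finset.mem_insert, Finset.mem_singleton]; tauto
  refine (Finset.card_le_card hsub).trans ((Finset.card_union_le _ _).trans ?_)
  have h7 := Finset.card_biUnion_le_card_mul ((Co a).filter fun q => (walls a q.1).card = 3)
      (fun q => (walls a q.1).image fun i => (q.1, i)) 3 (fun q hq =>
        Finset.card_image_le.trans (le_of_eq (Finset.mem_filter.1 hq).2))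
  have h8 := Finset.card_filter_le (Co a) fun q => (walls a q.1).card = 3
  omega

end states

end Cheap

set_option linter.unusedSectionVars false
set_option linter.unusedVariables false
namespace Cheap

section forms

/-- Quadratic forms on `ℝ³`. -/
def Quad : Submodule ℝ (E3 → ℝ) :=
  Submodule.span ℝ (Set.range fun p : E3 × E3 => fun x => dt p.1 x * dt p.2 x)

/-- Cubic forms on `ℝ³`. -/
def Cub : Submodule ℝ (E3 → ℝ) :=
  Submodule.span ℝ (Set.range fun p : E3 × E3 × E3 => fun x => dt p.1 x * dt p.2.1 x * dt p.2.2 x)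

theorem mul_mem_Quad (u v : E3) : (fun x => dt u x * dt v x) ∈ Quad :=
  Submodule.subset_span ⟨(u, v), rfl⟩

theorem mul_mem_Cub (u v w : E3) : (fun x => dt u x * dt v x * dt w x) ∈ Cub :=
  Submodule.subset_span ⟨(u, v, w), rfl⟩

theorem dt_add_left (x y z : E3) : dt (x + y) z = dt x z + dt y z := by
  rw [dt_comm, dt_add, dt_comm z x, dt_comm z y]

theorem dt_smul_left (c : ℝ) (x z : E3) : dt (c • x) z = c * dt x z := by
  rw [dt_comm, dt_smul, dt_comm z x]

theorem fac_cub {f : E3 → ℝ} (hf : f ∈ Cub) (n w : E3) :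
    ∃ g ∈ Quad, ∀ x, f x = f (x - dt n x • w) + dt n x * g x := by
  induction hf using Submodule.span_induction with
  | mem f h =>
    obtain ⟨⟨u, v, z⟩, rfl⟩ := h
    refine ⟨(dt u w) • (fun x => dt v x * dt z x) + ((dt v w) • (fun x => dt u x * dt z x) -
      (dt v w * dt u w) • (fun x => dt n x * dt z x)) + (dt z w) • ((fun x => dt u x * dt v x) -
      dt v w • (fun x => dt u x * dt n x) - dt u w • (fun x => dt n x * dt v x) +
      (dt u w * dt v w) • (fun x => dt n x * dt n x)), ?_, ?_⟩
    · refine Submodule.add_mem _ (Submodule.add_mem _ (Submodule.smul_mem _ _ (mul_mem_Quad _ _))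
        (Submodule.sub_mem _ (Submodule.smul_mem _ _ (mul_mem_Quad _ _))
        (Submodule.smul_mem _ _ (mul_mem_Quad _ _)))) (Submodule.smul_mem _ _ ?_)
      exact Submodule.add_mem _ (Submodule.sub_mem _ (Submodule.sub_mem _ (mul_mem_Quad _ _)
        (Submodule.smul_mem _ _ (mul_mem_Quad _ _))) (Submodule.smul_mem _ _ (mul_mem_Quad _ _)))
        (Submodule.smul_mem _ _ (mul_mem_Quad _ _))
    · intro x
      simp only [dt_sub, dt_smul, Pi.add_apply, Pi.sub_apply, Pi.smul_apply, smul_eq_mul]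
      ring
  | zero => exact ⟨0, Submodule.zero_mem _, fun x => by simp⟩
  | add f1 f2 _ _ h1 h2 =>
    obtain ⟨g1, m1, e1⟩ := h1
    obtain ⟨g2, m2, e2⟩ := h2
    refine ⟨g1 + g2, Submodule.add_mem _ m1 m2, fun x => ?_⟩
    simp only [Pi.add_apply]
    rw [e1 x, e2 x]; ring
  | smul c f1 _ h1 =>
    obtain ⟨g1, m1, e1⟩ := h1
    refine ⟨c • g1, Submodule.smul_mem _ _ m1, fun x => ?_⟩
    simp only [Pi.smul_apply, smul_eq_mul]
    rw [e1 x]; ring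

theorem fac_quad {f : E3 → ℝ} (hf : f ∈ Quad) (n w : E3) :
    ∃ l : E3, ∀ x, f x = f (x - dt n x • w) + dt n x * dt l x := by
  induction hf using Submodule.span_induction with
  | mem f h =>
    obtain ⟨⟨u, v⟩, rfl⟩ := h
    refine ⟨(dt u w) • v + dt v w • u + (-(dt u w * dt v w)) • n, ?_⟩
    intro x
    simp only [dt_sub, dt_smul, dt_add_left, dt_smul_left]
    ring
  | zero => exact ⟨0, fun x => by simp [dt]⟩
  | add f1 f2 _ _ h1 h2 =>
    obtain ⟨g1, e1⟩ := h1
    obtain ⟨g2, e2⟩ := h2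
    refine ⟨g1 + g2, fun x => ?_⟩
    simp only [Pi.add_apply, dt_add_left]
    rw [e1 x, e2 x]; ring
  | smul c f1 _ h1 =>
    obtain ⟨g1, e1⟩ := h1
    refine ⟨c • g1, fun x => ?_⟩
    simp only [Pi.smul_apply, smul_eq_mul, dt_smul_left]
    rw [e1 x]; ring

theorem line_cub {f : E3 → ℝ} (hf : f ∈ Cub) (u v : E3) : ∃ α β γ δ : ℝ, ∀ s t : ℝ,
    f (s • u + t • v) = α * s ^ 3 + β * s ^ 2 * t + γ * s * t ^ 2 + δ * t ^ 3 := by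
  induction hf using Submodule.span_induction with
  | mem f h =>
    obtain ⟨⟨x, y, z⟩, rfl⟩ := h
    refine ⟨dt x u * dt y u * dt z u,
      dt x v * dt y u * dt z u + dt x u * dt y v * dt z u + dt x u * dt y u * dt z v,
      dt x u * dt y v * dt z v + dt x v * dt y u * dt z v + dt x v * dt y v * dt z u,
      dt x v * dt y v * dt z v, ?_⟩
    intro s t
    simp only [dt_add, dt_smul]
    ring
  | zero => exact ⟨0, 0, 0, 0, fun s t => by simp⟩
  | add f1 f2 _ _ h1 h2 =>
    obtain ⟨p1, p2, p3, p4, e1⟩ := h1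
    obtain ⟨q1, q2, q3, q4, e2⟩ := h2
    refine ⟨p1 + q1, p2 + q2, p3 + q3, p4 + q4, fun s t => ?_⟩
    simp only [Pi.add_apply]
    rw [e1, e2]; ring
  | smul c f1 _ h1 =>
    obtain ⟨p1, p2, p3, p4, e1⟩ := h1
    refine ⟨c * p1, c * p2, c * p3, c * p4, fun s t => ?_⟩
    simp only [Pi.smul_apply, smul_eq_mul]
    rw [e1]; ring

theorem line_quad {f : E3 → ℝ} (hf : f ∈ Quad) (u v : E3) : ∃ α β γ : ℝ, ∀ s t : ℝ,
    f (s • u + t • v) = α * s ^ 2 + β * s * t + γ * t ^ 2 := by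
  induction hf using Submodule.span_induction with
  | mem f h =>
    obtain ⟨⟨x, y⟩, rfl⟩ := h
    refine ⟨dt x u * dt y u, dt x v * dt y u + dt x u * dt y v, dt x v * dt y v, ?_⟩
    intro s t
    simp only [dt_add, dt_smul]
    ring
  | zero => exact ⟨0, 0, 0, fun s t => by simp⟩
  | add f1 f2 _ _ h1 h2 =>
    obtain ⟨p1, p2, p3, e1⟩ := h1
    obtain ⟨q1, q2, q3, e2⟩ := h2
    refine ⟨p1 + q1, p2 + q2, p3 + q3, fun s t => ?_⟩
    simp only [Pi.add_apply]
    rw [e1, e2]; ring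
  | smul c f1 _ h1 =>
    obtain ⟨p1, p2, p3, e1⟩ := h1
    refine ⟨c * p1, c * p2, c * p3, fun s t => ?_⟩
    simp only [Pi.smul_apply, smul_eq_mul]
    rw [e1]; ring

/-- A vector in the plane of two independent vectors. -/
theorem eq_comb {u v x : E3} (h : cr u v ≠ 0) (hx : dt x (cr u v) = 0) :
    ∃ s t : ℝ, x = s • u + t • v := by
  have hpos := dt_self_pos h
  refine ⟨dt (cr x v) (cr u v) / dt (cr u v) (cr u v), dt (cr u x) (cr u v) / dt (cr u v) (cr u v), ?_⟩
  have key : dt (cr u v) (cr u v) • x = dt (cr x v) (cr u v) • u + dt (cr u x) (cr u v) • v := by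
    simp only [dt, cr, Matrix.cons_val] at hx
    ext i
    fin_cases i <;> simp [dt, cr]
    · linear_combination (u 1 * v 2 - u 2 * v 1) * hx
    · linear_combination (u 2 * v 0 - u 0 * v 2) * hx
    · linear_combination (u 0 * v 1 - u 1 * v 0) * hx
  have h2 : x = (dt (cr u v) (cr u v))⁻¹ • (dt (cr u v) (cr u v) • x) := by
    rw [smul_smul, inv_mul_cancel₀ hpos.ne', one_smul]
  rw [key] at h2
  rw [smul_add, smul_smul, smul_smul] at h2
  rw [div_eq_inv_mul, div_eq_inv_mul]
  exact h2

end forms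

section chasles

variable {ι : Type*} [Fintype ι] [DecidableEq ι] {a : ι → E3}

theorem T3.comb (H : Arr a) {i j k : ι} (h : T3 a i j k) :
    ∃ s t : ℝ, s ≠ 0 ∧ t ≠ 0 ∧ a k = s • a i + t • a j := by
  have h1 : k ∈ fl a i j := by rw [h.2.2.2]; simp
  obtain ⟨s, t, hst⟩ := eq_comb (H.hp i j h.1) ((mem_fl a).1 h1)
  have cr_self : ∀ (c : ℝ) (y : E3), cr y (c • y) = 0 := by
    intro c y; ext i; fin_cases i <;> simp [cr] <;> ring
  refine ⟨s, t, ?_, ?_, hst⟩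
  · rintro rfl
    apply H.hp j k h.2.2.1
    rw [hst, zero_smul, zero_add, cr_self]
  · rintro rfl
    apply H.hp i k h.2.1
    rw [hst, zero_smul, add_zero, cr_self]

/-- The linear form of the line of `i` and `j`. -/
theorem T3.form_ne {i j k l : ι} (h : T3 a i j k) (h1 : l ≠ i) (h2 : l ≠ j) (h3 : l ≠ k) :
    dt (cr (a i) (a j)) (a l) ≠ 0 := by
  intro hl
  rw [dt_comm] at hl
  have := (mem_fl a).2 hl
  rw [h.2.2.2] at this
  simp only [Finset.mem_insert, Finset.mem_singleton] at this
  tauto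

theorem T3.form_eq {i j k : ι} (h : T3 a i j k) : dt (cr (a i) (a j)) (a k) = 0 := by
  rw [dt_comm]
  apply (mem_fl a).1
  rw [h.2.2.2]; simp

theorem van_of_line {f : E3 → ℝ} {u v : E3} (h : cr u v ≠ 0)
    (hf : ∀ s t : ℝ, f (s • u + t • v) = 0) (x : E3) :
    f (x - dt (cr u v) x • ((dt (cr u v) (cr u v))⁻¹ • cr u v)) = 0 := by
  have hpos := dt_self_pos h
  obtain ⟨s, t, hst⟩ := eq_comb (x := x - dt (cr u v) x • ((dt (cr u v) (cr u v))⁻¹ • cr u v)) h (by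
    rw [dt_comm, dt_sub, dt_smul, dt_smul, inv_mul_cancel₀ hpos.ne', mul_one, sub_self])
  rw [hst, hf]

/-- The nine points theorem for a grid of simple triple points. -/
theorem chasles (H : Arr a) {f : E3 → ℝ} (hf : f ∈ Cub)
    {p11 p12 p13 p21 p22 p23 p31 p32 p33 : ι}
    (r1 : T3 a p11 p12 p13) (r2 : T3 a p21 p22 p23) (r3 : T3 a p31 p32 p33)
    (c1 : T3 a p11 p21 p31) (c2 : T3 a p12 p22 p32) (c3 : T3 a p13 p23 p33)
    (d1 : p11 ≠ p22) (d2 : p11 ≠ p32) (d3 : p12 ≠ p21) (d4 : p12 ≠ p31) (d5 : p12 ≠ p23)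
    (d6 : p12 ≠ p33) (d7 : p21 ≠ p13) (d8 : p22 ≠ p13) (d9 : p23 ≠ p11)
    (d10 : p31 ≠ p13) (d11 : p32 ≠ p13) (d12 : p31 ≠ p22) (d13 : p31 ≠ p23)
    (d14 : p32 ≠ p21) (d15 : p32 ≠ p23)
    (v11 : f (a p11) = 0) (v12 : f (a p12) = 0) (v13 : f (a p13) = 0)
    (v21 : f (a p21) = 0) (v22 : f (a p22) = 0) (v23 : f (a p23) = 0)
    (v31 : f (a p31) = 0) (v32 : f (a p32) = 0) : f (a p33) = 0 := by
  set C1 := cr (a p11) (a p21) with hC1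
  set C2 := cr (a p12) (a p22) with hC2
  set C3 := cr (a p13) (a p23) with hC3
  obtain ⟨s, u, hs, hu, e13⟩ := r1.comb H
  have z11 : dt C1 (a p11) = 0 := by rw [dt_comm]; exact dt_cr_left _ _
  have z21 : dt C1 (a p21) = 0 := by rw [dt_comm]; exact dt_cr_right _ _
  have z31 : dt C1 (a p31) = 0 := c1.form_eq
  have z12 : dt C2 (a p12) = 0 := by rw [dt_comm]; exact dt_cr_left _ _
  have z22 : dt C2 (a p22) = 0 := by rw [dt_comm]; exact dt_cr_right _ _
  have z32 : dt C2 (a p32) = 0 := c2.form_eq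
  have z13 : dt C3 (a p13) = 0 := by rw [dt_comm]; exact dt_cr_left _ _
  have z23 : dt C3 (a p23) = 0 := by rw [dt_comm]; exact dt_cr_right _ _
  have z33 : dt C3 (a p33) = 0 := c3.form_eq
  have n1 : dt C1 (a p12) ≠ 0 := c1.form_ne r1.1.symm d3 d4
  have n2 : dt C2 (a p11) ≠ 0 := c2.form_ne r1.1 d1 d2
  have n3 : dt C3 (a p12) ≠ 0 := c3.form_ne r1.2.2.1 d5 d6
  -- the auxiliary point
  set y : E3 := s • a p11 + (2 * u) • a p12 with hy
  have y1 : dt C1 y ≠ 0 := by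
    rw [hy, dt_add, dt_smul, dt_smul, z11, mul_zero, zero_add]
    exact mul_ne_zero (mul_ne_zero two_ne_zero hu) n1
  have y2 : dt C2 y ≠ 0 := by
    rw [hy, dt_add, dt_smul, dt_smul, z12, mul_zero, add_zero]
    exact mul_ne_zero hs n2
  have y3 : dt C3 y ≠ 0 := by
    have h1 : dt C3 (s • a p11 + u • a p12) = 0 := by rw [← e13]; exact z13
    rw [dt_add, dt_smul, dt_smul] at h1
    have h2 : dt C3 y = u * dt C3 (a p12) := by
      rw [hy, dt_add, dt_smul, dt_smul]; linarith
    rw [h2]; exact mul_ne_zero hu n3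
  set lam : ℝ := f y / (dt C1 y * dt C2 y * dt C3 y) with hlam
  set g : E3 → ℝ := f - lam • (fun x => dt C1 x * dt C2 x * dt C3 x) with hg
  have hgC : g ∈ Cub := Submodule.sub_mem _ hf (Submodule.smul_mem _ _ (mul_mem_Cub _ _ _))
  have gx : ∀ x, g x = f x - lam * (dt C1 x * dt C2 x * dt C3 x) := fun x => rfl
  have gy : g y = 0 := by
    rw [gx, hlam, div_mul_cancel₀ _ (mul_ne_zero (mul_ne_zero y1 y2) y3), sub_self]
  have g11 : g (a p11) = 0 := by rw [gx, v11, z11]; ring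
  have g12 : g (a p12) = 0 := by rw [gx, v12, z12]; ring
  have g13 : g (a p13) = 0 := by rw [gx, v13, z13]; ring
  have g21 : g (a p21) = 0 := by rw [gx, v21, z21]; ring
  have g22 : g (a p22) = 0 := by rw [gx, v22, z22]; ring
  have g23 : g (a p23) = 0 := by rw [gx, v23, z23]; ring
  have g31 : g (a p31) = 0 := by rw [gx, v31, z31]; ring
  have g32 : g (a p32) = 0 := by rw [gx, v32, z32]; ring
  -- `g` vanishes on the first row
  have row1 : ∀ s t : ℝ, g (s • a p11 + t • a p12) = 0 := by
    obtain ⟨α, β, γ, δ, hl⟩ := line_cub hgC (a p11) (a p12)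
    have h1 := hl 1 0
    have h2 := hl 0 1
    have h3 := hl s u
    have h4 := hl s (2 * u)
    rw [← hy, gy] at h4
    rw [← e13, g13] at h3
    simp only [one_smul, zero_smul, add_zero, zero_add, g11, g12] at h1 h2
    have hα : α = 0 := by linarith
    have hδ : δ = 0 := by linarith
    subst hα hδ
    have h5 : s * u * (β * s + γ * u) = 0 := by linear_combination -h3
    have h6 : s * u * (β * s + 2 * γ * u) = 0 := by linear_combination -h4 / 2
    have hsu := mul_ne_zero hs hu
    have h7 := (mul_eq_zero.1 h5).resolve_left hsu
    have h8 := (mul_eq_zero.1 h6).resolve_left hsu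
    have hγ : γ = 0 := by
      have : γ * u = 0 := by linarith
      exact (mul_eq_zero.1 this).resolve_right hu
    have hβ : β = 0 := by
      have : β * s = 0 := by rw [hγ] at h7; linarith
      exact (mul_eq_zero.1 this).resolve_right hs
    intro s t
    rw [hl, hγ, hβ]; ring
  obtain ⟨q, hq, hgq⟩ := fac_cub hgC (cr (a p11) (a p12))
    ((dt (cr (a p11) (a p12)) (cr (a p11) (a p12)))⁻¹ • cr (a p11) (a p12))
  have hgq' : ∀ x, g x = dt (cr (a p11) (a p12)) x * q x := by
    intro x
    rw [hgq, van_of_line (H.hp _ _ r1.1) row1, zero_add]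
  have q0 : ∀ l, l ≠ p11 → l ≠ p12 → l ≠ p13 → g (a l) = 0 → q (a l) = 0 := by
    intro l h1 h2 h3 h4
    rw [hgq'] at h4
    exact (mul_eq_zero.1 h4).resolve_left (r1.form_ne h1 h2 h3)
  have q21 := q0 p21 c1.1.symm d3.symm d7 g21
  have q22 := q0 p22 d1.symm c2.1.symm d8 g22
  have q23 := q0 p23 d9 d5.symm c3.1.symm g23
  have q31 := q0 p31 c1.2.1.symm d4.symm d10 g31
  have q32 := q0 p32 d2.symm c2.2.1.symm d11 g32
  have row2 : ∀ s t : ℝ, q (s • a p21 + t • a p22) = 0 := by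
    obtain ⟨s, t, hs, ht, e23⟩ := r2.comb H
    obtain ⟨α, β, γ, hl⟩ := line_quad hq (a p21) (a p22)
    have h1 := hl 1 0
    have h2 := hl 0 1
    have h3 := hl s t
    rw [← e23, q23] at h3
    simp only [one_smul, zero_smul, add_zero, zero_add, q21, q22] at h1 h2
    have hα : α = 0 := by linarith
    have hγ : γ = 0 := by linarith
    subst hα hγ
    have h5 : β * (s * t) = 0 := by linear_combination -h3
    have hβ := (mul_eq_zero.1 h5).resolve_right (mul_ne_zero hs ht)
    intro s t
    rw [hl, hβ]; ring
  obtain ⟨l, hl⟩ := fac_quad hq (cr (a p21) (a p22))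
    ((dt (cr (a p21) (a p22)) (cr (a p21) (a p22)))⁻¹ • cr (a p21) (a p22))
  have hl' : ∀ x, q x = dt (cr (a p21) (a p22)) x * dt l x := by
    intro x
    rw [hl, van_of_line (H.hp _ _ r2.1) row2, zero_add]
  have l31 : dt l (a p31) = 0 := by
    rw [hl'] at q31
    exact (mul_eq_zero.1 q31).resolve_left (r2.form_ne c1.2.2.1.symm d12 d13)
  have l32 : dt l (a p32) = 0 := by
    rw [hl'] at q32
    exact (mul_eq_zero.1 q32).resolve_left (r2.form_ne d14 c2.2.2.1.symm d15)
  obtain ⟨s', t', -, -, e33⟩ := r3.comb H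
  have l33 : dt l (a p33) = 0 := by
    rw [e33, dt_add, dt_smul, dt_smul, l31, l32]; ring
  have h1 : g (a p33) = 0 := by rw [hgq', hl', l33]; ring
  rw [gx, z33] at h1
  linarith

end chasles

end Cheap

set_option linter.unusedSectionVars false
set_option linter.unusedVariables false
namespace Cheap

section cubic

/-- The cubic form with given coefficients. -/
def ev (c : Fin 10 → ℝ) (x : E3) : ℝ :=
  c 0 * x 0 ^ 3 + c 1 * (x 0 ^ 2 * x 1) + c 2 * (x 0 ^ 2 * x 2) + c 3 * (x 0 * x 1 ^ 2) +
    c 4 * (x 0 * x 1 * x 2) + c 5 * (x 0 * x 2 ^ 2) + c 6 * x 1 ^ 3 + c 7 * (x 1 ^ 2 * x 2) +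
    c 8 * (x 1 * x 2 ^ 2) + c 9 * x 2 ^ 3

theorem ev_mem_Cub (c : Fin 10 → ℝ) : ev c ∈ Cub := by
  have hX : ∀ x : E3, dt ![1, 0, 0] x = x 0 := fun x => by simp [dt]
  have hY : ∀ x : E3, dt ![0, 1, 0] x = x 1 := fun x => by simp [dt]
  have hZ : ∀ x : E3, dt ![0, 0, 1] x = x 2 := fun x => by simp [dt]
  have M := fun (k : ℝ) (u v w : E3) => Submodule.smul_mem Cub k (mul_mem_Cub u v w)
  have h := Submodule.add_mem _ (Submodule.add_mem _ (Submodule.add_mem _ (Submodule.add_mem _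
    (Submodule.add_mem _ (Submodule.add_mem _ (Submodule.add_mem _ (Submodule.add_mem _
    (Submodule.add_mem _
    (M (c 0) ![1, 0, 0] ![1, 0, 0] ![1, 0, 0]) (M (c 1) ![1, 0, 0] ![1, 0, 0] ![0, 1, 0]))
    (M (c 2) ![1, 0, 0] ![1, 0, 0] ![0, 0, 1])) (M (c 3) ![1, 0, 0] ![0, 1, 0] ![0, 1, 0]))
    (M (c 4) ![1, 0, 0] ![0, 1, 0] ![0, 0, 1])) (M (c 5) ![1, 0, 0] ![0, 0, 1] ![0, 0, 1]))
    (M (c 6) ![0, 1, 0] ![0, 1, 0] ![0, 1, 0])) (M (c 7) ![0, 1, 0] ![0, 1, 0] ![0, 0, 1]))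
    (M (c 8) ![0, 1, 0] ![0, 0, 1] ![0, 0, 1])) (M (c 9) ![0, 0, 1] ![0, 0, 1] ![0, 0, 1])
  convert h using 1
  funext x
  simp only [Pi.add_apply, Pi.smul_apply, smul_eq_mul, hX, hY, hZ, ev]
  ring

theorem exists_cubic (v : Fin 9 → E3) : ∃ c : Fin 10 → ℝ, c ≠ 0 ∧ ∀ i, ev c (v i) = 0 := by
  let φ : (Fin 10 → ℝ) →ₗ[ℝ] (Fin 9 → ℝ) :=
    { toFun := fun c i => ev c (v i)
      map_add' := by intro x y; funext i; simp [ev]; ring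
      map_smul' := by intro x y; funext i; simp [ev]; ring }
  have h : LinearMap.ker φ ≠ ⊥ := LinearMap.ker_ne_bot_of_finrank_lt (by simp)
  obtain ⟨c, hc, hc0⟩ := (Submodule.ne_bot_iff _).1 h
  exact ⟨c, hc0, fun i => congrFun (LinearMap.mem_ker.1 hc) i⟩

theorem exists_cubic_line (n : E3) (hn : n ≠ 0) :
    ∃ c : Fin 10 → ℝ, c ≠ 0 ∧ ∀ x, ev c x = dt n x ^ 3 := by
  refine ⟨![n 0 ^ 3, 3 * n 0 ^ 2 * n 1, 3 * n 0 ^ 2 * n 2, 3 * n 0 * n 1 ^ 2,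
    6 * n 0 * n 1 * n 2, 3 * n 0 * n 2 ^ 2, n 1 ^ 3, 3 * n 1 ^ 2 * n 2, 3 * n 1 * n 2 ^ 2,
    n 2 ^ 3], ?_, ?_⟩
  · intro h
    apply hn
    have h0 := congrFun h 0
    have h6 := congrFun h 6
    have h9 := congrFun h 9
    simp at h0 h6 h9
    ext i; fin_cases i <;> simp [h0, h6, h9]
  · intro x
    simp [ev, dt]
    ring

end cubic

section run

variable {ι : Type*} [Fintype ι] [DecidableEq ι] {a : ι → E3}

theorem config2 (H : Arr a) {f : E3 → ℝ} (hf : f ∈ Cub) {A0 A1 A2 B0 B1 B2 l c e : ι}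
    (t1 : T3 a l A0 B0) (t2 : T3 a l A1 B1) (t3 : T3 a l A2 B2) (t4 : T3 a c A0 B1)
    (t5 : T3 a c A1 B2) (t6 : T3 a e B0 A1) (t7 : T3 a e B1 A2)
    (n1 : A0 ≠ A1) (n2 : A0 ≠ B2) (n3 : B0 ≠ B2) (n4 : B1 ≠ B2) (n5 : B0 ≠ B1)
    (v1 : f (a A0) = 0) (v2 : f (a A1) = 0) (v3 : f (a B0) = 0) (v4 : f (a B1) = 0)
    (v5 : f (a B2) = 0) (v6 : f (a l) = 0) (v7 : f (a c) = 0) (v8 : f (a e) = 0) :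
    f (a A2) = 0 := by
  have hcA2 : c ≠ A2 := by
    rintro rfl
    exact t2.1 ((t3.rot H).unique (t5.swap' H))
  have hcB0 : c ≠ B0 := by
    rintro rfl
    exact t2.2.1 ((((t1.rot H).swap H)).unique t4)
  have heA0 : e ≠ A0 := by
    rintro rfl
    exact t2.1 ((t1.rot H).unique t6)
  have heB2 : e ≠ B2 := by
    rintro rfl
    exact t2.2.1 (((t3.rot H).swap H).unique (t7.swap' H))
  have hcl : c ≠ l := by
    rintro rfl
    exact n4 (t2.unique t5)
  have hel : e ≠ l := by
    rintro rfl
    exact n5 ((t6.swap' H).unique t2)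
  have hce : c ≠ e := by
    rintro rfl
    exact n3 ((t6.swap' H).unique t5)
  exact chasles H hf (p11 := A1) (p12 := c) (p13 := B2) (p21 := B0) (p22 := A0) (p23 := l)
    (p31 := e) (p32 := B1) (p33 := A2)
    (t5.swap H) ((t1.rot H).swap H) t7 ((t6.rot H).swap H) t4 ((t3.rot H).rot H)
    n1.symm t2.2.2.1 hcB0 hce hcl hcA2 n3 n2 t2.1 heB2 n4 heA0 hel n5.symm t2.2.1.symm
    v2 v7 v5 v3 v1 v6 v8 v4

theorem config1 (H : Arr a) {f : E3 → ℝ} (hf : f ∈ Cub) {A0 A1 A2 B1 B2 B3 l c d : ι}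
    (t0 : A0 ≠ l) (t1 : T3 a l A1 B1) (t2 : T3 a l A2 B2) (t3 : T3 a c A0 B1) (t4 : T3 a c A1 B2)
    (t5 : T3 a c A2 B3) (t6 : T3 a d A0 B2) (t7 : T3 a d A1 B3)
    (n1 : A0 ≠ A1) (n2 : A0 ≠ A2) (n3 : A0 ≠ B3) (n4 : A1 ≠ A2) (n5 : B1 ≠ B2) (n6 : A2 ≠ B1)
    (n7 : B2 ≠ B3) (n8 : l ≠ B3) (n9 : B1 ≠ B3)
    (v1 : f (a A0) = 0) (v2 : f (a A1) = 0) (v3 : f (a A2) = 0) (v4 : f (a B1) = 0)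
    (v5 : f (a B2) = 0) (v6 : f (a l) = 0) (v7 : f (a c) = 0) (v8 : f (a d) = 0) :
    f (a B3) = 0 := by
  have hdA2 : d ≠ A2 := by
    rintro rfl
    exact t0 ((t2.rot H).unique (t6.swap' H)).symm
  have hdB1 : d ≠ B1 := by
    rintro rfl
    exact n8 (((t1.rot H).swap H).unique t7)
  have hcl : c ≠ l := by
    rintro rfl
    exact n5 (t1.unique t4)
  have hdl : d ≠ l := by
    rintro rfl
    exact n9 (t1.unique t7)
  have hcd : c ≠ d := by
    rintro rfl
    exact n7 (t4.unique t7)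
  exact chasles H hf (p11 := B1) (p12 := A0) (p13 := c) (p21 := l) (p22 := B2) (p23 := A2)
    (p31 := A1) (p32 := d) (p33 := B3)
    ((t3.rot H).swap H) (t2.swap' H) (t7.swap H) ((t1.rot H).rot H) ((t6.rot H)) t5
    n5 hdB1.symm t0 n1 n2 n3 hcl.symm t4.2.1.symm n6 t4.1.symm hcd.symm t4.2.2.1 n4 hdl hdA2
    v4 v1 v7 v6 v5 v3 v2 v8

/-- A strip of triple points lies on a cubic. -/
theorem strip_cubic (H : Arr a) (m : ℕ) (hm : 1 ≤ m) (A B : ℕ → ι) (l c d e : ι)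
    (hL : ∀ n, n ≤ m → T3 a l (A n) (B n)) (hC : ∀ n, n + 1 ≤ m → T3 a c (A n) (B (n + 1)))
    (hD : ∀ n, n + 2 ≤ m → T3 a d (A n) (B (n + 2)))
    (hE : ∀ n, n + 1 ≤ m → T3 a e (B n) (A (n + 1)))
    (hne : ∀ n n', n ≤ m → n' ≤ m → n ≠ n' → A n ≠ A n' ∧ A n ≠ B n' ∧ B n ≠ B n') :
    ∃ q : Fin 10 → ℝ, q ≠ 0 ∧ ev q (a l) = 0 ∧
      ∀ n, n ≤ m → ev q (a (A n)) = 0 ∧ ev q (a (B n)) = 0 := by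
  obtain ⟨q, hq0, hq⟩ := exists_cubic ![a e, a l, a c, a d, a (A 0), a (A 1), a (B 0), a (B 1), a (B 2)]
  have ve : ev q (a e) = 0 := hq 0
  have vl : ev q (a l) = 0 := hq 1
  have vc : ev q (a c) = 0 := hq 2
  have vd : ev q (a d) = 0 := hq 3
  have vA0 : ev q (a (A 0)) = 0 := hq 4
  have vA1 : ev q (a (A 1)) = 0 := hq 5
  have vB0 : ev q (a (B 0)) = 0 := hq 6
  have vB1 : ev q (a (B 1)) = 0 := hq 7
  have vB2 : ev q (a (B 2)) = 0 := hq 8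
  have hf := ev_mem_Cub q
  refine ⟨q, hq0, vl, ?_⟩
  suffices h : ∀ k, k + 1 ≤ m → ∀ n, n ≤ k + 1 → ev q (a (A n)) = 0 ∧ ev q (a (B n)) = 0 by
    obtain ⟨k, rfl⟩ : ∃ k, m = k + 1 := ⟨m - 1, by omega⟩
    exact h k le_rfl
  intro k
  induction k with
  | zero =>
    intro _ n hn
    interval_cases n
    · exact ⟨vA0, vB0⟩
    · exact ⟨vA1, vB1⟩
  | succ k ih =>
    intro hk n hn
    have ih' := ih (by omega)
    rcases Nat.lt_or_ge n (k + 2) with h | h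
    · exact ih' n (by omega)
    obtain rfl : n = k + 2 := by omega
    have hB : ev q (a (B (k + 2))) = 0 := by
      rcases k with _ | k
      · exact vB2
      · exact config1 H hf (A0 := A k) (A1 := A (k + 1)) (A2 := A (k + 2)) (B1 := B (k + 1))
          (B2 := B (k + 2)) (B3 := B (k + 3)) (l := l) (c := c) (d := d)
          (hL k (by omega)).1.symm (hL _ (by omega)) (hL _ (by omega)) (hC _ (by omega))
          (hC _ (by omega)) (hC _ (by omega)) (hD _ (by omega)) (hD _ (by omega))
          (hne _ _ (by omega) (by omega) (by omega)).1 (hne _ _ (by omega) (by omega) (by omega)).1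
          (hne _ _ (by omega) (by omega) (by omega)).2.1 (hne _ _ (by omega) (by omega) (by omega)).1
          (hne _ _ (by omega) (by omega) (by omega)).2.2 (hne _ _ (by omega) (by omega) (by omega)).2.1
          (hne _ _ (by omega) (by omega) (by omega)).2.2 (hL _ (by omega)).2.1
          (hne _ _ (by omega) (by omega) (by omega)).2.2
          (ih' _ (by omega)).1 (ih' _ (by omega)).1 (ih' _ (by omega)).1 (ih' _ (by omega)).2
          (ih' _ (by omega)).2 vl vc vd
    refine ⟨?_, hB⟩
    exact config2 H hf (A0 := A k) (A1 := A (k + 1)) (A2 := A (k + 2)) (B0 := B k)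
      (B1 := B (k + 1)) (B2 := B (k + 2)) (l := l) (c := c) (e := e)
      (hL _ (by omega)) (hL _ (by omega)) (hL _ (by omega)) (hC _ (by omega))
      (hC _ (by omega)) (hE _ (by omega)) (hE _ (by omega))
      (hne _ _ (by omega) (by omega) (by omega)).1 (hne _ _ (by omega) (by omega) (by omega)).2.1
      (hne _ _ (by omega) (by omega) (by omega)).2.2 (hne _ _ (by omega) (by omega) (by omega)).2.2
      (hne _ _ (by omega) (by omega) (by omega)).2.2
      (ih' _ (by omega)).1 (ih' _ (by omega)).1 (ih' _ (by omega)).2 (ih' _ (by omega)).2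
      hB vl vc ve

end run

end Cheap

set_option linter.unusedSectionVars false
set_option linter.unusedVariables false
namespace Cheap

section runs

variable {ι : Type*} [Fintype ι] [DecidableEq ι] {a : ι → E3}

/-- The local picture around a regular labelled triangle. -/
structure Ed (a : ι → E3) (A : Finset ι) (l x y b0 x' c b e d : ι) : Prop where
  t1 : T3 a l x b0
  t2 : T3 a l y x'
  t3 : T3 a x y c
  t4 : T3 a b0 x' e
  t5 : T3 a x' c b
  t6 : T3 a x b d
  g0 : Good a A l x y
  g1 : Good a (symmDiff A {l}) l b0 x'
  g2 : Good a (symmDiff A {y}) y x' c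
  g3 : Good a (symmDiff (symmDiff A {l}) {x'}) x' y e
  g4 : Good a (symmDiff (symmDiff A {y}) {c}) c x b
  g5 : Good a (symmDiff (symmDiff (symmDiff A {y}) {c}) {b}) b x' d

theorem RG.ed (H : Arr a) {A : Finset ι} {l x y : ι} (h : RG a (A, l, x, y)) :
    ∃ b0 x' c b e d, Ed a A l x y b0 x' c b e d := by
  obtain ⟨g0, g1, g2, g3, g4, g5⟩ := h
  simp only [GoodS, Fm, Gm, rt] at g0 g1 g2 g3 g4 g5
  have t1 := g0.2.2.1
  have t2 := g0.2.2.2.1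
  have t3 := g0.2.2.2.2
  generalize hb0 : third a l x = b0 at *
  generalize hx' : third a l y = x' at *
  generalize hc : third a x y = c at *
  rw [third_comm H t2, third_comm H t3] at g2 g4 g5
  rw [third_eq ((t2.swap' H).swap H)] at g3
  rw [third_eq ((t3.rot H).swap H)] at g4 g5
  have t4 := g1.2.2.2.2
  have t5 := g2.2.2.2.2
  generalize he : third a b0 x' = e at *
  generalize hb : third a x' c = b at *
  rw [third_comm H t4] at g3
  rw [third_comm H t5] at g4 g5
  rw [third_eq ((t5.rot H).swap H)] at g5
  have t6 := g4.2.2.2.2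
  generalize hd : third a x b = d at *
  rw [third_comm H t6] at g5
  exact ⟨b0, x', c, b, e, d, t1, t2, t3, t4, t5, t6, g0, g1, g2, g3, g4, g5⟩

theorem Good.walls_card {A : Finset ι} {i j k : ι} (h : Good a A i j k) :
    (walls a A).card = 3 := by
  rw [h.2.1, Finset.card_eq_three]
  exact ⟨i, j, k, h.2.2.1.1, h.2.2.2.1.1, h.2.2.2.2.1, rfl⟩

theorem third_of_triple {p q r s : ι} {p' q' : ι} (hp : p = p') (hq : q = q') (h1 : p ≠ r)
    (h2 : q ≠ r) (h : ({p, q, r} : Finset ι) = {p', q', s}) : r = s := by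
  subst hp hq
  have : r ∈ ({p, q, s} : Finset ι) := by rw [← h]; simp
  simp only [Finset.mem_insert, Finset.mem_singleton] at this
  rcases this with h | h | h
  · exact absurd h.symm h1
  · exact absurd h.symm h2
  · exact h

theorem symmDiff_rev (A X Y Z : Finset ι) : symmDiff (symmDiff (symmDiff A X) Y) Z =
    symmDiff (symmDiff (symmDiff A Z) Y) X := by
  rw [symmDiff_right_comm (symmDiff A X) Y Z, symmDiff_right_comm A X Z,
    symmDiff_right_comm (symmDiff A Z) X Y]

theorem Ed.step (H : Arr a) {A A' : Finset ι} {l x y b0 x' c b e d y2 b02 x2' c2 b2 e2 d2 : ι}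
    (h : Ed a A l x y b0 x' c b e d) (hA : A' = symmDiff (symmDiff A {y}) {x'})
    (h2 : Ed a A' l x' y2 b02 x2' c2 b2 e2 d2) :
    y2 = b ∧ c2 = c ∧ b02 = y ∧ e2 = e ∧ d2 = d := by
  subst hA
  have hb02 : b02 = y := h2.t1.unique (h.t2.swap' H)
  subst hb02
  have f1 := ((h.g2.rot H).rot H).flip_walls H h2.g0.walls_card
  rw [third_eq h.t5, third_eq ((h.t2.rot H).swap H), h2.g0.2.1] at f1
  have hy2 : y2 = b := by
    have e1 : ({l, x', y2} : Finset ι) = {l, x', b} := by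
      rw [f1]; ext z; simp only [Finset.mem_insert, Finset.mem_singleton]; tauto
    exact third_of_triple rfl rfl h2.g0.2.2.2.1.1 h2.g0.2.2.2.2.1 e1
  subst hy2
  have hc2 : c2 = c := h2.t3.unique (h.t5.swap' H)
  subst hc2
  have hA1 : symmDiff (symmDiff (symmDiff A {b02}) {x'}) {l} =
      symmDiff (symmDiff (symmDiff A {l}) {x'}) {b02} := symmDiff_rev _ _ _ _
  have g1 := h2.g1
  rw [hA1] at g1
  have gg := (h.g3.swap H).rot H
  have f2 := gg.flip_walls H g1.walls_card
  rw [g1.2.1, third_eq (h.t2.rot H)] at f2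
  have tt : T3 a b02 e (third a b02 e) := gg.2.2.2.1
  have hx2 : x2' = third a b02 e := by
    have e1 : ({l, b02, x2'} : Finset ι) = {l, b02, third a b02 e} := by
      rw [f2]; ext z; simp only [Finset.mem_insert, Finset.mem_singleton]; tauto
    exact third_of_triple rfl rfl g1.2.2.2.1.1 g1.2.2.2.2.1 e1
  rw [← hx2] at tt
  have he2 : e2 = e := h2.t4.unique (tt.swap' H)
  have hA2 : symmDiff (symmDiff (symmDiff (symmDiff A {b02}) {x'}) {y2}) {c2} =
      symmDiff (symmDiff (symmDiff (symmDiff A {b02}) {c2}) {y2}) {x'} := symmDiff_rev _ _ _ _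
  have g4 := h2.g4
  rw [hA2] at g4
  have gg5 := (h.g5.swap H).rot H
  have f3 := gg5.flip_walls H g4.walls_card
  rw [g4.2.1, third_eq (h.t5.swap' H)] at f3
  have tt5 : T3 a x' d (third a x' d) := gg5.2.2.2.1
  have hb2 : b2 = third a x' d := by
    have e1 : ({c2, x', b2} : Finset ι) = {c2, x', third a x' d} := by
      rw [f3]; ext z; simp only [Finset.mem_insert, Finset.mem_singleton]; tauto
    exact third_of_triple rfl rfl g4.2.2.2.1.1 g4.2.2.2.2.1 e1
  rw [← hb2] at tt5
  exact ⟨rfl, rfl, rfl, he2, h2.t6.unique (tt5.swap' H)⟩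

theorem run_cubic (H : Arr a) (m : ℕ) (hm : 1 ≤ m) (l : ι) (T : ℕ → Finset ι) (A B : ℕ → ι)
    (hRG : ∀ n, n < m → RG a (T n, l, A n, B (n + 1)))
    (hL : ∀ n ≤ m, T3 a l (A n) (B n))
    (hT : ∀ n, n + 1 < m → T (n + 1) = symmDiff (symmDiff (T n) {B (n + 1)}) {A (n + 1)})
    (hne : ∀ n n', n ≤ m → n' ≤ m → n ≠ n' → A n ≠ A n' ∧ A n ≠ B n' ∧ B n ≠ B n') :
    ∃ q : Fin 10 → ℝ, q ≠ 0 ∧ ev q (a l) = 0 ∧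
      ∀ n ≤ m, ev q (a (A n)) = 0 ∧ ev q (a (B n)) = 0 := by
  have h1 : ∀ n, ∃ c b e d, n < m →
      Ed a (T n) l (A n) (B (n + 1)) (B n) (A (n + 1)) c b e d := by
    intro n
    by_cases hn : n < m
    · obtain ⟨b0, x', c, b, e, d, h⟩ := (hRG n hn).ed H
      have e1 : b0 = B n := h.t1.unique (hL n hn.le)
      have e2 : x' = A (n + 1) := h.t2.unique ((hL (n + 1) hn).swap' H)
      subst e1 e2
      exact ⟨c, b, e, d, fun _ => h⟩
    · exact ⟨l, l, l, l, fun h => absurd h hn⟩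
  choose c b e d h using h1
  have hs : ∀ n, n + 1 < m → B (n + 2) = b n ∧ c (n + 1) = c n ∧ e (n + 1) = e n ∧
      d (n + 1) = d n := by
    intro n hn
    obtain ⟨r1, r2, _, r3, r4⟩ := (h n (by omega)).step H (hT n hn) (h (n + 1) hn)
    exact ⟨r1, r2, r3, r4⟩
  have hc : ∀ n, n < m → c n = c 0 ∧ e n = e 0 ∧ d n = d 0 := by
    intro n
    induction n with
    | zero => intro _; exact ⟨rfl, rfl, rfl⟩
    | succ k ih =>
      intro hk
      obtain ⟨i1, i2, i3⟩ := ih (by omega)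
      obtain ⟨_, s1, s2, s3⟩ := hs k hk
      exact ⟨s1.trans i1, s2.trans i2, s3.trans i3⟩
  refine strip_cubic H m hm A B l (c 0) (d 0) (e 0) hL ?_ ?_ ?_ hne
  · intro n hn
    have := (h n hn).t3
    rw [(hc n hn).1] at this
    exact (this.rot H).rot H
  · intro n hn
    have := (h n (by omega)).t6
    rw [(hc n (by omega)).2.2, ← (hs n hn).1] at this
    exact (this.rot H).rot H
  · intro n hn
    have := (h n hn).t4
    rw [(hc n hn).2.1] at this
    exact (this.rot H).rot H

end runs
end Cheap

set_option linter.unusedSectionVars false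
set_option linter.unusedVariables false
namespace Cheap

theorem dt_cr_sq (x y : E3) : dt (cr x y) (cr x y) = dt x x * dt y y - dt x y ^ 2 := by
  simp [dt, cr]; ring

theorem dt_cr_cyc (x y z : E3) : dt x (cr y z) = dt (cr x y) z := by
  simp [dt, cr]; ring

section edges

variable {ι : Type*} [Fintype ι] [DecidableEq ι] {a : ι → E3}

/-- Combinatorial ranks of the values of a real function away from `l`. -/
theorem exists_rank (l : ι) (τ : ι → ℝ) : ∃ (k : ℕ) (idx : ι → ℕ),
    (∀ j, j ≠ l → idx j < k) ∧ (∀ i, i < k → ∃ j, j ≠ l ∧ idx j = i) ∧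
    (∀ j m, j ≠ l → m ≠ l → (idx j < idx m ↔ τ j < τ m)) := by
  classical
  let Θ : Finset ℝ := (Finset.univ.erase l).image τ
  let r : ℝ → ℕ := fun x => (Θ.filter (· < x)).card
  have hmem : ∀ j, j ≠ l → τ j ∈ Θ := fun j hj =>
    Finset.mem_image_of_mem _ (Finset.mem_erase.2 ⟨hj, Finset.mem_univ _⟩)
  have hlt : ∀ x ∈ Θ, ∀ y, x < y → r x < r y := by
    intro x hx y hxy
    refine Finset.card_lt_card ⟨?_, ?_⟩
    · intro z hz
      rw [Finset.mem_filter] at hz ⊢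
      exact ⟨hz.1, hz.2.trans hxy⟩
    · intro hc
      have := hc (Finset.mem_filter.2 ⟨hx, hxy⟩)
      rw [Finset.mem_filter] at this
      exact lt_irrefl _ this.2
  have hk : ∀ x ∈ Θ, r x < Θ.card := by
    intro x hx
    refine Finset.card_lt_card ⟨Finset.filter_subset _ _, ?_⟩
    intro hc
    have := hc hx
    rw [Finset.mem_filter] at this
    exact lt_irrefl _ this.2
  have hinj : Set.InjOn r Θ := by
    intro x hx y hy hxy
    by_contra hne
    rcases lt_or_gt_of_ne hne with h | h
    · exact absurd hxy (hlt x hx y h).ne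
    · exact absurd hxy (hlt y hy x h).ne'
  have himg : Θ.image r = Finset.range Θ.card := by
    refine Finset.eq_of_subset_of_card_le ?_ ?_
    · intro n hn
      obtain ⟨x, hx, rfl⟩ := Finset.mem_image.1 hn
      exact Finset.mem_range.2 (hk x hx)
    · rw [Finset.card_range, Finset.card_image_of_injOn hinj]
  refine ⟨Θ.card, fun j => r (τ j), fun j hj => hk _ (hmem j hj), ?_, ?_⟩
  · intro i hi
    have : i ∈ Θ.image r := by rw [himg]; exact Finset.mem_range.2 hi
    obtain ⟨x, hx, hxi⟩ := Finset.mem_image.1 this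
    obtain ⟨j, hj, rfl⟩ := Finset.mem_image.1 hx
    exact ⟨j, (Finset.mem_erase.1 hj).1, hxi⟩
  · intro j m hj hm
    refine ⟨fun h => ?_, fun h => hlt _ (hmem j hj) _ h⟩
    by_contra hc
    rcases (not_lt.1 hc).lt_or_eq with h' | h'
    · exact absurd h (hlt _ (hmem m hm) _ h').le.not_gt
    · simp only [h'] at h; exact lt_irrefl _ h

/-- The combinatorial description of the line `l` in the arrangement. -/
structure Chart (a : ι → E3) (l : ι) (k : ℕ) (idx : ι → ℕ) (T : ℕ → Finset ι) : Prop where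
  lt : ∀ j, j ≠ l → idx j < k
  surj : ∀ i, i < k → ∃ j, j ≠ l ∧ idx j = i
  flat : ∀ j m, j ≠ l → m ≠ l → (m ∈ fl a l j ↔ idx m = idx j)
  step : ∀ i m, m ∈ symmDiff (T i) (T (i + 1)) ↔ m ≠ l ∧ idx m = i + 1
  inj : ∀ i j, i < j → j < k → T i ≠ T j
  tope : ∀ i, i + 1 < k → T i ∈ topes a
  wall : ∀ i, i + 1 < k → l ∈ walls a (T i)
  corner : ∀ i j, i + 1 < k → j ≠ l → (idx j = i ∨ idx j = i + 1) → IsCorner a (T i) (fl a l j)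

theorem exists_chart (H : Arr a) (l : ι) : ∃ k idx T, Chart a l k idx T := by
  classical
  obtain ⟨d, hd⟩ := exists_generic (fun j => if j = l then a l else cr (a j) (a l)) (by
    intro j
    by_cases hj : j = l
    · simp only [hj, if_true]; exact H.h0 l
    · simp only [hj, if_false]; exact H.hp j l hj)
  set q := cr (a l) d with hq
  have hjq : ∀ j, j ≠ l → dt (a j) q ≠ 0 := by
    intro j hj
    have := hd j
    simp only [hj, if_false] at this
    rw [hq, dt_cr_cyc]; exact this
  have hlq : dt (a l) q = 0 := dt_cr_left _ _
  obtain ⟨j0, hj0⟩ : ∃ j, j ≠ l := by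
    have : 1 < Fintype.card ι := H.hc
    obtain ⟨j, hj⟩ := Fintype.exists_ne_of_one_lt_card this l
    exact ⟨j, hj⟩
  have hq0 : q ≠ 0 := by
    intro h
    have := hjq j0 hj0
    rw [h, dt_zero] at this
    exact this rfl
  set p := cr (a l) q with hp
  have hpp : 0 < dt p p := by
    rw [hp, dt_cr_sq, hlq]
    have := mul_pos (dt_self_pos (H.h0 l)) (dt_self_pos hq0)
    simpa using this
  have hpq : dt p q = 0 := by rw [dt_comm]; exact dt_cr_right _ _
  have hlp : dt (a l) p = 0 := dt_cr_left _ _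
  let X : ℝ → E3 := fun t => p + t • q
  have hX0 : ∀ t, X t ≠ 0 := by
    intro t h
    have h1 : dt p (X t) = dt p p := by
      simp only [X]; rw [dt_add, dt_smul, hpq]; ring
    rw [h, dt_zero] at h1
    exact hpp.ne h1
  have hXl : ∀ t, dt (a l) (X t) = 0 := by
    intro t
    simp only [X]; rw [dt_add, dt_smul, hlp, hlq]; ring
  let τ : ι → ℝ := fun j => - dt (a j) p / dt (a j) q
  have hX : ∀ j, j ≠ l → ∀ t, dt (a j) (X t) = dt (a j) q * (t - τ j) := by
    intro j hj t
    have := hjq j hj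
    simp only [X, τ]; rw [dt_add, dt_smul]
    field_simp
    ring
  obtain ⟨k, idx, i1, i2, i3⟩ := exists_rank l τ
  let T : ℕ → Finset ι := fun i => Finset.univ.filter (fun m => m = l ∨ (idx m ≤ i ↔ 0 < dt (a m) q))
  have hT : ∀ i m, m ∈ T i ↔ m = l ∨ (idx m ≤ i ↔ 0 < dt (a m) q) := by
    intro i m; simp [T]
  have hsgn : ∀ i m t, m ≠ l → (idx m ≤ i ↔ τ m < t) → τ m ≠ t → 0 < eps (T i) m * dt (a m) (X t) := by
    intro i m t hm h1 h2
    rw [hX m hm]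
    have h3 := hjq m hm
    by_cases h4 : idx m ≤ i
    · have h5 := h1.1 h4
      by_cases h6 : 0 < dt (a m) q
      · have : m ∈ T i := by rw [hT]; tauto
        simp only [eps, this, if_true]
        nlinarith [mul_pos h6 (sub_pos.2 h5)]
      · have : m ∉ T i := by rw [hT]; tauto
        simp only [eps, this, if_false]
        have h7 : dt (a m) q < 0 := lt_of_le_of_ne (not_lt.1 h6) h3
        nlinarith [mul_pos (neg_pos.2 h7) (sub_pos.2 h5)]
    · have h5 : t < τ m := lt_of_le_of_ne (not_lt.1 (fun h => h4 (h1.2 h))) h2.symm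
      by_cases h6 : 0 < dt (a m) q
      · have : m ∉ T i := by rw [hT]; tauto
        simp only [eps, this, if_false]
        nlinarith [mul_pos h6 (sub_pos.2 h5)]
      · have : m ∈ T i := by rw [hT]; tauto
        simp only [eps, this, if_true]
        have h7 : dt (a m) q < 0 := lt_of_le_of_ne (not_lt.1 h6) h3
        nlinarith [mul_pos (neg_pos.2 h7) (sub_pos.2 h5)]
  have heq : ∀ j m, j ≠ l → m ≠ l → (idx j = idx m ↔ τ j = τ m) := by
    intro j m hj hm
    have h1 := i3 j m hj hm
    have h2 := i3 m j hm hj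
    constructor
    · intro h
      have h3 : ¬ τ j < τ m := fun h' => by have := h1.2 h'; omega
      have h4 : ¬ τ m < τ j := fun h' => by have := h2.2 h'; omega
      exact le_antisymm (not_lt.1 h4) (not_lt.1 h3)
    · intro h
      have h3 : ¬ idx j < idx m := fun h' => by have := h1.1 h'; exact this.ne h
      have h4 : ¬ idx m < idx j := fun h' => by have := h2.1 h'; exact this.ne h.symm
      omega
  have hflat : ∀ j m, j ≠ l → m ≠ l → (m ∈ fl a l j ↔ τ m = τ j) := by
    intro j m hj hm
    rw [mem_fl_of a H.hp hj.symm (hX0 (τ j)) (hXl _) (by rw [hX j hj]; ring), hX m hm]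
    rw [mul_eq_zero, sub_eq_zero]
    constructor
    · rintro (h | h)
      · exact absurd h (hjq m hm)
      · exact h.symm
    · intro h; exact Or.inr h.symm
  have hmid : ∀ i, i + 1 < k → ∃ z, ∀ m, m ≠ l → 0 < eps (T i) m * dt (a m) (X z) := by
    intro i hi
    obtain ⟨j1, hj1, e1⟩ := i2 i (by omega)
    obtain ⟨j2, hj2, e2⟩ := i2 (i + 1) hi
    have h12 : τ j1 < τ j2 := (i3 j1 j2 hj1 hj2).1 (by omega)
    refine ⟨(τ j1 + τ j2) / 2, fun m hm => ?_⟩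
    have hle : idx m ≤ i → τ m ≤ τ j1 := by
      intro h
      by_contra hc
      have := (i3 j1 m hj1 hm).2 (not_le.1 hc)
      omega
    have hge : ¬ idx m ≤ i → τ j2 ≤ τ m := by
      intro h
      by_contra hc
      have := (i3 m j2 hm hj2).2 (not_le.1 hc)
      omega
    by_cases h : idx m ≤ i
    · have h1 := hle h
      have h2 : τ m < (τ j1 + τ j2) / 2 := by linarith
      exact hsgn i m _ hm (by tauto) h2.ne
    · have h1 := hge h
      have h2 : (τ j1 + τ j2) / 2 < τ m := by linarith
      exact hsgn i m _ hm ⟨fun h' => absurd h' h, fun h' => absurd h' h2.le.not_gt⟩ h2.ne'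
  have hstep : ∀ i m, m ∈ symmDiff (T i) (T (i + 1)) ↔ m ≠ l ∧ idx m = i + 1 := by
    intro i m
    rw [Finset.mem_symmDiff, hT, hT]
    have h1 : idx m = i + 1 ↔ (idx m ≤ i + 1 ∧ ¬ idx m ≤ i) := by omega
    have h2 : idx m ≤ i → idx m ≤ i + 1 := by omega
    rw [h1]
    tauto
  have hflip : ∀ i, i + 1 < k → symmDiff (T i) {l} ∈ topes a := by
    intro i hi
    obtain ⟨z, hz⟩ := hmid i hi
    exact wall_of_zero a H.h0 (hXl z) hz
  refine ⟨k, idx, T, i1, i2, ?_, hstep, ?_, ?_, ?_, ?_⟩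
  · intro j m hj hm
    rw [hflat j m hj hm, heq m j hm hj]
  · intro i j hij hj he
    obtain ⟨m, hm, hmj⟩ := i2 j hj
    have h1 : m ∈ T i ↔ m ∈ T j := by rw [he]
    rw [hT, hT] at h1
    have h2 : ¬ idx m ≤ i := by omega
    have h3 : idx m ≤ j := by omega
    tauto
  · intro i hi
    obtain ⟨z, hz⟩ := hmid i hi
    have := wall_of_zero a H.h0 (A := symmDiff (T i) {l}) (hXl z) (fun m hm => by
      rw [eps_symmDiff_of_ne _ hm]; exact hz m hm)
    rwa [symmDiff_symmDiff_cancel_right] at this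
  · intro i hi
    exact (mem_walls a).2 (hflip i hi)
  · intro i j hi hj hij
    refine ⟨X (τ j), hX0 _, fun m => ⟨fun hm => ?_, fun hm => ?_⟩⟩
    · by_cases hml : m = l
      · rw [hml]; exact hXl _
      · rw [hX m hml, (hflat j m hj hml).1 hm]; ring
    · have hml : m ≠ l := by
        rintro rfl; exact hm (fl_left a m j)
      have hne : τ m ≠ τ j := fun h => hm ((hflat j m hj hml).2 h)
      refine hsgn i m _ hml ?_ hne
      have hne' : idx m ≠ idx j := fun h => hne ((heq m j hml hj).1 h)
      rw [← i3 m j hml hj]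
      omega

end edges
end Cheap

set_option linter.unusedSectionVars false
set_option linter.unusedVariables false
namespace Cheap

section cover

variable {ι : Type*} [Fintype ι] [DecidableEq ι] {a : ι → E3}

theorem Chart.edge (H : Arr a) {l : ι} {k : ℕ} {idx : ι → ℕ} {T : ℕ → Finset ι}
    (C : Chart a l k idx T) {i : ℕ} (hi : i + 1 < k) :
    (T i, l) ∈ NG a ∨ ∃ x y, Good a (T i) l x y ∧ idx x = i ∧ idx y = i + 1 := by
  classical
  by_cases hg : ∃ x y, Good a (T i) l x y
  · right
    obtain ⟨x, y, hg⟩ := hg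
    have hx : x ≠ l := hg.2.2.1.1.symm
    have hy : y ≠ l := hg.2.2.2.1.1.symm
    have key : ∀ v, (v = i ∨ v = i + 1) → idx x = v ∨ idx y = v := by
      intro v hv
      obtain ⟨j, hj, hjv⟩ := C.surj v (by omega)
      have hco := C.corner i j hi hj (by omega)
      have := corner_mem a H.hp H.h0 hg.1 hg.2.1 (fl_mem_flats a hj.symm) hco (fl_left a l j)
      rw [C.flat j x hj hx, C.flat j y hj hy, hjv] at this
      exact this
    have h1 := key i (Or.inl rfl)
    have h2 := key (i + 1) (Or.inr rfl)
    by_cases hxi : idx x = i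
    · exact ⟨x, y, hg, hxi, by omega⟩
    · exact ⟨y, x, hg.swap H, by omega, by omega⟩
  · left
    rw [NG, Finset.mem_filter]
    exact ⟨Finset.mem_product.2 ⟨C.tope i hi, Finset.mem_univ _⟩, C.wall i hi, hg⟩

/-- Regular edges. -/
def RGE (a : ι → E3) (l : ι) (idx : ι → ℕ) (T : ℕ → Finset ι) (i : ℕ) : Prop :=
  ∃ x y, RG a (T i, l, x, y) ∧ idx x = i ∧ idx y = i + 1

theorem Chart.idx_eq {l : ι} {k : ℕ} {idx : ι → ℕ} {T : ℕ → Finset ι}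
    (C : Chart a l k idx T) {x y : ι} (h : T3 a l x y) : idx y = idx x := by
  rw [← C.flat x y h.1.symm h.2.1.symm, h.2.2.2]
  simp

theorem Chart.link (H : Arr a) {l : ι} {k : ℕ} {idx : ι → ℕ} {T : ℕ → Finset ι}
    (C : Chart a l k idx T) {i : ℕ} {x y x2 y2 : ι}
    (h1 : Good a (T i) l x y) (hx : idx x = i) (hy : idx y = i + 1)
    (h2 : Good a (T (i + 1)) l x2 y2) (hx2 : idx x2 = i + 1) :
    T3 a l x2 y ∧ T (i + 1) = symmDiff (symmDiff (T i) {y}) {x2} := by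
  have t := h1.2.2.2.1
  generalize third a l y = z at t
  have hz := C.idx_eq t
  have hT : T (i + 1) = symmDiff (symmDiff (T i) {y}) {z} := by
    have e1 : symmDiff (T i) (T (i + 1)) = symmDiff {y} {z} := by
      ext m
      rw [C.step, Finset.mem_symmDiff, Finset.mem_singleton, Finset.mem_singleton]
      constructor
      · rintro ⟨hm, hmi⟩
        have : m ∈ fl a l y := (C.flat y m t.1.symm hm).2 (by omega)
        rw [t.2.2.2] at this
        simp only [Finset.mem_insert, Finset.mem_singleton] at this
        rcases this with h | h | h
        · exact absurd h hm
        · exact Or.inl ⟨h, h ▸ t.2.2.1⟩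
        · exact Or.inr ⟨h, h ▸ t.2.2.1.symm⟩
      · rintro (⟨h, _⟩ | ⟨h, _⟩)
        · rw [h]; exact ⟨t.1.symm, hy⟩
        · rw [h]; exact ⟨t.2.1.symm, by omega⟩
    rw [symmDiff_assoc, ← e1, symmDiff_symmDiff_cancel_left]
  have hx2l : x2 ≠ l := h2.2.2.1.1.symm
  have hmem : x2 ∈ fl a l y := (C.flat y x2 t.1.symm hx2l).2 (by omega)
  rw [t.2.2.2] at hmem
  simp only [Finset.mem_insert, Finset.mem_singleton] at hmem
  rcases hmem with h | h | h
  · exact absurd h hx2l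
  · exfalso
    have hw : x2 ∈ walls a (T (i + 1)) := by rw [h2.2.1]; simp
    rw [mem_walls, h, hT, symmDiff_right_comm (T i), symmDiff_symmDiff_cancel_right] at hw
    have hw2 : z ∈ walls a (T i) := (mem_walls a).2 hw
    rw [h1.2.1] at hw2
    simp only [Finset.mem_insert, Finset.mem_singleton] at hw2
    rcases hw2 with h | h | h
    · exact t.2.1 h.symm
    · rw [h] at hz; omega
    · exact t.2.2.1 h.symm
  · subst h
    exact ⟨t.swap' H, hT⟩

theorem Chart.run (H : Arr a) {l : ι} {k : ℕ} {idx : ι → ℕ} {T : ℕ → Finset ι}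
    (C : Chart a l k idx T) {v0 v1 : ℕ} (h01 : v0 ≤ v1) (h1 : v1 < k)
    (hR : ∀ i, v0 ≤ i → i < v1 → RGE a l idx T i) :
    ∃ q : Fin 10 → ℝ, q ≠ 0 ∧ ev q (a l) = 0 ∧
      ∀ j, j ≠ l → v0 ≤ idx j → idx j ≤ v1 → ev q (a j) = 0 := by
  rcases h01.eq_or_lt with h | hlt
  · subst h
    obtain ⟨j0, hj0, hi⟩ := C.surj v0 h1
    obtain ⟨q, hq, hev⟩ := exists_cubic_line (cr (a l) (a j0)) (H.hp l j0 hj0.symm)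
    refine ⟨q, hq, ?_, ?_⟩
    · rw [hev, dt_comm, dt_cr_left]; norm_num
    · intro j hj h2 h3
      have : j ∈ fl a l j0 := (C.flat j0 j hj0 hj).2 (by omega)
      rw [mem_fl] at this
      rw [hev, dt_comm, this]; norm_num
  · haveI : Nonempty ι := ⟨l⟩
    have hR' : ∀ i, ∃ x y, v0 ≤ i → i < v1 → RG a (T i, l, x, y) ∧ idx x = i ∧ idx y = i + 1 := by
      intro i
      by_cases h : v0 ≤ i ∧ i < v1
      · obtain ⟨x, y, h'⟩ := hR i h.1 h.2
        exact ⟨x, y, fun _ _ => h'⟩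
      · exact ⟨l, l, fun h2 h3 => absurd ⟨h2, h3⟩ h⟩
    choose x y hxy using hR'
    obtain ⟨m, rfl⟩ : ∃ m, v1 = v0 + m := ⟨v1 - v0, by omega⟩
    have hm : 1 ≤ m := by omega
    have hG : ∀ n, n < m → Good a (T (v0 + n)) l (x (v0 + n)) (y (v0 + n)) :=
      fun n hn => (hxy (v0 + n) (by omega) (by omega)).1.1
    have hlink : ∀ n, n + 1 < m → T3 a l (x (v0 + (n + 1))) (y (v0 + n)) ∧
        T (v0 + (n + 1)) = symmDiff (symmDiff (T (v0 + n)) {y (v0 + n)}) {x (v0 + (n + 1))} := by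
      intro n hn
      have e1 := hxy (v0 + n) (by omega) (by omega)
      have e2 := hxy (v0 + n + 1) (by omega) (by omega)
      exact C.link H e1.1.1 e1.2.1 e1.2.2 e2.1.1 e2.2.1
    let A : ℕ → ι := fun n => if n < m then x (v0 + n) else third a l (y (v0 + (m - 1)))
    let B : ℕ → ι := fun n => if n = 0 then third a l (x v0) else y (v0 + (n - 1))
    have hA1 : ∀ n, n < m → A n = x (v0 + n) := fun n hn => by simp [A, hn]
    have hA2 : A m = third a l (y (v0 + (m - 1))) := by simp [A]
    have hB0 : B 0 = third a l (x v0) := by simp [B]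
    have hB1 : ∀ n, B (n + 1) = y (v0 + n) := fun n => by simp [B]
    have hL : ∀ n ≤ m, T3 a l (A n) (B n) := by
      intro n hn
      cases n with
      | zero =>
        rw [hA1 0 hm, hB0]
        exact (hG 0 hm).2.2.1
      | succ n =>
        rw [hB1]
        rcases hn.eq_or_lt with h | h
        · subst h
          rw [hA2, Nat.add_sub_cancel]
          exact (hG n (by omega)).2.2.2.1.swap' H
        · rw [hA1 _ h]; exact (hlink n h).1
    have hiA : ∀ n ≤ m, idx (A n) = v0 + n := by
      intro n hn
      rcases hn.eq_or_lt with h | h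
      · have e := C.idx_eq (hL n hn)
        obtain ⟨n', rfl⟩ : ∃ n', n = n' + 1 := ⟨n - 1, by omega⟩
        rw [hB1] at e
        rw [← e, (hxy (v0 + n') (by omega) (by omega)).2.2]; omega
      · rw [hA1 n h]; exact (hxy (v0 + n) (by omega) (by omega)).2.1
    have hiB : ∀ n ≤ m, idx (B n) = v0 + n := fun n hn => by
      rw [C.idx_eq (hL n hn), hiA n hn]
    obtain ⟨q, hq, hq1, hq2⟩ := run_cubic H m hm l (fun n => T (v0 + n)) A B
      (by
        intro n hn
        rw [hA1 n hn, hB1]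
        exact (hxy (v0 + n) (by omega) (by omega)).1) hL
      (by
        intro n hn
        rw [hA1 _ hn, hB1]
        exact (hlink n hn).2)
      (by
        intro n n' hn hn' hne
        refine ⟨fun h => ?_, fun h => ?_, fun h => ?_⟩
        · have e1 := hiA n hn
          rw [h, hiA n' hn'] at e1; omega
        · have e1 := hiA n hn
          rw [h, hiB n' hn'] at e1; omega
        · have e1 := hiB n hn
          rw [h, hiB n' hn'] at e1; omega)
    refine ⟨q, hq, hq1, fun j hj h2 h3 => ?_⟩
    obtain ⟨n, hn⟩ : ∃ n, idx j = v0 + n := ⟨idx j - v0, by omega⟩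
    have hnm : n ≤ m := by omega
    have t := hL n hnm
    have hmem : j ∈ fl a l (A n) := (C.flat _ _ t.1.symm hj).2 (by rw [hn, hiA n hnm])
    rw [t.2.2.2] at hmem
    simp only [Finset.mem_insert, Finset.mem_singleton] at hmem
    rcases hmem with h | h | h
    · exact absurd h hj
    · rw [h]; exact (hq2 n hnm).1
    · rw [h]; exact (hq2 n hnm).2

open Classical in
/-- Irregular edges on a line. -/
noncomputable def Bad (a : ι → E3) (l : ι) (k : ℕ) (idx : ι → ℕ) (T : ℕ → Finset ι) : Finset ℕ :=
  (Finset.range k).filter (fun i => i + 1 < k ∧ ¬ RGE a l idx T i)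

theorem Chart.cover (H : Arr a) {l : ι} {k : ℕ} {idx : ι → ℕ} {T : ℕ → Finset ι}
    (C : Chart a l k idx T) : ∃ q : ℕ → Fin 10 → ℝ, (∀ r, q r ≠ 0) ∧
      ∀ j, ∃ r, r ≤ (Bad a l k idx T).card ∧ ev (q r) (a j) = 0 := by
  classical
  let R : ℕ → ℕ := fun v => ((Bad a l k idx T).filter (· < v)).card
  have hk : 0 < k := by
    obtain ⟨j, hj⟩ := Fintype.exists_ne_of_one_lt_card (show 1 < Fintype.card ι from H.hc) l
    have := C.lt j hj; omega
  have key : ∀ r, ∃ q : Fin 10 → ℝ, q ≠ 0 ∧ ev q (a l) = 0 ∧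
      ∀ j, j ≠ l → R (idx j) = r → ev q (a j) = 0 := by
    intro r
    by_cases hS : ((Finset.range k).filter (fun v => R v = r)).Nonempty
    · set S := (Finset.range k).filter (fun v => R v = r) with hSd
      have h0 := Finset.min'_mem S hS
      have h1 := Finset.max'_mem S hS
      have hle : S.min' hS ≤ S.max' hS := Finset.min'_le _ _ h1
      have hmin : ∀ v ∈ S, S.min' hS ≤ v := fun v hv => Finset.min'_le _ _ hv
      have hmax : ∀ v ∈ S, v ≤ S.max' hS := fun v hv => Finset.le_max' _ _ hv
      generalize S.min' hS = v0 at *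
      generalize S.max' hS = v1 at *
      rw [hSd, Finset.mem_filter, Finset.mem_range] at h0 h1
      obtain ⟨q, hq, hq1, hq2⟩ := C.run H hle h1.1 (by
        intro i hi0 hi1
        by_contra hc
        have hib : i ∈ Bad a l k idx T := by
          rw [Bad, Finset.mem_filter, Finset.mem_range]
          exact ⟨by omega, by omega, hc⟩
        have : R v0 < R v1 := by
          refine Finset.card_lt_card ⟨?_, ?_⟩
          · intro z hz
            rw [Finset.mem_filter] at hz ⊢
            exact ⟨hz.1, by omega⟩
          · intro hcc
            have := hcc (Finset.mem_filter.2 ⟨hib, hi1⟩)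
            rw [Finset.mem_filter] at this
            omega
        omega)
      refine ⟨q, hq, hq1, fun j hj hjr => ?_⟩
      have hjS : idx j ∈ S := by
        rw [hSd, Finset.mem_filter, Finset.mem_range]; exact ⟨C.lt j hj, hjr⟩
      exact hq2 j hj (hmin _ hjS) (hmax _ hjS)
    · obtain ⟨q, hq, hq1, _⟩ := C.run H (le_refl 0) hk (by intro i _ h; omega)
      refine ⟨q, hq, hq1, fun j hj hjr => ?_⟩
      exact absurd ⟨idx j, Finset.mem_filter.2 ⟨Finset.mem_range.2 (C.lt j hj), hjr⟩⟩ hS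
  choose q hq hq1 hq2 using key
  refine ⟨q, hq, fun j => ?_⟩
  by_cases hj : j = l
  · exact ⟨0, Nat.zero_le _, by rw [hj]; exact hq1 0⟩
  · exact ⟨R (idx j), Finset.card_le_card (Finset.filter_subset _ _), hq2 _ j hj rfl⟩

open Classical in
theorem Chart.card_Bad (H : Arr a) {l : ι} {k : ℕ} {idx : ι → ℕ} {T : ℕ → Finset ι}
    (C : Chart a l k idx T) : (Bad a l k idx T).card ≤
      ((NG a).filter (fun p => p.2 = l)).card + ((BS a).filter (fun s => s.2.1 = l)).card := by
  haveI : Nonempty ι := ⟨l⟩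
  have hTinj : ∀ i j, i < k → j < k → T i = T j → i = j := by
    intro i j hi hj he
    rcases lt_trichotomy i j with h | h | h
    · exact absurd he (C.inj i j h hj)
    · exact h
    · exact absurd he.symm (C.inj j i h hi)
  rw [← Finset.card_filter_add_card_filter_not (s := Bad a l k idx T) (fun i => (T i, l) ∈ NG a)]
  refine Nat.add_le_add ?_ ?_
  · refine Finset.card_le_card_of_injOn (fun i => (T i, l)) ?_ ?_
    · intro i hi
      have := (Finset.mem_filter.1 hi).2
      exact Finset.mem_coe.2 (Finset.mem_filter.2 ⟨this, rfl⟩)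
    · intro i hi j hj he
      have h1 := (Finset.mem_filter.1 (Finset.mem_filter.1 hi).1).1
      have h2 := (Finset.mem_filter.1 (Finset.mem_filter.1 hj).1).1
      exact hTinj i j (Finset.mem_range.1 h1) (Finset.mem_range.1 h2) (Prod.mk.inj he).1
  · have hex : ∀ i ∈ (Bad a l k idx T).filter (fun i => ¬ (T i, l) ∈ NG a), ∃ s : St ι,
        s ∈ (BS a).filter (fun s => s.2.1 = l) ∧ s.1 = T i := by
      intro i hi
      obtain ⟨hi1, hi2⟩ := Finset.mem_filter.1 hi
      obtain ⟨_, hi3, hi4⟩ := Finset.mem_filter.1 hi1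
      rcases C.edge H hi3 with h | ⟨x, y, hg, hx, hy⟩
      · exact absurd h hi2
      · refine ⟨(T i, l, x, y), Finset.mem_filter.2 ⟨?_, rfl⟩, rfl⟩
        rw [BS, Finset.mem_filter]
        exact ⟨Finset.mem_univ _, hg, fun h => hi4 ⟨x, y, h, hx, hy⟩⟩
    choose! f hf1 hf2 using hex
    refine Finset.card_le_card_of_injOn f (fun i hi => hf1 i hi) ?_
    intro i hi j hj he
    have h1 := (Finset.mem_filter.1 (Finset.mem_filter.1 hi).1).1
    have h2 := (Finset.mem_filter.1 (Finset.mem_filter.1 hj).1).1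
    refine hTinj i j (Finset.mem_range.1 h1) (Finset.mem_range.1 h2) ?_
    rw [← hf2 i hi, ← hf2 j hj, he]

/-- Main covering statement for noncollinear configurations. -/
theorem cover_main (H : Arr a) (K : ℝ) (hK : 1 ≤ K) (hN : (N2 a : ℝ) ≤ K * Fintype.card ι) :
    ∃ (N : ℕ) (q : ℕ → Fin 10 → ℝ), (N : ℝ) + 1 ≤ 500 * K ∧ (∀ r, q r ≠ 0) ∧
      ∀ j, ∃ r, r ≤ N ∧ ev (q r) (a j) = 0 := by
  classical
  have hch : ∀ l, ∃ k idx T, Chart a l k idx T := exists_chart H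
  choose k idx T C using hch
  have hsum : ∑ l, (Bad a l (k l) (idx l) (T l)).card ≤ 312 * N2 a := by
    calc ∑ l, (Bad a l (k l) (idx l) (T l)).card
        ≤ ∑ l, (((NG a).filter (fun p => p.2 = l)).card +
          ((BS a).filter (fun s => s.2.1 = l)).card) := Finset.sum_le_sum fun l _ => (C l).card_Bad H
      _ = (NG a).card + (BS a).card := by
        rw [Finset.sum_add_distrib,
          ← Finset.card_eq_sum_card_fiberwise (f := fun p : Finset ι × ι => p.2)
            (fun _ _ => Finset.mem_coe.2 (Finset.mem_univ _)),
          ← Finset.card_eq_sum_card_fiberwise (f := fun s : St ι => s.2.1)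
            (fun _ _ => Finset.mem_coe.2 (Finset.mem_univ _))]
      _ ≤ 312 * N2 a := by
        have h1 := card_NG H
        have h2 := card_BS H
        omega
  have hc : 0 < Fintype.card ι := by have := H.hc; omega
  obtain ⟨l, hl⟩ : ∃ l, ((Bad a l (k l) (idx l) (T l)).card : ℝ) ≤ 312 * K := by
    by_contra hcon
    push Not at hcon
    haveI : Nonempty ι := Fintype.card_pos_iff.1 hc
    have h1 : ∑ l : ι, (312 * K : ℝ) < ∑ l, ((Bad a l (k l) (idx l) (T l)).card : ℝ) :=
      Finset.sum_lt_sum_of_nonempty Finset.univ_nonempty fun l _ => hcon l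
    rw [Finset.sum_const, Finset.card_univ, nsmul_eq_mul] at h1
    have h2 : (∑ l, ((Bad a l (k l) (idx l) (T l)).card : ℝ)) ≤ 312 * N2 a := by
      exact_mod_cast hsum
    nlinarith
  obtain ⟨q, hq, hq2⟩ := (C l).cover H
  exact ⟨_, q, by linarith, hq, hq2⟩

end cover
end Cheap

set_option linter.unusedSectionVars false
set_option linter.unusedVariables false
namespace Cheap

section glue

theorem ev_eq_zero {c : Fin 10 → ℝ} (h : ∀ x, ev c x = 0) : c = 0 := by
  have h1 := h ![1, 0, 0]
  have h2 := h ![0, 1, 0]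
  have h3 := h ![0, 0, 1]
  have h4 := h ![1, 1, 0]
  have h5 := h ![1, -1, 0]
  have h6 := h ![1, 0, 1]
  have h7 := h ![1, 0, -1]
  have h8 := h ![0, 1, 1]
  have h9 := h ![0, 1, -1]
  have h10 := h ![1, 1, 1]
  simp [ev] at h1 h2 h3 h4 h5 h6 h7 h8 h9 h10
  funext i
  fin_cases i <;> simp <;> linarith

/-- The cubic curve with given coefficients. -/
def curve (c : Fin 10 → ℝ) : Set RP2 := {x : RP2 | ev c x.rep = 0}

theorem curve_isCubic {c : Fin 10 → ℝ} (hc : c ≠ 0) : IsCubicCurve (curve c) := by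
  open MvPolynomial in
  let p : MvPolynomial (Fin 3) ℝ :=
    C (c 0) * (X 0 * X 0 * X 0) + C (c 1) * (X 0 * X 0 * X 1) + C (c 2) * (X 0 * X 0 * X 2) +
    C (c 3) * (X 0 * X 1 * X 1) + C (c 4) * (X 0 * X 1 * X 2) + C (c 5) * (X 0 * X 2 * X 2) +
    C (c 6) * (X 1 * X 1 * X 1) + C (c 7) * (X 1 * X 1 * X 2) + C (c 8) * (X 1 * X 2 * X 2) +
    C (c 9) * (X 2 * X 2 * X 2)
  have hev : ∀ x, MvPolynomial.eval x p = ev c x := by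
    intro x
    simp only [p, ev, map_add, map_mul, MvPolynomial.eval_C, MvPolynomial.eval_X]
    ring
  have hmon : ∀ (r : ℝ) (i j k : Fin 3), (MvPolynomial.C r * (MvPolynomial.X i * MvPolynomial.X j *
      MvPolynomial.X k) : MvPolynomial (Fin 3) ℝ).IsHomogeneous 3 := by
    intro r i j k
    have := (MvPolynomial.isHomogeneous_C (Fin 3) r).mul
      (((MvPolynomial.isHomogeneous_X ℝ i).mul (MvPolynomial.isHomogeneous_X ℝ j)).mul
        (MvPolynomial.isHomogeneous_X ℝ k))
    simpa using this
  refine ⟨p, ?_, ?_, ?_⟩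
  · intro h
    apply hc
    apply ev_eq_zero
    intro x
    rw [← hev, h, map_zero]
  · exact (((((((((hmon _ _ _ _).add (hmon _ _ _ _)).add (hmon _ _ _ _)).add (hmon _ _ _ _)).add
      (hmon _ _ _ _)).add (hmon _ _ _ _)).add (hmon _ _ _ _)).add (hmon _ _ _ _)).add
      (hmon _ _ _ _)).add (hmon _ _ _ _)
  · ext x
    simp only [curve, Set.mem_ofPred_eq, hev]

theorem cr_rep_ne {x y : RP2} (h : x ≠ y) : cr x.rep y.rep ≠ 0 := by
  intro hc
  apply h
  rw [← x.mk_rep, ← y.mk_rep, Projectivization.mk_eq_mk_iff']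
  have hy := dt_self_pos y.rep_nonzero
  refine ⟨dt x.rep y.rep / dt y.rep y.rep, ?_⟩
  generalize x.rep = u at *
  generalize y.rep = v at *
  have c0 := congrFun hc 0
  have c1 := congrFun hc 1
  have c2 := congrFun hc 2
  simp [cr] at c0 c1 c2
  have key : dt u v • v = dt v v • u := by
    funext i
    fin_cases i <;> simp [dt]
    · linear_combination v 2 * c1 - v 1 * c2
    · linear_combination v 0 * c2 - v 2 * c0
    · linear_combination v 1 * c0 - v 0 * c1
  rw [div_eq_inv_mul, mul_smul, key, smul_smul, inv_mul_cancel₀ hy.ne', one_smul]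

/-- The plane spanned by two vectors. -/
def pl (u v : E3) : Submodule ℝ E3 := Submodule.span ℝ (Set.range ![u, v])

theorem finrank_pl {u v : E3} (h : cr u v ≠ 0) : Module.finrank ℝ (pl u v) = 2 := by
  have hli : LinearIndependent ℝ ![u, v] := by
    rw [LinearIndependent.pair_iff]
    intro s t hst
    have e0 := congrFun hst 0
    have e1 := congrFun hst 1
    have e2 := congrFun hst 2
    simp at e0 e1 e2
    have hs : s • cr u v = 0 := by
      funext i
      fin_cases i <;> simp [cr, -mul_eq_zero]
      · linear_combination v 2 * e1 - v 1 * e2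
      · linear_combination v 0 * e2 - v 2 * e0
      · linear_combination v 1 * e0 - v 0 * e1
    have ht : t • cr u v = 0 := by
      funext i
      fin_cases i <;> simp [cr, -mul_eq_zero]
      · linear_combination u 1 * e2 - u 2 * e1
      · linear_combination u 2 * e0 - u 0 * e2
      · linear_combination u 0 * e1 - u 1 * e0
    exact ⟨(smul_eq_zero.1 hs).resolve_right h, (smul_eq_zero.1 ht).resolve_right h⟩
  rw [pl, finrank_span_eq_card hli, Fintype.card_fin]

theorem left_mem_pl (u v : E3) : u ∈ pl u v := Submodule.subset_span ⟨0, rfl⟩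

theorem right_mem_pl (u v : E3) : v ∈ pl u v := Submodule.subset_span ⟨1, rfl⟩

theorem mem_pl {u v x : E3} (h : cr u v ≠ 0) : x ∈ pl u v ↔ dt x (cr u v) = 0 := by
  constructor
  · intro hx
    have hle : pl u v ≤ kr (cr u v) := by
      refine Submodule.span_le.2 ?_
      rintro _ ⟨i, rfl⟩
      have : dt (cr u v) (![u, v] i) = 0 := by
        fin_cases i
        · simpa using (dt_comm _ _).trans (dt_cr_left u v)
        · simpa using (dt_comm _ _).trans (dt_cr_right u v)
      exact mem_kr.2 this
    rw [dt_comm]; exact mem_kr.1 (hle hx)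
  · intro hx
    obtain ⟨s, t, rfl⟩ := eq_comb h hx
    exact Submodule.add_mem _ (Submodule.smul_mem _ _ (left_mem_pl u v))
      (Submodule.smul_mem _ _ (right_mem_pl u v))

theorem submodule_le_iff (x : RP2) (W : Submodule ℝ E3) : x.submodule ≤ W ↔ x.rep ∈ W := by
  rw [Projectivization.submodule_eq, Submodule.span_singleton_le_iff_mem]

theorem eq_pl {x y : RP2} (h : x ≠ y) {W : Submodule ℝ E3} (hW : Module.finrank ℝ W = 2)
    (hx : x.submodule ≤ W) (hy : y.submodule ≤ W) : W = pl x.rep y.rep := by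
  rw [submodule_le_iff] at hx hy
  symm
  apply Submodule.eq_of_le_of_finrank_eq
  · refine Submodule.span_le.2 ?_
    rintro _ ⟨i, rfl⟩
    fin_cases i
    · exact hx
    · exact hy
  · rw [finrank_pl (cr_rep_ne h), hW]

theorem finite_ord {P : Set RP2} (hP : P.Finite) :
    {L : Set RP2 | IsProjLine L ∧ (P ∩ L).ncard = 2}.Finite := by
  refine ((hP.prod hP).image
    (fun p : RP2 × RP2 => {x : RP2 | x.submodule ≤ pl p.1.rep p.2.rep})).subset ?_
  rintro L ⟨⟨W, hW, rfl⟩, hL⟩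
  obtain ⟨x, y, hxy, he⟩ := Set.ncard_eq_two.1 hL
  have hx : x ∈ P ∩ {x : RP2 | x.submodule ≤ W} := by rw [he]; simp
  have hy : y ∈ P ∩ {x : RP2 | x.submodule ≤ W} := by rw [he]; simp
  refine ⟨(x, y), ⟨hx.1, hy.1⟩, ?_⟩
  simp only [← eq_pl hxy hW hx.2 hy.2]

theorem N2_le {P : Set RP2} (hP : P.Finite) [DecidableEq hP.toFinset] :
    N2 (fun p : hP.toFinset => p.1.rep) ≤ numOrdinaryLines P := by
  classical
  set a : hP.toFinset → E3 := fun p => p.1.rep with ha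
  have hp : ∀ i j : hP.toFinset, i ≠ j → cr (a i) (a j) ≠ 0 := fun i j hij =>
    cr_rep_ne fun h => hij (Subtype.ext h)
  have hex : ∀ J ∈ (flats a).filter (fun J => J.card = 2), ∃ L : Set RP2,
      IsProjLine L ∧ (P ∩ L).ncard = 2 ∧ ∀ i : hP.toFinset, i ∈ J ↔ i.1 ∈ L := by
    intro J hJ
    obtain ⟨hJ1, hJ2⟩ := Finset.mem_filter.1 hJ
    obtain ⟨i, j, hij, rfl⟩ := (mem_flats a).1 hJ1
    have hmem : ∀ m : hP.toFinset, m ∈ fl a i j ↔ m.1.submodule ≤ pl (a i) (a j) := by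
      intro m
      rw [mem_fl, submodule_le_iff, mem_pl (hp i j hij)]
    refine ⟨{x | x.submodule ≤ pl (a i) (a j)}, ⟨_, finrank_pl (hp i j hij), rfl⟩, ?_, hmem⟩
    have he : P ∩ {x | x.submodule ≤ pl (a i) (a j)} =
        (((fl a i j).map (Function.Embedding.subtype _) : Finset RP2) : Set RP2) := by
      ext x
      rw [Finset.mem_coe, Finset.mem_map]
      constructor
      · rintro ⟨hx1, hx2⟩
        exact ⟨⟨x, hP.mem_toFinset.2 hx1⟩, (hmem _).2 hx2, rfl⟩
      · rintro ⟨m, hm, rfl⟩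
        exact ⟨hP.mem_toFinset.1 m.2, (hmem _).1 hm⟩
    rw [he, Set.ncard_coe_finset, Finset.card_map, hJ2]
  choose! f hf1 hf2 hf3 using hex
  rw [N2, numOrdinaryLines, ← Set.ncard_coe_finset]
  refine Set.ncard_le_ncard_of_injOn f ?_ ?_ (finite_ord hP)
  · intro J hJ
    exact ⟨hf1 J hJ, hf2 J hJ⟩
  · intro J hJ J' hJ' he
    ext i
    rw [hf3 J hJ, hf3 J' hJ', he]

theorem exists_perp (u : E3) : ∃ v : E3, v ≠ 0 ∧ dt u v = 0 := by
  by_cases h : u 0 = 0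
  · refine ⟨![1, 0, 0], fun hc => ?_, by simp [dt, h]⟩
    have := congrFun hc 0
    simp at this
  · refine ⟨![u 1, - u 0, 0], fun hc => ?_, by simp [dt]; ring⟩
    have := congrFun hc 1
    simp at this
    exact h this

end glue
end Cheap

/-- The cheap structure theorem: a set of `n` points of `ℝP²` spanning at most `K n`
ordinary lines is contained in the union of at most `500 K` cubic curves. -/
theorem cheap_structure (K : ℝ) (hK : 1 ≤ K) (n : ℕ) (P : Set RP2)
    (hfin : P.Finite) (hcard : P.ncard = n)
    (hord : (numOrdinaryLines P : ℝ) ≤ K * n) :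
    ∃ 𝒞 : Finset (Set RP2), (∀ Z ∈ 𝒞, IsCubicCurve Z) ∧
      (𝒞.card : ℝ) ≤ 500 * K ∧ P ⊆ ⋃ Z ∈ 𝒞, Z := by
  classical
  by_cases hcol : ∃ u : Cheap.E3, u ≠ 0 ∧ ∀ p ∈ P, Cheap.dt p.rep u = 0
  · obtain ⟨u, hu, hp⟩ := hcol
    obtain ⟨c, hc, hev⟩ := Cheap.exists_cubic_line u hu
    refine ⟨{Cheap.curve c}, ?_, ?_, ?_⟩
    · intro Z hZ
      rw [Finset.mem_singleton.1 hZ]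
      exact Cheap.curve_isCubic hc
    · rw [Finset.card_singleton]; push_cast; linarith
    · intro p hpP
      refine Set.mem_iUnion₂.2 ⟨Cheap.curve c, Finset.mem_singleton_self _, ?_⟩
      have : Cheap.ev c p.rep = 0 := by
        rw [hev, Cheap.dt_comm, hp p hpP]; norm_num
      exact this
  · push Not at hcol
    have hn : ∀ u : Cheap.E3, u ≠ 0 → ∃ i : hfin.toFinset, Cheap.dt i.1.rep u ≠ 0 := by
      intro u hu
      obtain ⟨p, hp, h⟩ := hcol u hu
      exact ⟨⟨p, hfin.mem_toFinset.2 hp⟩, h⟩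
    have hcd : Fintype.card hfin.toFinset = n := by
      rw [Fintype.card_coe, ← hcard, Set.ncard_eq_toFinset_card P hfin]
    have H : Cheap.Arr (fun p : hfin.toFinset => p.1.rep) := by
      refine ⟨fun i j hij => Cheap.cr_rep_ne fun h => hij (Subtype.ext h),
        fun i => i.1.rep_nonzero, hn, ?_⟩
      by_contra hc
      have hsub : Fintype.card hfin.toFinset ≤ 1 := by omega
      obtain ⟨i, hi⟩ := hn ![1, 0, 0] (fun hc => by
        have := congrFun hc 0
        simp at this)
      obtain ⟨v, hv, hv2⟩ := Cheap.exists_perp i.1.rep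
      obtain ⟨j, hj⟩ := hn v hv
      rw [Fintype.card_le_one_iff.1 hsub j i] at hj
      exact hj hv2
    have hN : (Cheap.N2 (fun p : hfin.toFinset => p.1.rep) : ℝ) ≤ K * Fintype.card hfin.toFinset := by
      rw [hcd]
      refine le_trans ?_ hord
      exact_mod_cast Cheap.N2_le hfin
    obtain ⟨N, q, hNK, hq, hq2⟩ := Cheap.cover_main H K hK hN
    refine ⟨(Finset.range (N + 1)).image (fun r => Cheap.curve (q r)), ?_, ?_, ?_⟩
    · intro Z hZ
      obtain ⟨r, _, rfl⟩ := Finset.mem_image.1 hZ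
      exact Cheap.curve_isCubic (hq r)
    · refine le_trans ?_ hNK
      have := Finset.card_image_le (s := Finset.range (N + 1)) (f := fun r => Cheap.curve (q r))
      rw [Finset.card_range] at this
      exact_mod_cast this
    · intro p hp
      obtain ⟨r, hr, hr2⟩ := hq2 ⟨p, hfin.mem_toFinset.2 hp⟩
      refine Set.mem_iUnion₂.2 ⟨Cheap.curve (q r), Finset.mem_image_of_mem _
        (Finset.mem_range.2 (by omega)), hr2⟩
end

section
/- Let K ≥ 1 be a real number and let P be a set of n points in the real projective plane ℝP² spanning at most Kn ordinary lines. Suppose there is a line ℓ containing at least (2/3)n points of P. Then at most 3K points of P do not lie on ℓ. -/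
theorem finrank_sup_pair {x y : RP2} (h : x ≠ y) :
    Module.finrank ℝ (x.submodule ⊔ y.submodule : Submodule ℝ (Fin 3 → ℝ)) = 2 := by
  have hx := x.finrank_submodule
  have hy := y.finrank_submodule
  have hs := Submodule.finrank_sup_add_finrank_inf_eq x.submodule y.submodule
  have hle : Module.finrank ℝ (x.submodule ⊓ y.submodule : Submodule ℝ (Fin 3 → ℝ)) ≤ 1 :=
    hx ▸ Submodule.finrank_mono inf_le_left
  have hn : Module.finrank ℝ (x.submodule ⊓ y.submodule : Submodule ℝ (Fin 3 → ℝ)) ≠ 1 := by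
    intro h1
    have a := Submodule.eq_of_le_of_finrank_eq
      (inf_le_left : x.submodule ⊓ y.submodule ≤ x.submodule) (by rw [h1, hx])
    have b := Submodule.eq_of_le_of_finrank_eq
      (inf_le_right : x.submodule ⊓ y.submodule ≤ y.submodule) (by rw [h1, hy])
    exact h (Projectivization.submodule_injective (a.symm.trans b))
  omega

theorem projLine_ext {L L' : Set RP2} (hL : IsProjLine L) (hL' : IsProjLine L') {x y : RP2}
    (hxy : x ≠ y) (hx : x ∈ L) (hy : y ∈ L) (hx' : x ∈ L') (hy' : y ∈ L') : L = L' := by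
  obtain ⟨W, hW, rfl⟩ := hL
  obtain ⟨W', hW', rfl⟩ := hL'
  have key := finrank_sup_pair hxy
  have h1 : x.submodule ⊔ y.submodule = W :=
    Submodule.eq_of_le_of_finrank_eq (sup_le hx hy) (by rw [key, hW])
  have h2 : x.submodule ⊔ y.submodule = W' :=
    Submodule.eq_of_le_of_finrank_eq (sup_le hx' hy') (by rw [key, hW'])
  rw [← h1, ← h2]

def lineThru (p q : RP2) : Set RP2 := {x : RP2 | x.submodule ≤ p.submodule ⊔ q.submodule}

theorem lineThru_isProjLine {p q : RP2} (h : p ≠ q) : IsProjLine (lineThru p q) :=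
  ⟨_, finrank_sup_pair h, rfl⟩

theorem left_mem (p q : RP2) : p ∈ lineThru p q := by
  show p.submodule ≤ _
  exact le_sup_left

theorem right_mem (p q : RP2) : q ∈ lineThru p q := by
  show q.submodule ≤ _
  exact le_sup_right

theorem ordinary_finite (P : Set RP2) (hfin : P.Finite) :
    {L : Set RP2 | IsProjLine L ∧ (P ∩ L).ncard = 2}.Finite := by
  refine Set.Finite.of_finite_image (f := fun L => P ∩ L)
    (hfin.finite_subsets.subset ?_) ?_
  · rintro _ ⟨L, _, rfl⟩
    exact Set.inter_subset_left
  · rintro L ⟨hL, h2⟩ L' ⟨hL', _⟩ (he : P ∩ L = P ∩ L')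
    obtain ⟨x, y, hxy, hS⟩ := Set.ncard_eq_two.1 h2
    have hx : x ∈ P ∩ L := by rw [hS]; simp
    have hy : y ∈ P ∩ L := by rw [hS]; simp
    have hx' := he ▸ hx
    have hy' := he ▸ hy
    exact projLine_ext hL hL' hxy hx.2 hy.2 hx'.2 hy'.2

open Classical in
theorem count_lines (P : Set RP2) (hfin : P.Finite) (ℓ : Set RP2) (hℓ : IsProjLine ℓ) :
    (P \ ℓ).ncard * (P ∩ ℓ).ncard ≤
      numOrdinaryLines P + (P \ ℓ).ncard * (P \ ℓ).ncard := by
  have hA := hfin.inter_of_left ℓ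
  have hB := hfin.sdiff (t := ℓ)
  obtain ⟨A, hA⟩ := hA.exists_finset_coe
  obtain ⟨B, hB⟩ := hB.exists_finset_coe
  have memA : ∀ x, x ∈ A ↔ x ∈ P ∧ x ∈ ℓ := fun x => by
    rw [← Finset.mem_coe, hA]; rfl
  have memB : ∀ x, x ∈ B ↔ x ∈ P ∧ x ∉ ℓ := fun x => by
    rw [← Finset.mem_coe, hB]; rfl
  rw [← hA, ← hB, Set.ncard_coe_finset, Set.ncard_coe_finset]
  have hne : ∀ p ∈ A, ∀ q ∈ B, p ≠ q := by
    rintro p hp q hq rfl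
    exact ((memB p).1 hq).2 ((memA p).1 hp).2
  let bad : RP2 → RP2 → Prop := fun q p => ∃ q' ∈ B, q' ≠ q ∧ q' ∈ lineThru p q
  have hbad : ∀ q ∈ B, (A.filter (bad q)).card ≤ B.card := by
    intro q hq
    have hc : ∀ p : RP2, ∃ q', bad q p → q' ∈ B ∧ q' ≠ q ∧ q' ∈ lineThru p q := by
      intro p
      by_cases h : bad q p
      · obtain ⟨q', h1⟩ := h
        exact ⟨q', fun _ => h1⟩
      · exact ⟨q, fun h' => absurd h' h⟩
    choose f hf using hc
    refine Finset.card_le_card_of_injOn f ?_ ?_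
    · intro p hp
      exact (hf p (Finset.mem_filter.1 hp).2).1
    · intro p hp p' hp' he
      obtain ⟨hpA, hpb⟩ := Finset.mem_filter.1 hp
      obtain ⟨hpA', hpb'⟩ := Finset.mem_filter.1 hp'
      obtain ⟨h1, h2, h3⟩ := hf p hpb
      obtain ⟨h1', h2', h3'⟩ := hf p' hpb'
      rw [← he] at h3'
      have e := projLine_ext (lineThru_isProjLine (hne p hpA q hq))
        (lineThru_isProjLine (hne p' hpA' q hq)) h2 h3 (right_mem _ _) h3' (right_mem _ _)
      by_contra hpp
      have e2 := projLine_ext (lineThru_isProjLine (hne p hpA q hq)) hℓ hpp (left_mem _ _)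
        (e ▸ left_mem p' q) ((memA p).1 hpA).2 ((memA p').1 hpA').2
      exact ((memB q).1 hq).2 (e2 ▸ right_mem p q)
  let G : Finset (Σ _ : RP2, RP2) := B.sigma fun q => A.filter fun p => ¬ bad q p
  have hGcard : B.card * A.card ≤ G.card + B.card * B.card := by
    have : ∑ q ∈ B, A.card ≤ ∑ q ∈ B, ((A.filter fun p => ¬ bad q p).card + B.card) := by
      refine Finset.sum_le_sum fun q hq => ?_
      have h1 := hbad q hq
      have h2 := A.card_filter_add_card_filter_not (bad q)
      omega
    simpa [G, Finset.card_sigma, Finset.sum_add_distrib] using this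
  have hinter : ∀ g ∈ G, P ∩ lineThru g.2 g.1 = {g.2, g.1} := by
    rintro ⟨q, p⟩ hg
    obtain ⟨hq, hp⟩ := Finset.mem_sigma.1 hg
    obtain ⟨hp, hnb⟩ := Finset.mem_filter.1 hp
    dsimp only at *
    ext x
    constructor
    · rintro ⟨hxP, hx⟩
      by_cases hxl : x ∈ ℓ
      · left
        by_contra hxp
        have e2 := projLine_ext (lineThru_isProjLine (hne p hp q hq)) hℓ hxp hx
          (left_mem _ _) hxl ((memA p).1 hp).2
        exact ((memB q).1 hq).2 (e2 ▸ right_mem p q)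
      · right
        by_contra hxq
        exact hnb ⟨x, (memB x).2 ⟨hxP, hxl⟩, hxq, hx⟩
    · rintro (rfl | rfl)
      · exact ⟨((memA _).1 hp).1, left_mem _ _⟩
      · exact ⟨((memB _).1 hq).1, right_mem _ _⟩
  have hG : ∀ g ∈ G, g.1 ∈ B ∧ g.2 ∈ A := by
    rintro ⟨q, p⟩ hg
    obtain ⟨hq, hp⟩ := Finset.mem_sigma.1 hg
    exact ⟨hq, (Finset.mem_filter.1 hp).1⟩
  have hle : G.card ≤ numOrdinaryLines P := by
    rw [← Set.ncard_coe_finset]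
    refine Set.ncard_le_ncard_of_injOn (fun g => lineThru g.2 g.1) ?_ ?_ (ordinary_finite P hfin)
    · intro g hg
      obtain ⟨h1, h2⟩ := hG g hg
      have hn := hne _ h2 _ h1
      refine ⟨lineThru_isProjLine hn, ?_⟩
      rw [hinter g hg]
      exact Set.ncard_pair hn
    · rintro ⟨q, p⟩ hg ⟨q', p'⟩ hg' he
      obtain ⟨h1, h2⟩ := hG _ hg
      obtain ⟨h1', h2'⟩ := hG _ hg'
      have e1 := hinter _ hg
      have e2 := hinter _ hg'
      dsimp only at *
      rw [he, e2] at e1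
      have hp : p' ∈ ({p, q} : Set RP2) := by rw [← e1]; simp
      have hq : q' ∈ ({p, q} : Set RP2) := by rw [← e1]; simp
      have a1 : p' = p := hp.resolve_right (hne _ h2' _ h1)
      have a2 : q' = q := hq.resolve_left (fun h => hne _ h2 _ h1' h.symm)
      rw [a1, a2]
  omega

/-- If a set of `n` points spans at most `K n` ordinary lines and some line contains
at least `2n/3` of the points, then at most `3K` points lie off that line. -/
theorem big_line (K : ℝ) (hK : 1 ≤ K) (n : ℕ) (P : Set RP2)
    (hfin : P.Finite) (hcard : P.ncard = n)
    (hord : (numOrdinaryLines P : ℝ) ≤ K * n)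
    (ℓ : Set RP2) (hℓ : IsProjLine ℓ)
    (hbig : (2 : ℝ) / 3 * n ≤ ((P ∩ ℓ).ncard : ℝ)) :
    ((P \ ℓ).ncard : ℝ) ≤ 3 * K := by
  have hc := count_lines P hfin ℓ hℓ
  have hs := Set.ncard_inter_add_ncard_sdiff_eq_ncard P ℓ hfin
  rw [hcard] at hs
  have hc' : ((P \ ℓ).ncard : ℝ) * (P ∩ ℓ).ncard ≤
      numOrdinaryLines P + ((P \ ℓ).ncard : ℝ) * (P \ ℓ).ncard := by exact_mod_cast hc
  have hs' : ((P ∩ ℓ).ncard : ℝ) + (P \ ℓ).ncard = n := by exact_mod_cast hs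
  have hm0 : (0 : ℝ) ≤ (P \ ℓ).ncard := Nat.cast_nonneg _
  have ha0 : (0 : ℝ) ≤ (P ∩ ℓ).ncard := Nat.cast_nonneg _
  generalize ((P \ ℓ).ncard : ℝ) = m at *
  generalize ((P ∩ ℓ).ncard : ℝ) = a at *
  rcases Nat.eq_zero_or_pos n with h0 | hpos
  · subst h0
    norm_num at hs'
    linarith
  · have hn : (0 : ℝ) < n := by exact_mod_cast hpos
    have h1 : (n : ℝ) / 3 ≤ a - m := by linarith
    have h2 := mul_le_mul_of_nonneg_left h1 hm0
    have h3 : m * n ≤ (3 * K) * n := by nlinarith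
    exact le_of_mul_le_mul_right h3 hn
end

section
/- For every positive integer m and every real K ≥ 1 there exists a positive integer n₀ = n₀(m,K) such that the following holds. If P is a set of n ≥ n₀ points in the real projective plane ℝP² that is contained in the union of m lines ℓ₁ ∪ ⋯ ∪ ℓ_m, and P spans at most Kn ordinary lines, then there is a single line containing all except at most 3K of the points of P. -/
open Classical in
/-- top-k selection -/
lemma exists_top {α : Type*} (S : Finset α) (s : α → ℝ) (k : ℕ) :
    ∃ H ⊆ S, H.card ≤ k ∧ (H = S ∨ H.card = k) ∧ ∀ x ∈ H, ∀ y ∈ S, y ∉ H → s y ≤ s x := by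
  induction k with
  | zero => exact ⟨∅, by simp, by simp, by simp, by simp⟩
  | succ k ih =>
    obtain ⟨H, hHS, hc, h1, h2⟩ := ih
    by_cases hH : H = S
    · exact ⟨H, hHS, by omega, Or.inl hH, h2⟩
    · have hk : H.card = k := h1.resolve_left hH
      have hne : (S \ H).Nonempty := by
        rw [Finset.sdiff_nonempty]
        intro h
        exact hH (Finset.Subset.antisymm hHS h)
      obtain ⟨z, hz, hmax⟩ := Finset.exists_max_image (S \ H) s hne
      rw [Finset.mem_sdiff] at hz
      have hcard : (insert z H).card = k + 1 := by
        rw [Finset.card_insert_of_notMem hz.2, hk]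
      refine ⟨insert z H, ?_, hcard.le, Or.inr hcard, ?_⟩
      · intro x hx
        rcases Finset.mem_insert.1 hx with rfl | hx
        · exact hz.1
        · exact hHS hx
      · intro x hx y hy hyn
        have hyn' : y ∉ H := fun h => hyn (Finset.mem_insert_of_mem h)
        rcases Finset.mem_insert.1 hx with rfl | hx
        · exact hmax y (Finset.mem_sdiff.2 ⟨hy, hyn'⟩)
        · exact h2 x hx y hy hyn'

/-- collinearity -/
def Col (a x t : RP2) : Prop := t.submodule ≤ a.submodule ⊔ x.submodule

lemma submodule_le_iff (p : RP2) (W : Submodule ℝ (Fin 3 → ℝ)) :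
    p.submodule ≤ W ↔ p.rep ∈ W := by
  rw [Projectivization.submodule_eq, Submodule.span_singleton_le_iff_mem]

lemma eq_of_rep_mem {p q : RP2} (h : p.rep ∈ q.submodule) : p = q := by
  rw [Projectivization.submodule_eq, Submodule.mem_span_singleton] at h
  obtain ⟨c, hc⟩ := h
  rw [← p.mk_rep, ← q.mk_rep, Projectivization.mk_eq_mk_iff']
  exact ⟨c, hc⟩

lemma rep_mem_self (p : RP2) : p.rep ∈ p.submodule := by
  rw [← submodule_le_iff]

lemma finrank_sup {a x : RP2} (h : a ≠ x) :
    Module.finrank ℝ (a.submodule ⊔ x.submodule : Submodule ℝ (Fin 3 → ℝ)) = 2 := by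
  have h1 := Submodule.finrank_sup_add_finrank_inf_eq a.submodule x.submodule
  rw [Projectivization.finrank_submodule, Projectivization.finrank_submodule] at h1
  have h2 : a.submodule ⊓ x.submodule = ⊥ := by
    rw [Submodule.eq_bot_iff]
    intro y hy
    by_contra hy0
    obtain ⟨ha, hx⟩ := Submodule.mem_inf.1 hy
    rw [Projectivization.submodule_eq, Submodule.mem_span_singleton] at ha
    obtain ⟨c, rfl⟩ := ha
    have hc : c ≠ 0 := by rintro rfl; simp at hy0
    apply h
    apply eq_of_rep_mem
    have := x.submodule.smul_mem c⁻¹ hx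
    rwa [smul_smul, inv_mul_cancel₀ hc, one_smul] at this
  rw [h2] at h1
  simpa using h1

lemma sup_eq {a x : RP2} (h : a ≠ x) {W : Submodule ℝ (Fin 3 → ℝ)}
    (hW : Module.finrank ℝ W = 2) (ha : a.submodule ≤ W) (hx : x.submodule ≤ W) :
    a.submodule ⊔ x.submodule = W :=
  Submodule.eq_of_le_of_finrank_eq (sup_le ha hx) (by rw [finrank_sup h, hW])

lemma exists_functional {W : Submodule ℝ (Fin 3 → ℝ)} (hW : Module.finrank ℝ W = 2) :
    ∃ f : (Fin 3 → ℝ) →ₗ[ℝ] ℝ, LinearMap.ker f = W := by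
  have hlt : W < ⊤ := by
    rw [lt_top_iff_ne_top]
    rintro rfl
    rw [finrank_top] at hW
    simp at hW
  obtain ⟨f, hf, hle⟩ := Submodule.exists_le_ker_of_lt_top W hlt
  refine ⟨f, (Submodule.eq_of_le_of_finrank_eq hle ?_).symm⟩
  have h1 := LinearMap.finrank_range_add_finrank_ker f
  have h2 : LinearMap.range f = ⊤ := LinearMap.range_eq_top.2 (LinearMap.surjective hf)
  rw [h2] at h1
  simp at h1
  omega

lemma exists_inter {W V : Submodule ℝ (Fin 3 → ℝ)} (hW : Module.finrank ℝ W = 2)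
    (hV : Module.finrank ℝ V = 2) (h : V ≠ W) :
    ∃ β : Fin 3 → ℝ, β ≠ 0 ∧ β ∈ V ∧ β ∈ W ∧ ∀ v ∈ V, v ∈ W → ∃ c : ℝ, v = c • β := by
  have h1 := Submodule.finrank_sup_add_finrank_inf_eq V W
  have h3 : 2 < Module.finrank ℝ (V ⊔ W : Submodule ℝ (Fin 3 → ℝ)) := by
    rw [← hV]
    apply Submodule.finrank_lt_finrank_of_lt
    refine lt_of_le_of_ne le_sup_left ?_
    intro he
    have : W ≤ V := by rw [he]; exact le_sup_right
    exact h (Submodule.eq_of_le_of_finrank_eq this (by rw [hV, hW])).symm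
  have h4 : Module.finrank ℝ (V ⊔ W : Submodule ℝ (Fin 3 → ℝ)) ≤ 3 := by
    simpa using Submodule.finrank_le (V ⊔ W)
  have h5 : Module.finrank ℝ (V ⊓ W : Submodule ℝ (Fin 3 → ℝ)) = 1 := by omega
  obtain ⟨⟨β, hβ⟩, hne, hall⟩ := finrank_eq_one_iff'.1 h5
  refine ⟨β, by simpa using hne, hβ.1, hβ.2, fun v hv hw => ?_⟩
  obtain ⟨c, hc⟩ := hall ⟨v, hv, hw⟩
  exact ⟨c, by simpa using (congrArg Subtype.val hc).symm⟩

/-- ordinary pairs -/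
def OrdPair (B : Finset RP2) (p : RP2 × RP2) : Prop := ∀ t ∈ B, t ≠ p.2 → ¬ Col p.1 p.2 t

lemma ordLines_finite (P : Finset RP2) :
    {L : Set RP2 | IsProjLine L ∧ ((P : Set RP2) ∩ L).ncard = 2}.Finite := by
  apply Set.Finite.of_finite_image (f := fun L => (P : Set RP2) ∩ L)
  · apply Set.Finite.subset P.finite_toSet.finite_subsets
    rintro _ ⟨L, -, rfl⟩
    exact Set.inter_subset_left
  · rintro L ⟨⟨W, hW, rfl⟩, hL⟩ L' ⟨⟨W', hW', rfl⟩, -⟩ he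
    obtain ⟨a, x, hax, hS⟩ := Set.ncard_eq_two.1 hL
    simp only at he
    have ha : a ∈ (P : Set RP2) ∩ {x | x.submodule ≤ W} := by rw [hS]; simp
    have hx : x ∈ (P : Set RP2) ∩ {x | x.submodule ≤ W} := by rw [hS]; simp
    have e1 := sup_eq hax hW ha.2 hx.2
    rw [he] at ha hx
    have e2 := sup_eq hax hW' ha.2 hx.2
    rw [← e1, ← e2]

open Classical in
lemma ord_count (P A B : Finset RP2) (W : Submodule ℝ (Fin 3 → ℝ))
    (hW : Module.finrank ℝ W = 2) (hP : P = A ∪ B) (hA : ∀ a ∈ A, a.submodule ≤ W)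
    (hB : ∀ x ∈ B, ¬ x.submodule ≤ W) :
    ((A ×ˢ B).filter (OrdPair B)).card ≤ numOrdinaryLines (P : Set RP2) := by
  unfold numOrdinaryLines
  rw [← Set.ncard_coe_finset]
  have key : ∀ p ∈ (A ×ˢ B).filter (OrdPair B), p.1 ∈ A ∧ p.2 ∈ B ∧ p.1 ≠ p.2 ∧
      (P : Set RP2) ∩ {t | t.submodule ≤ p.1.submodule ⊔ p.2.submodule} = {p.1, p.2} := by
    rintro ⟨a, x⟩ hp
    rw [Finset.mem_filter, Finset.mem_product] at hp
    obtain ⟨⟨ha, hx⟩, ho⟩ := hp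
    simp only at ha hx
    have hne : a ≠ x := by rintro rfl; exact hB _ hx (hA _ ha)
    refine ⟨ha, hx, hne, ?_⟩
    ext t
    simp only [hP, Finset.coe_union, Set.mem_inter_iff, Set.mem_union, Finset.mem_coe,
      Set.mem_ofPred_eq, Set.mem_insert_iff, Set.mem_singleton_iff]
    constructor
    · rintro ⟨ht | ht, hc⟩
      · left
        by_contra hta
        have e := sup_eq (Ne.symm hta) (finrank_sup hne) le_sup_left hc
        have e2 := sup_eq (Ne.symm hta) hW (hA a ha) (hA t ht)
        apply hB x hx
        rw [← e2, e]
        exact le_sup_right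
      · right
        by_contra htx
        exact ho t ht htx hc
    · rintro (rfl | rfl)
      · exact ⟨Or.inl ha, le_sup_left⟩
      · exact ⟨Or.inr hx, le_sup_right⟩
  refine Set.ncard_le_ncard_of_injOn
    (fun p : RP2 × RP2 => {t : RP2 | t.submodule ≤ p.1.submodule ⊔ p.2.submodule}) ?_ ?_
    (ordLines_finite P)
  · intro p hp
    obtain ⟨-, -, hne, h⟩ := key p hp
    exact ⟨⟨_, finrank_sup hne, rfl⟩, by rw [h]; exact Set.ncard_pair hne⟩
  · intro p hp q hq he
    obtain ⟨h1, h2, hne, h⟩ := key p hp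
    obtain ⟨h1', h2', hne', h'⟩ := key q hq
    simp only at he
    rw [he, h'] at h
    have hpa : p.1 ∈ ({q.1, q.2} : Set RP2) := by rw [h]; simp
    have hpx : p.2 ∈ ({q.1, q.2} : Set RP2) := by rw [h]; simp
    simp only [Set.mem_insert_iff, Set.mem_singleton_iff] at hpa hpx
    have ea : p.1 = q.1 := by
      rcases hpa with e | e
      · exact e
      · exact absurd (hA _ h1) (e ▸ hB _ h2')
    have ex : p.2 = q.2 := by
      rcases hpx with e | e
      · exact absurd (hA _ h1') (e ▸ hB _ h2)
      · exact e
    exact Prod.ext ea ex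

/-- the third point determines the direction -/
lemma col_unique {a a' x t : RP2} {W : Submodule ℝ (Fin 3 → ℝ)}
    (hW : Module.finrank ℝ W = 2) (ha : a.submodule ≤ W) (ha' : a'.submodule ≤ W)
    (hx : ¬ x.submodule ≤ W) (hxt : t ≠ x) (h : Col a x t) (h' : Col a' x t) : a = a' := by
  by_contra hne
  have hax : a ≠ x := by rintro rfl; exact hx ha
  have hax' : a' ≠ x := by rintro rfl; exact hx ha'
  have e1 := sup_eq hxt (finrank_sup hax) h le_sup_right
  have e2 := sup_eq hxt (finrank_sup hax') h' le_sup_right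
  have e3 := sup_eq hne hW ha ha'
  have e4 : a.submodule ⊔ a'.submodule = a.submodule ⊔ x.submodule :=
    sup_eq hne (finrank_sup hax) le_sup_left (by rw [← e1, e2]; exact le_sup_left)
  apply hx
  rw [← e3, e4]
  exact le_sup_right

open Classical in
lemma pair_count (A B X A' T : Finset RP2) (W : Submodule ℝ (Fin 3 → ℝ))
    (hW : Module.finrank ℝ W = 2) (hA : ∀ a ∈ A, a.submodule ≤ W)
    (hB : ∀ x ∈ B, ¬ x.submodule ≤ W) (hX : X ⊆ B) (hA' : A' ⊆ A)
    (hT : ∀ x ∈ X, ∀ a ∈ A', ∀ t ∈ B, t ≠ x → Col a x t → t ∈ T) :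
    X.card * A'.card ≤ ((A ×ˢ B).filter (OrdPair B)).card + X.card * T.card := by
  have h1 : A' ×ˢ X ⊆ (A ×ˢ B).filter (OrdPair B) ∪
      (A' ×ˢ X).filter (fun p => ¬ OrdPair B p) := by
    intro p hp
    rw [Finset.mem_union, Finset.mem_filter, Finset.mem_filter]
    by_cases ho : OrdPair B p
    · left
      rw [Finset.mem_product] at hp
      exact ⟨Finset.mem_product.2 ⟨hA' hp.1, hX hp.2⟩, ho⟩
    · exact Or.inr ⟨hp, ho⟩
  have h2 : ((A' ×ˢ X).filter (fun p => ¬ OrdPair B p)).card ≤ (X ×ˢ T).card := by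
    have hch : ∀ p ∈ (A' ×ˢ X).filter (fun p => ¬ OrdPair B p),
        ∃ t, t ∈ B ∧ t ≠ p.2 ∧ Col p.1 p.2 t := by
      intro p hp
      have := (Finset.mem_filter.1 hp).2
      unfold OrdPair at this
      push Not at this
      exact this
    choose! τ hτ using hch
    refine Finset.card_le_card_of_injOn (fun p => (p.2, τ p)) ?_ ?_
    · intro p hp
      obtain ⟨t1, t2, t3⟩ := hτ p hp
      have hp' := Finset.mem_product.1 (Finset.mem_filter.1 hp).1
      exact Finset.mem_coe.2 (Finset.mem_product.2 ⟨hp'.2, hT _ hp'.2 _ hp'.1 _ t1 t2 t3⟩)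
    · intro p hp q hq he
      obtain ⟨t1, t2, t3⟩ := hτ p hp
      obtain ⟨t1', t2', t3'⟩ := hτ q hq
      have hp' := Finset.mem_product.1 (Finset.mem_filter.1 hp).1
      have hq' := Finset.mem_product.1 (Finset.mem_filter.1 hq).1
      simp only [Prod.mk.injEq] at he
      obtain ⟨e1, e2⟩ := he
      rw [← e1, ← e2] at t3'
      exact Prod.ext (col_unique hW (hA _ (hA' hp'.1)) (hA _ (hA' hq'.1)) (hB _ (hX hp'.2))
        t2 t3 t3') e1
  have h3 := Finset.card_le_card h1
  have h4 := Finset.card_union_le ((A ×ˢ B).filter (OrdPair B))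
    ((A' ×ˢ X).filter (fun p => ¬ OrdPair B p))
  rw [Finset.card_product] at h2 h3
  rw [mul_comm X.card A'.card]
  omega

open Classical in
lemma trim (m k : ℕ) (hm : 0 < m) (A B : Finset RP2) (W : Submodule ℝ (Fin 3 → ℝ))
    (hW : Module.finrank ℝ W = 2) (hA : ∀ a ∈ A, a.submodule ≤ W)
    (hB : ∀ x ∈ B, ¬ x.submodule ≤ W) (V : Fin m → Submodule ℝ (Fin 3 → ℝ))
    (hV : ∀ j, Module.finrank ℝ (V j) = 2) (hcov : ∀ x ∈ B, ∃ j, x.submodule ≤ V j)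
    (hBk : 2 * m * k < B.card) (hAm : m < A.card) :
    ∃ X A' T : Finset RP2, X ⊆ B ∧ A' ⊆ A ∧ X.card = k ∧ A.card ≤ m + 2 * m * A'.card ∧
      T.card ≤ 2 * m * k ∧ ∀ x ∈ X, ∀ a ∈ A', ∀ t ∈ B, t ≠ x → Col a x t → t ∈ T := by
  obtain ⟨f, hf⟩ := exists_functional hW
  have fW : ∀ v, f v = 0 ↔ v ∈ W := fun v => by rw [← hf, LinearMap.mem_ker]
  have hf0 : ∀ x ∈ B, f x.rep ≠ 0 := fun x hx h =>
    hB x hx ((submodule_le_iff x W).2 ((fW _).1 h))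
  have hfA : ∀ a ∈ A, f a.rep = 0 := fun a ha => (fW _).2 ((submodule_le_iff a W).1 (hA a ha))
  obtain ⟨x0, hx0⟩ : B.Nonempty := Finset.card_pos.1 (by omega)
  have hAB : ∀ a ∈ A, ∀ x ∈ B, a ≠ x := by
    rintro a ha x hx rfl
    exact hB _ hx (hA _ ha)
  have hg : ∀ a ∈ A, ∃ g : (Fin 3 → ℝ) →ₗ[ℝ] ℝ,
      LinearMap.ker g = a.submodule ⊔ x0.submodule := fun a ha =>
    exists_functional (finrank_sup (hAB a ha x0 hx0))
  choose! g hg using hg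
  let N : RP2 → (Fin 3 → ℝ) := fun x => (f x.rep)⁻¹ • x.rep
  have hN1 : ∀ x ∈ B, f (N x) = 1 := by
    intro x hx
    simp only [N, map_smul, smul_eq_mul]
    exact inv_mul_cancel₀ (hf0 x hx)
  have hNmem : ∀ x (U : Submodule ℝ (Fin 3 → ℝ)), x.submodule ≤ U → N x ∈ U := fun x U h =>
    U.smul_mem _ ((submodule_le_iff x U).1 h)
  have hrep : ∀ x ∈ B, x.rep = f x.rep • N x := by
    intro x hx
    simp only [N]
    rw [smul_smul, mul_inv_cancel₀ (hf0 x hx), one_smul]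
  have hNinj : ∀ x ∈ B, ∀ y, N x = N y → x = y := by
    intro x hx y h
    apply eq_of_rep_mem
    rw [hrep x hx, h]
    exact Submodule.smul_mem _ _ (hNmem y _ le_rfl)
  have hcol : ∀ a ∈ A, ∀ x ∈ B, ∀ t ∈ B, Col a x t → g a (N t) = g a (N x) := by
    intro a ha x hx t ht h
    have h1 := hNmem t _ h
    rw [Submodule.mem_sup] at h1
    obtain ⟨p, hp, q, hq, hpq⟩ := h1
    rw [Projectivization.submodule_eq, Submodule.mem_span_singleton] at hp hq
    obtain ⟨c, rfl⟩ := hp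
    obtain ⟨d, rfl⟩ := hq
    have h2 := congrArg f hpq
    rw [hN1 t ht, map_add, map_smul, map_smul, hfA a ha, smul_zero, zero_add, smul_eq_mul] at h2
    have hd : d = (f x.rep)⁻¹ := eq_inv_of_mul_eq_one_left h2
    have h3 : g a a.rep = 0 := by
      rw [← LinearMap.mem_ker, hg a ha]
      exact Submodule.mem_sup_left (rep_mem_self a)
    rw [← hpq, hd, map_add, map_smul, h3, smul_zero, zero_add]
  have hβ : ∀ j, ∃ β : Fin 3 → ℝ, ∃ σ : RP2 → ℝ,
      (V j ≠ W → β ≠ 0 ∧ β ∈ V j ∧ β ∈ W) ∧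
      ∀ x ∈ B, ∀ y ∈ B, x.submodule ≤ V j → y.submodule ≤ V j →
        N x - N y = (σ x - σ y) • β := by
    intro j
    by_cases h : V j = W
    · exact ⟨0, 0, fun h' => absurd h h', fun x hx y hy h1 h2 => absurd (h ▸ h1) (hB x hx)⟩
    · obtain ⟨β, h0, h1, h2, h3⟩ := exists_inter hW (hV j) h
      obtain ⟨i, hi⟩ := Function.ne_iff.1 h0
      refine ⟨β, fun x => N x i / β i, fun _ => ⟨h0, h1, h2⟩, ?_⟩
      intro x hx y hy hxV hyV
      obtain ⟨c, hc⟩ := h3 (N x - N y) ((V j).sub_mem (hNmem x _ hxV) (hNmem y _ hyV))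
        ((fW _).1 (by rw [map_sub, hN1 x hx, hN1 y hy, sub_self]))
      have hi' : β i ≠ 0 := hi
      have h4 : N x i - N y i = c * β i := by simpa using congrFun hc i
      rw [hc, ← sub_div, h4, mul_div_cancel_right₀ _ hi']
  choose β σ hβ1 hβ2 using hβ
  have hgβ : ∀ a ∈ A, ∀ j, V j ≠ W → ¬ a.submodule ≤ V j → g a (β j) ≠ 0 := by
    intro a ha j hj haj h0
    obtain ⟨b0, b1, b2⟩ := hβ1 j hj
    rw [← LinearMap.mem_ker, hg a ha, Submodule.mem_sup] at h0
    obtain ⟨p, hp, q, hq, hpq⟩ := h0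
    rw [Projectivization.submodule_eq, Submodule.mem_span_singleton] at hp hq
    obtain ⟨c, rfl⟩ := hp
    obtain ⟨d, rfl⟩ := hq
    have h2 := congrArg f hpq
    rw [(fW _).2 b2, map_add, map_smul, map_smul, hfA a ha, smul_zero, zero_add, smul_eq_mul] at h2
    have hd : d = 0 := (mul_eq_zero.1 h2).resolve_right (hf0 x0 hx0)
    rw [hd, zero_smul, add_zero] at hpq
    have hc : c ≠ 0 := by
      rintro rfl
      rw [zero_smul] at hpq
      exact b0 hpq.symm
    apply haj
    rw [submodule_le_iff]
    have := (V j).smul_mem c⁻¹ b1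
    rwa [← hpq, smul_smul, inv_mul_cancel₀ hc, one_smul] at this
  -- ends
  have hH := fun e : Fin m × Bool => exists_top (B.filter (fun x => x.submodule ≤ V e.1))
    (fun x => if e.2 then σ e.1 x else - σ e.1 x) k
  choose H hHS hHk hHor hHtop using hH
  set T : Finset RP2 := Finset.univ.biUnion H with hTdef
  have hTk : T.card ≤ 2 * m * k := by
    have h := Finset.card_biUnion_le_card_mul (Finset.univ : Finset (Fin m × Bool)) H k
      (fun e _ => hHk e)
    have h2 : (Finset.univ : Finset (Fin m × Bool)).card = 2 * m := by
      simp [mul_comm]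
    rwa [h2] at h
  have hQ : (B \ T).Nonempty := by
    rw [Finset.sdiff_nonempty]
    intro h
    have := Finset.card_le_card h
    omega
  set G : Finset RP2 := A.filter (fun a => ∀ j, V j ≠ W → ¬ a.submodule ≤ V j) with hGdef
  have hGA : A.card ≤ m + G.card := by
    have h1 : A ⊆ (Finset.univ.biUnion
        (fun j : Fin m => A.filter (fun a => V j ≠ W ∧ a.submodule ≤ V j))) ∪ G := by
      intro a ha
      rw [Finset.mem_union]
      by_cases h : ∀ j, V j ≠ W → ¬ a.submodule ≤ V j
      · exact Or.inr (Finset.mem_filter.2 ⟨ha, h⟩)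
      · left
        push Not at h
        obtain ⟨j, h1, h2⟩ := h
        exact Finset.mem_biUnion.2 ⟨j, Finset.mem_univ _, Finset.mem_filter.2 ⟨ha, h1, h2⟩⟩
    have h2 : (Finset.univ.biUnion
        (fun j : Fin m => A.filter (fun a => V j ≠ W ∧ a.submodule ≤ V j))).card ≤ m := by
      have h := Finset.card_biUnion_le_card_mul (Finset.univ : Finset (Fin m))
        (fun j : Fin m => A.filter (fun a => V j ≠ W ∧ a.submodule ≤ V j)) 1 ?_
      · simpa using h
      · intro j _
        rw [Finset.card_le_one]
        intro a ha b hb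
        rw [Finset.mem_filter] at ha hb
        by_contra hab
        exact ha.2.1 ((sup_eq hab (hV j) ha.2.2 hb.2.2).symm.trans
          (sup_eq hab hW (hA a ha.1) (hA b hb.1)))
    have h3 := Finset.card_le_card h1
    have h4 := Finset.card_union_le (Finset.univ.biUnion
        (fun j : Fin m => A.filter (fun a => V j ≠ W ∧ a.submodule ≤ V j))) G
    omega
  have hend : ∀ a ∈ G, ∃ e : Fin m × Bool, (H e).card = k ∧
      ∀ x ∈ H e, ∀ y ∈ B \ T, g a (N y) < g a (N x) := by
    intro a haG
    obtain ⟨ha, hbad⟩ := Finset.mem_filter.1 haG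
    obtain ⟨v, hv, hmax⟩ := Finset.exists_max_image (B \ T) (fun y => g a (N y)) hQ
    obtain ⟨hvB, hvT⟩ := Finset.mem_sdiff.1 hv
    obtain ⟨j, hj⟩ := hcov v hvB
    have hjW : V j ≠ W := fun h => hB v hvB (h ▸ hj)
    have hc := hgβ a ha j hjW (hbad j hjW)
    have hvH : ∀ e, v ∉ H e := fun e h =>
      hvT (Finset.mem_biUnion.2 ⟨e, Finset.mem_univ _, h⟩)
    refine ⟨(j, decide (0 < g a (β j))), ?_, ?_⟩
    · refine (hHor _).resolve_left ?_
      intro h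
      apply hvH (j, decide (0 < g a (β j)))
      rw [h]
      exact Finset.mem_filter.2 ⟨hvB, hj⟩
    · intro x hx y hy
      refine lt_of_le_of_lt (hmax y hy) ?_
      have hxS := Finset.mem_filter.1 (hHS _ hx)
      have htop := hHtop _ x hx v (Finset.mem_filter.2 ⟨hvB, hj⟩) (hvH _)
      have hdiff := hβ2 j x hxS.1 v hvB hxS.2 hj
      have hne : σ j x - σ j v ≠ 0 := by
        intro h
        rw [h, zero_smul, sub_eq_zero] at hdiff
        have := hNinj x hxS.1 v hdiff
        rw [this] at hx
        exact hvH _ hx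
      have h5 : g a (N x) - g a (N v) = (σ j x - σ j v) * g a (β j) := by
        rw [← map_sub, hdiff, map_smul, smul_eq_mul]
      have h6 : 0 < (σ j x - σ j v) * g a (β j) := by
        rcases lt_or_gt_of_ne hc with h | h
        · simp only [not_lt.2 h.le, decide_false] at htop
          simp at htop
          exact mul_pos_of_neg_of_neg (lt_of_le_of_ne (by linarith) hne) h
        · simp only [h, decide_true, if_true] at htop
          exact mul_pos (lt_of_le_of_ne (by linarith) hne.symm) h
      linarith
  haveI : Nonempty (Fin m × Bool) := ⟨(⟨0, hm⟩, true)⟩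
  choose! e he1 he2 using hend
  have hne : (Finset.univ : Finset (Fin m × Bool)).Nonempty := ⟨(⟨0, hm⟩, true), Finset.mem_univ _⟩
  obtain ⟨E, -, hE⟩ := Finset.exists_max_image Finset.univ
    (fun E => (G.filter (fun a => e a = E)).card) hne
  have hpig := Finset.card_le_mul_card_image_of_maps_to (s := G) (t := Finset.univ) (f := e)
    (fun a _ => Finset.mem_univ _) ((G.filter (fun a => e a = E)).card) (fun b hb => hE b hb)
  have h2 : (Finset.univ : Finset (Fin m × Bool)).card = 2 * m := by
    simp [mul_comm]
  rw [h2, mul_comm] at hpig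
  have hpos : 0 < (G.filter (fun a => e a = E)).card := by
    rcases Nat.eq_zero_or_pos (G.filter (fun a => e a = E)).card with h | h
    · rw [h] at hpig
      omega
    · exact h
  obtain ⟨a0, ha0⟩ := Finset.card_pos.1 hpos
  obtain ⟨ha0G, rfl⟩ := Finset.mem_filter.1 ha0
  refine ⟨H (e a0), G.filter (fun a => e a = e a0), T, ?_, ?_, he1 a0 ha0G, by omega, hTk, ?_⟩
  · exact (hHS _).trans (Finset.filter_subset _ _)
  · exact (Finset.filter_subset _ _).trans (Finset.filter_subset _ _)
  · intro x hx a ha t ht htx hc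
    obtain ⟨haG, hea⟩ := Finset.mem_filter.1 ha
    by_contra htT
    have haA := (Finset.mem_filter.1 haG).1
    have h1 := he2 a haG x (by rw [hea]; exact hx) t (Finset.mem_sdiff.2 ⟨ht, htT⟩)
    have h3 := hcol a haA x (Finset.mem_filter.1 (hHS _ hx)).1 t ht hc
    exact absurd h3 h1.ne

/-- If a large set of `n` points lying on a union of `m` lines spans at most `K n`
ordinary lines, then some single line contains all but at most `3K` of the points. -/
theorem few_lines_structure (m : ℕ) (hm : 0 < m) (K : ℝ) (hK : 1 ≤ K) :
    ∃ n₀ : ℕ, 0 < n₀ ∧ ∀ n : ℕ, n₀ ≤ n →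
      ∀ (P : Set RP2) (ℓ : Fin m → Set RP2),
        P.Finite → P.ncard = n →
        (∀ i, IsProjLine (ℓ i)) →
        P ⊆ ⋃ i, ℓ i →
        (numOrdinaryLines P : ℝ) ≤ K * n →
        ∃ L : Set RP2, IsProjLine L ∧ ((P \ L).ncard : ℝ) ≤ 3 * K := by
  classical
  obtain ⟨k, hk⟩ : ∃ k : ℕ, 4 * (m : ℝ) ^ 2 * K ≤ k := exists_nat_ge _
  have hm1 : (1 : ℝ) ≤ m := by exact_mod_cast hm
  have hkpos : (0 : ℝ) < k := by
    refine lt_of_lt_of_le ?_ hk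
    positivity
  refine ⟨2 * m ^ 2 + 8 * m ^ 3 * k + 6 * m * k + 1, by omega, ?_⟩
  intro n hn P0 ℓ hfin hcard hℓ hcov hord
  obtain ⟨P, rfl⟩ := hfin.exists_finset_coe
  rw [Set.ncard_coe_finset] at hcard
  choose V hV hℓV using hℓ
  obtain ⟨i, -, hi⟩ := Finset.exists_max_image Finset.univ
    (fun j : Fin m => (P.filter (fun x : RP2 => x.submodule ≤ V j)).card) ⟨⟨0, hm⟩, Finset.mem_univ _⟩
  have hcovP : ∀ x ∈ P, ∃ j, x.submodule ≤ V j := by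
    intro x hx
    obtain ⟨j, hj⟩ := Set.mem_iUnion.1 (hcov hx)
    rw [hℓV j] at hj
    exact ⟨j, hj⟩
  set A := P.filter (fun x : RP2 => x.submodule ≤ V i) with hAdef
  set B := P.filter (fun x : RP2 => ¬ x.submodule ≤ V i) with hBdef
  have hAcard : n ≤ m * A.card := by
    have h1 : P ⊆ Finset.univ.biUnion
        (fun j : Fin m => P.filter (fun x : RP2 => x.submodule ≤ V j)) := by
      intro x hx
      obtain ⟨j, hj⟩ := hcovP x hx
      exact Finset.mem_biUnion.2 ⟨j, Finset.mem_univ _, Finset.mem_filter.2 ⟨hx, hj⟩⟩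
    have h2 := Finset.card_biUnion_le_card_mul (Finset.univ : Finset (Fin m))
      (fun j : Fin m => P.filter (fun x : RP2 => x.submodule ≤ V j)) A.card hi
    have h3 := Finset.card_le_card h1
    rw [Finset.card_univ, Fintype.card_fin] at h2
    omega
  have hPAB : P = A ∪ B := (Finset.filter_union_filter_not_eq _ _).symm
  have hsum : A.card + B.card = n := by
    rw [← hcard]
    exact Finset.card_filter_add_card_filter_not _
  have hA : ∀ a ∈ A, a.submodule ≤ V i := fun a ha => (Finset.mem_filter.1 ha).2
  have hB : ∀ x ∈ B, ¬ x.submodule ≤ V i := fun a ha => (Finset.mem_filter.1 ha).2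
  have hO := ord_count P A B (V i) (hV i) hPAB hA hB
  have hO' : ((((A ×ˢ B).filter (OrdPair B)).card : ℕ) : ℝ) ≤ K * n :=
    le_trans (by exact_mod_cast hO) hord
  set O := ((A ×ˢ B).filter (OrdPair B)).card with hOdef
  have hnR : (2 * (m : ℝ) ^ 2 + 8 * m ^ 3 * k + 6 * m * k + 1) ≤ n := by exact_mod_cast hn
  by_cases hbig : 2 * m * k < B.card
  · exfalso
    have hAm : m < A.card := by
      by_contra h
      push Not at h
      have h1 : m * A.card ≤ m * m := Nat.mul_le_mul_left _ h
      nlinarith [Nat.zero_le (8 * m ^ 3 * k), Nat.zero_le (6 * m * k)]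
    obtain ⟨X, A', T, hX, hA', hXk, hAA', hTk, hT⟩ := trim m k hm A B (V i) (hV i) hA hB V hV
      (fun x hx => hcovP x (Finset.mem_filter.1 hx).1) hbig hAm
    have hc := pair_count A B X A' T (V i) (hV i) hA hB hX hA' hT
    rw [hXk, ← hOdef] at hc
    have c1 : (k : ℝ) * A'.card ≤ O + k * T.card := by exact_mod_cast hc
    have c2 : (n : ℝ) ≤ m * A.card := by exact_mod_cast hAcard
    have c3 : (A.card : ℝ) ≤ m + 2 * m * A'.card := by exact_mod_cast hAA'
    have c4 : (T.card : ℝ) ≤ 2 * m * k := by exact_mod_cast hTk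
    have d1 : (n : ℝ) ≤ m * (m + 2 * m * A'.card) :=
      c2.trans (mul_le_mul_of_nonneg_left c3 (by positivity))
    have d2 : (k : ℝ) * T.card ≤ k * (2 * m * k) := mul_le_mul_of_nonneg_left c4 hkpos.le
    have d3 : (k : ℝ) * A'.card ≤ K * n + k * (2 * m * k) := by linarith
    have d4 : (k : ℝ) * n ≤ k * (m * (m + 2 * m * A'.card)) :=
      mul_le_mul_of_nonneg_left d1 hkpos.le
    have d5 : 2 * (m : ℝ) ^ 2 * (k * A'.card) ≤ 2 * (m : ℝ) ^ 2 * (K * n + k * (2 * m * k)) :=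
      mul_le_mul_of_nonneg_left d3 (by positivity)
    have d6 : 4 * (m : ℝ) ^ 2 * K * n ≤ k * n :=
      mul_le_mul_of_nonneg_right hk (by positivity)
    have d7 : (k : ℝ) * n ≤ k * (2 * m ^ 2 + 8 * m ^ 3 * k) := by nlinarith
    have d8 := le_of_mul_le_mul_left d7 hkpos
    have d9 : (0 : ℝ) ≤ 6 * m * k := by positivity
    linarith
  · push Not at hbig
    refine ⟨ℓ i, ⟨V i, hV i, hℓV i⟩, ?_⟩
    have hPL : (P : Set RP2) \ ℓ i = (B : Set RP2) := by
      rw [hℓV i]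
      ext x
      simp [hBdef]
    rw [hPL, Set.ncard_coe_finset]
    by_contra hlt
    push Not at hlt
    have hc := pair_count A B B A B (V i) (hV i) hA hB subset_rfl subset_rfl
      (fun x _ a _ t ht _ _ => ht)
    rw [← hOdef] at hc
    have c1 : (B.card : ℝ) * A.card ≤ O + B.card * B.card := by exact_mod_cast hc
    have c2 : (A.card : ℝ) + B.card = n := by exact_mod_cast hsum
    have c3 : (B.card : ℝ) ≤ 2 * m * k := by exact_mod_cast hbig
    have hBpos : (0 : ℝ) < B.card := by linarith
    have c4 : (A.card : ℝ) = n - B.card := by linarith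
    rw [c4] at c1
    have hn0 : (0 : ℝ) ≤ n := by positivity
    have d1 : 3 * K * n ≤ B.card * n := mul_le_mul_of_nonneg_right hlt.le hn0
    have d2 : (B.card : ℝ) * n ≤ B.card * (3 * B.card) := by nlinarith
    have d3 := le_of_mul_le_mul_left d2 hBpos
    have d4 : (0 : ℝ) ≤ 2 * m ^ 2 + 8 * m ^ 3 * k := by positivity
    linarith
end
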